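/- Let p be an odd prime. For all integers k ≥ 1, all η > 0, and all polynomial growth functions ρ of degree d, there exist constants c, C > 0 and δ₀ > 0 such that for all 0 < δ < δ₀ there is N such that for all n ≥ N the following holds: for every A ⊆ 𝔽_p^n with VC₂-dimension at most k, there exists a quadratic factor 𝓑 on 𝔽_p^n of complexity (ℓ,q) and rank at least ρ(ℓ+q) such that (1) ℓ ≤ p^(p^(p^(p^(C·δ^(−c))))), (2) q ≤ (k+η)·log_p(δ^(−1)), and (3) there is a set Y which is a union of atoms of 𝓑 with |A △ Y| ≤ δ·p^n. Moreover, if d = 1 one can additionally ensure ℓ ≤ p^(p^(p^(C·δ^(−c)))). -/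

import Mathlib

open scoped BigOperators symmDiff
open Finset

attribute [local instance] Classical.propDecidable

namespace PaperTS

noncomputable section

/-- The group `𝔽_p^n`, written additively. -/
abbrev Vec (p n : ℕ) := Fin n → ZMod p

/-- Dot product on `𝔽_p^n`. -/
def dot {p n : ℕ} (x y : Vec p n) : ZMod p := ∑ i, x i * y i

/-- A quadratic factor of complexity `(ℓ, q)` on `𝔽_p^n`: a set of `ℓ` linearly independent
vectors together with a set of `q` pairwise distinct symmetric matrices. -/
structure QuadFactor (p n ℓ q : ℕ) where
  L : Fin ℓ → Vec p n
  Q : Fin q → Matrix (Fin n) (Fin n) (ZMod p)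
  linIndep : LinearIndependent (ZMod p) L
  symm : ∀ j, (Q j).IsSymm
  inj : Function.Injective Q

/-- Labels of atoms of a quadratic factor of complexity `(ℓ, q)`. -/
abbrev Label (p ℓ q : ℕ) := (Fin ℓ → ZMod p) × (Fin q → ZMod p)

namespace QuadFactor

variable {p n ℓ q : ℕ}

/-- The linear form `β_L`. -/
def betaL (B : QuadFactor p n ℓ q) (x : Vec p n) : Fin ℓ → ZMod p :=
  fun i => dot x (B.L i)

/-- The bilinear form `β_Q`. -/
def betaQ (B : QuadFactor p n ℓ q) (x y : Vec p n) : Fin q → ZMod p :=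
  fun j => dot x ((B.Q j).mulVec y)

/-- The labelling map `β_𝓑`. -/
def betaB (B : QuadFactor p n ℓ q) (x : Vec p n) : Label p ℓ q :=
  (B.betaL x, B.betaQ x x)

/-- The atom of `B` with label `ab`. -/
def atom (B : QuadFactor p n ℓ q) (ab : Label p ℓ q) : Set (Vec p n) :=
  {x | B.betaB x = ab}

/-- The fibre `β_Q^{-1}(d) ⊆ G × G`. -/
def fibQ (B : QuadFactor p n ℓ q) (d : Fin q → ZMod p) : Set (Vec p n × Vec p n) :=
  {xy | B.betaQ xy.1 xy.2 = d}

/-- The rank of a quadratic factor: `n` if `q = 0`, and otherwise the minimal rank of a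
nontrivial linear combination of the matrices. -/
def rank (B : QuadFactor p n ℓ q) : ℕ :=
  if q = 0 then n
  else sInf ((fun c : Fin q → ZMod p => (∑ j, c j • B.Q j).rank) '' {c | c ≠ 0})

end QuadFactor

/-- Refinement of quadratic factors: every atom of `B'` is contained in an atom of `B`. -/
def Refines {p n ℓ' q' ℓ q : ℕ} (B' : QuadFactor p n ℓ' q') (B : QuadFactor p n ℓ q) : Prop :=
  ∀ ab' : Label p ℓ' q', ∃ ab : Label p ℓ q, B'.atom ab' ⊆ B.atom ab

/-- `Σ(d)` for a tuple of labels `d = (d_a, d_b, d_c, d_ab, d_ac, d_bc)`. -/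
def SigmaD {p ℓ q : ℕ} (da db dc : Label p ℓ q) (dab dac dbc : Fin q → ZMod p) :
    Label p ℓ q :=
  (da.1 + db.1 + dc.1, da.2 + db.2 + dc.2 + 2 • dab + 2 • dac + 2 • dbc)

/-- Real-valued indicator function of a set. -/
def ind1 {G : Type*} (S : Set G) : G → ℝ := S.indicator 1

/-- Density of `A` on `P`. -/
def density {G : Type*} (A P : Set G) : ℝ := ((A ∩ P).ncard : ℝ) / (P.ncard : ℝ)

/-- Sum of `g` over a set in a fintype. -/
def setSum {α : Type*} [Fintype α] (s : Set α) (g : α → ℝ) : ℝ :=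
  ∑ x ∈ Finset.univ.filter (fun x => x ∈ s), g x

/-- Average of `g` over a set in a fintype. -/
def expOver {α : Type*} [Fintype α] (s : Set α) (g : α → ℝ) : ℝ :=
  setSum s g / (s.ncard : ℝ)

/-- The normalized indicator `μ_Γ` of `Γ ⊆ G × G`. -/
def mu {G : Type*} [Fintype G] (Γ : Set (G × G)) (xy : G × G) : ℝ :=
  ((Fintype.card G : ℝ) ^ 2 / (Γ.ncard : ℝ)) * ind1 Γ xy

/-- The product of the 8 values of `f` on the cube generated by `x, h₁, h₂, h₃`. -/
def cubeProd {G : Type*} [AddCommGroup G] (f : G → ℝ) (x h₁ h₂ h₃ : G) : ℝ :=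
  f x * f (x + h₁) * f (x + h₂) * f (x + h₃) * f (x + h₁ + h₂) * f (x + h₁ + h₃) *
    f (x + h₂ + h₃) * f (x + h₁ + h₂ + h₃)

/-- The eighth power of the (unnormalized) `U³` norm. -/
def U3pow8 {G : Type*} [AddCommGroup G] [Fintype G] (f : G → ℝ) : ℝ :=
  ∑ x : G, ∑ h₁ : G, ∑ h₂ : G, ∑ h₃ : G, cubeProd f x h₁ h₂ h₃

/-- The (unnormalized) `U³` norm. -/
def U3norm {G : Type*} [AddCommGroup G] [Fintype G] (f : G → ℝ) : ℝ :=
  U3pow8 f ^ ((1 : ℝ) / 8)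

/-- The Prendiville local `U³` norm of `f` relative to the set `B`
(equal to `0` when `‖1_B‖_{U³} = 0`, by the division-by-zero convention). -/
def U3localP {G : Type*} [AddCommGroup G] [Fintype G] (f : G → ℝ) (B : Set G) : ℝ :=
  U3norm (fun x => f x * ind1 B x) / U3norm (ind1 B)

/-- `Ω_B`: the 4-tuples all of whose associated cube points lie in `B`. -/
def Omega {G : Type*} [AddCommGroup G] (B : Set G) : Set (G × G × G × G) :=
  fun t =>
    match t with
    | (x, h₁, h₂, h₃) =>
        x ∈ B ∧ x + h₁ ∈ B ∧ x + h₂ ∈ B ∧ x + h₃ ∈ B ∧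
        x + h₁ + h₂ ∈ B ∧ x + h₁ + h₃ ∈ B ∧ x + h₂ + h₃ ∈ B ∧ x + h₁ + h₂ + h₃ ∈ B

/-- The change of variables `Ψ : G⁶ → G⁴`. -/
def Psi {G : Type*} [AddCommGroup G] : G × G × G × G × G × G → G × G × G × G :=
  fun t =>
    match t with
    | (x₁, x₂, y₁, y₂, z₁, z₂) => (x₁ + y₁ + z₁, x₂ - x₁, y₂ - y₁, z₂ - z₁)

/-- `K_{2,2,2}(d)`. -/
def K222 {p n ℓ q : ℕ} (B : QuadFactor p n ℓ q) (da db dc : Label p ℓ q)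
    (dab dac dbc : Fin q → ZMod p) :
    Set (Vec p n × Vec p n × Vec p n × Vec p n × Vec p n × Vec p n) :=
  fun t =>
    match t with
    | (x₁, x₂, y₁, y₂, z₁, z₂) =>
        B.betaB x₁ = da ∧ B.betaB x₂ = da ∧ B.betaB y₁ = db ∧ B.betaB y₂ = db ∧
        B.betaB z₁ = dc ∧ B.betaB z₂ = dc ∧
        B.betaQ x₁ y₁ = dab ∧ B.betaQ x₁ y₂ = dab ∧ B.betaQ x₂ y₁ = dab ∧ B.betaQ x₂ y₂ = dab ∧
        B.betaQ x₁ z₁ = dac ∧ B.betaQ x₁ z₂ = dac ∧ B.betaQ x₂ z₁ = dac ∧ B.betaQ x₂ z₂ = dac ∧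
        B.betaQ y₁ z₁ = dbc ∧ B.betaQ y₁ z₂ = dbc ∧ B.betaQ y₂ z₁ = dbc ∧ B.betaQ y₂ z₂ = dbc

/-- The product `∏_{i,j,k ∈ {1,2}} f (x_i + y_j + z_k)` for a 6-tuple. -/
def prod8 {G : Type*} [AddCommGroup G] (f : G → ℝ) :
    G × G × G × G × G × G → ℝ :=
  fun t =>
    match t with
    | (x₁, x₂, y₁, y₂, z₁, z₂) =>
        f (x₁ + y₁ + z₁) * f (x₁ + y₁ + z₂) * f (x₁ + y₂ + z₁) * f (x₁ + y₂ + z₂) *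
        f (x₂ + y₁ + z₁) * f (x₂ + y₁ + z₂) * f (x₂ + y₂ + z₁) * f (x₂ + y₂ + z₂)

/-- The eighth power of the Terry–Wolf local `U³` norm. -/
def TW8 {p n ℓ q : ℕ} [NeZero p] (B : QuadFactor p n ℓ q) (f : Vec p n → ℝ)
    (da db dc : Label p ℓ q) (dab dac dbc : Fin q → ZMod p) : ℝ :=
  expOver (B.atom da) fun x₀ => expOver (B.atom da) fun x₁ =>
  expOver (B.atom db) fun y₀ => expOver (B.atom db) fun y₁ =>
  expOver (B.atom dc) fun z₀ => expOver (B.atom dc) fun z₁ =>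
    (mu (B.fibQ dab) (x₀, y₀) * mu (B.fibQ dab) (x₀, y₁) *
     mu (B.fibQ dab) (x₁, y₀) * mu (B.fibQ dab) (x₁, y₁) *
     mu (B.fibQ dac) (x₀, z₀) * mu (B.fibQ dac) (x₀, z₁) *
     mu (B.fibQ dac) (x₁, z₀) * mu (B.fibQ dac) (x₁, z₁) *
     mu (B.fibQ dbc) (y₀, z₀) * mu (B.fibQ dbc) (y₀, z₁) *
     mu (B.fibQ dbc) (y₁, z₀) * mu (B.fibQ dbc) (y₁, z₁)) *
    prod8 f (x₀, x₁, y₀, y₁, z₀, z₁)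

/-- `A` has VC₂-dimension at least `k`. -/
def HasVC2Dim {G : Type*} [AddCommGroup G] (A : Set G) (k : ℕ) : Prop :=
  ∃ (a b : Fin k → G) (c : Set (Fin k × Fin k) → G),
    ∀ (i j : Fin k) (S : Set (Fin k × Fin k)), (a i + b j + c S ∈ A ↔ (i, j) ∈ S)

/-- `A` has VC₂-dimension at most `k`. -/
def VC2dimLE {G : Type*} [AddCommGroup G] (A : Set G) (k : ℕ) : Prop :=
  ∀ m : ℕ, HasVC2Dim A m → m ≤ k

/-- A growth function: an increasing function `ℝ → ℝ≥0`. -/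
def GrowthFunction (ρ : ℝ → ℝ) : Prop :=
  Monotone ρ ∧ ∀ x, 0 ≤ ρ x

/-- `ρ` is bounded by a polynomial of degree `d` on `[1, ∞)`. -/
def PolyBound (ρ : ℝ → ℝ) (d : ℕ) : Prop :=
  ∃ C > (0 : ℝ), ∀ x : ℝ, 1 ≤ x → ρ x ≤ C * x ^ d

/-- `ρ` is a polynomial growth function of degree (exactly) `d`, i.e. `d ≥ 1` is minimal
with `ρ(x) ≤ C x^d` for `x ≥ 1`. -/
def PolyGrowthDegree (ρ : ℝ → ℝ) (d : ℕ) : Prop :=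
  1 ≤ d ∧ PolyBound ρ d ∧ ∀ d' : ℕ, 1 ≤ d' → PolyBound ρ d' → d ≤ d'

/-- The index `ind(A, 𝒫)` of a partition. -/
def indx {p n : ℕ} (A : Set (Vec p n)) (Ps : Finset (Set (Vec p n))) : ℝ :=
  (∑ P ∈ Ps, density A P ^ 2 * (P.ncard : ℝ)) / (p : ℝ) ^ n

/-- `P` fails to be `δ`-uniform for `A` with respect to the localized `U³` norm. -/
def BadPart {G : Type*} [AddCommGroup G] [Fintype G] (δ : ℝ) (A P : Set G) : Prop :=
  δ * U3norm (ind1 P) < U3norm (fun x => (ind1 A x - density A P) * ind1 P x)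

/-- `ker(U)^⊥`, the orthogonal complement of the kernel of `U`. -/
def kerPerp {p n : ℕ} (U : Matrix (Fin n) (Fin n) (ZMod p)) : Set (Vec p n) :=
  {v | ∀ w : Vec p n, U.mulVec w = 0 → dot v w = 0}

/-- `B'` is a `ρ`-matrix deletion of `B`. -/
def IsMatrixDeletion {p n ℓ' q' ℓ q : ℕ} (ρ : ℝ → ℝ)
    (B' : QuadFactor p n ℓ' q') (B : QuadFactor p n ℓ q) : Prop :=
  q' + 1 = q ∧
  ∃ c : Fin q → ZMod p, c ≠ 0 ∧
    (((∑ j, c j • B.Q j).rank : ℝ) < ρ ((ℓ : ℝ) + (q : ℝ))) ∧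
    (∃ i : Fin q, c i ≠ 0 ∧ Set.range B'.Q = Set.range B.Q \ {B.Q i}) ∧
    Set.range B.L ⊆ Set.range B'.L ∧
    Submodule.span (ZMod p) (Set.range B'.L) =
      Submodule.span (ZMod p) (Set.range B.L ∪ kerPerp (∑ j, c j • B.Q j))

/-- The functions `τ_i^ρ : ℤ × ℤ → ℝ`. -/
def tau (ρ : ℝ → ℝ) : ℕ → ℤ × ℤ → ℝ
  | 0, xy => (xy.1 : ℝ)
  | i + 1, xy => tau ρ i xy + ρ (tau ρ i xy + (xy.2 : ℝ) - (i : ℝ))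

/-- `f_σ^ρ` for binary strings `σ : Fin m → ℤ` (with values in `{-1, 1}`). -/
def fseq (ρ : ℝ → ℝ) : (m : ℕ) → (Fin m → ℤ) → ℝ × ℝ
  | 0, _ => (0, 0)
  | m + 1, σ =>
      let ab := fseq ρ m (fun j => σ j.castSucc)
      if σ (Fin.last m) = 1 then (ab.1 + 1, ab.2 + 1)
      else (ab.1 + ρ (ab.1 + ab.2), ab.2 - 1)

end

open scoped ComplexConjugate Matrix Pointwise

section Characters

variable {p : ℕ} [Fact p.Prime]

/-- The standard additive character of `𝔽_p`. -/
noncomputable def chi (a : ZMod p) : ℂ := ZMod.stdAddChar a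

lemma chi_zero : chi (0 : ZMod p) = 1 := AddChar.map_zero_eq_one _

lemma chi_add (a b : ZMod p) : chi (a + b) = chi a * chi b := AddChar.map_add_eq_mul _ _ _

lemma norm_chi (a : ZMod p) : ‖chi a‖ = 1 := by
  rw [chi, ZMod.stdAddChar_apply]
  exact Circle.norm_coe _

lemma chi_neg (a : ZMod p) : chi (-a) = conj (chi a) := by
  have h : chi (-a) * chi a = 1 := by rw [← chi_add, neg_add_cancel, chi_zero]
  have h2 : conj (chi a) * chi a = 1 := by
    rw [mul_comm, Complex.mul_conj, Complex.normSq_eq_norm_sq, norm_chi]; simp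
  have h3 : chi a ≠ 0 := by
    rw [← norm_ne_zero_iff, norm_chi]; exact one_ne_zero
  exact mul_right_cancel₀ h3 (h.trans h2.symm)

lemma chi_sub (a b : ZMod p) : chi (a - b) = chi a * conj (chi b) := by
  rw [sub_eq_add_neg, chi_add, chi_neg]

lemma sum_chi_hom {V : Type*} [AddCommGroup V] [Fintype V] (ψ : V →+ ZMod p) :
    ∑ v, chi (ψ v) = if ψ = 0 then (Fintype.card V : ℂ) else 0 := by
  have h := AddChar.sum_eq_ite ((ZMod.stdAddChar (N := p)).compAddMonoidHom ψ)
  have h2 : (ZMod.stdAddChar (N := p)).compAddMonoidHom ψ = 0 ↔ ψ = 0 := by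
    constructor
    · intro h
      ext v
      have := DFunLike.congr_fun h v
      simp only [AddChar.compAddMonoidHom_apply, AddChar.zero_apply] at this
      rw [← AddChar.map_zero_eq_one (ZMod.stdAddChar (N := p))] at this
      exact ZMod.injective_stdAddChar this
    · rintro rfl
      ext v
      simp
  simp only [h2] at h
  exact h

lemma sum_chi_dot {n : ℕ} (ξ : Vec p n) :
    ∑ x : Vec p n, chi (ξ ⬝ᵥ x) = if ξ = 0 then (Fintype.card (Vec p n) : ℂ) else 0 := by
  let ψ : Vec p n →+ ZMod p :=
    { toFun := fun x => ξ ⬝ᵥ x, map_zero' := by simp, map_add' := fun x y => dotProduct_add _ _ _ }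
  have h := sum_chi_hom ψ
  have h2 : ψ = 0 ↔ ξ = 0 := by
    constructor
    · intro h
      ext i
      have := DFunLike.congr_fun h (Pi.single i 1)
      simpa [ψ] using this
    · rintro rfl
      ext x
      simp [ψ]
  simp only [h2] at h
  exact h

end Characters

section CauchySchwarz

lemma sq_norm_sum_mul_le {ι : Type*} (s : Finset ι) (a b : ι → ℂ) :
    ‖∑ i ∈ s, a i * b i‖ ^ 2 ≤ (∑ i ∈ s, ‖a i‖ ^ 2) * ∑ i ∈ s, ‖b i‖ ^ 2 := by
  calc ‖∑ i ∈ s, a i * b i‖ ^ 2 ≤ (∑ i ∈ s, ‖a i‖ * ‖b i‖) ^ 2 := by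
        gcongr
        exact (norm_sum_le _ _).trans_eq (by simp)
    _ ≤ _ := sum_mul_sq_le_sq_mul_sq _ _ _

lemma sq_norm_sum_mul_le_card {ι : Type*} [Fintype ι] (a b : ι → ℂ) (ha : ∀ i, ‖a i‖ ≤ 1) :
    ‖∑ i, a i * b i‖ ^ 2 ≤ (Fintype.card ι : ℝ) * ∑ i, ‖b i‖ ^ 2 := by
  refine (sq_norm_sum_mul_le _ a b).trans ?_
  gcongr
  calc ∑ i, ‖a i‖ ^ 2 ≤ ∑ _i : ι, (1 : ℝ) := by
        gcongr with i
        exact pow_le_one₀ (norm_nonneg _) (ha i)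
    _ = _ := by simp

lemma ofReal_sq_norm_sum {ι : Type*} (s : Finset ι) (b : ι → ℂ) :
    ((‖∑ i ∈ s, b i‖ ^ 2 : ℝ) : ℂ) = ∑ i ∈ s, ∑ j ∈ s, b i * conj (b j) := by
  rw [← Complex.normSq_eq_norm_sq, ← Complex.mul_conj, map_sum, sum_mul_sum]

end CauchySchwarz

section Fourier

variable {p : ℕ} [Fact p.Prime] {n : ℕ}

lemma sum_chi_dot' (ξ : Vec p n) :
    ∑ x : Vec p n, chi (x ⬝ᵥ ξ) = if ξ = 0 then (Fintype.card (Vec p n) : ℂ) else 0 := by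
  simp_rw [dotProduct_comm _ ξ]
  exact sum_chi_dot ξ

lemma parseval (F : Vec p n → ℂ) :
    ∑ ξ : Vec p n, ‖∑ x, F x * chi (ξ ⬝ᵥ x)‖ ^ 2 = Fintype.card (Vec p n) * ∑ x, ‖F x‖ ^ 2 := by
  have key : ((∑ ξ : Vec p n, ‖∑ x, F x * chi (ξ ⬝ᵥ x)‖ ^ 2 : ℝ) : ℂ)
      = ((Fintype.card (Vec p n) * ∑ x, ‖F x‖ ^ 2 : ℝ) : ℂ) := by
    rw [Complex.ofReal_sum]
    simp_rw [ofReal_sq_norm_sum]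
    calc ∑ ξ : Vec p n, ∑ x, ∑ y, F x * chi (ξ ⬝ᵥ x) * conj (F y * chi (ξ ⬝ᵥ y))
        = ∑ x, ∑ y, F x * conj (F y) * ∑ ξ : Vec p n, chi (ξ ⬝ᵥ (x - y)) := by
          rw [sum_comm]
          refine sum_congr rfl fun x _ => ?_
          rw [sum_comm]
          refine sum_congr rfl fun y _ => ?_
          rw [mul_sum]
          refine sum_congr rfl fun ξ _ => ?_
          rw [dotProduct_sub, chi_sub, map_mul]
          ring
      _ = ∑ x, F x * conj (F x) * Fintype.card (Vec p n) := by
          refine sum_congr rfl fun x _ => ?_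
          rw [sum_eq_single x]
          · rw [sum_chi_dot', if_pos (sub_self x)]
          · intro y _ hy
            rw [sum_chi_dot', if_neg (sub_ne_zero.2 hy.symm), mul_zero]
          · simp
      _ = _ := by
          push_cast
          rw [mul_sum]
          refine sum_congr rfl fun x _ => ?_
          rw [Complex.mul_conj, Complex.normSq_eq_norm_sq]
          push_cast
          ring
  exact_mod_cast key

/-- The autocorrelation of `g`. -/
noncomputable def autocorr {G : Type*} [AddCommGroup G] [Fintype G] (g : G → ℝ) (k : G) : ℝ :=
  ∑ x, g x * g (x + k)

lemma sq_norm_fourier (g : Vec p n → ℝ) (ξ : Vec p n) :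
    ((‖∑ x, (g x : ℂ) * chi (ξ ⬝ᵥ x)‖ ^ 2 : ℝ) : ℂ) = ∑ k, (autocorr g k : ℂ) * chi (ξ ⬝ᵥ k) := by
  rw [ofReal_sq_norm_sum]
  simp only [autocorr, Complex.ofReal_sum, sum_mul]
  rw [sum_comm]
  conv_rhs => rw [sum_comm]
  refine sum_congr rfl fun x _ => ?_
  refine (Fintype.sum_equiv (Equiv.addLeft x) _ _ fun k => ?_).symm
  simp only [Equiv.coe_addLeft, dotProduct_add, chi_add, map_mul, Complex.conj_ofReal]
  push_cast
  have h : chi (ξ ⬝ᵥ x) * conj (chi (ξ ⬝ᵥ x)) = 1 := by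
    rw [Complex.mul_conj, Complex.normSq_eq_norm_sq, norm_chi]; simp
  linear_combination (-(g x : ℂ) * g (x + k) * chi (ξ ⬝ᵥ k)) * h

lemma sum_sq_autocorr {G : Type*} [AddCommGroup G] [Fintype G] (g : G → ℝ) :
    ∑ k, autocorr g k ^ 2 = ∑ x, ∑ k, ∑ l, g x * g (x + k) * g (x + l) * g (x + k + l) := by
  rw [sum_comm]
  refine sum_congr rfl fun k _ => ?_
  rw [autocorr, sq, sum_mul_sum]
  refine sum_congr rfl fun x _ => ?_
  refine (Fintype.sum_equiv (Equiv.addLeft x) _ _ fun l => ?_).symm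
  simp only [Equiv.coe_addLeft]
  rw [show x + k + l = x + l + k by abel]
  ring

lemma sum_fourier_pow_four (g : Vec p n → ℝ) :
    ∑ ξ : Vec p n, (‖∑ x, (g x : ℂ) * chi (ξ ⬝ᵥ x)‖ ^ 2) ^ 2 =
      Fintype.card (Vec p n) * ∑ k, autocorr g k ^ 2 := by
  have h := parseval (fun k : Vec p n => (autocorr g k : ℂ))
  simp_rw [← sq_norm_fourier] at h
  simpa [Complex.norm_real, sq_abs] using h

/-- The squared Fourier coefficient at `ξ` of the multiplicative derivative of `f` along `h`. -/
noncomputable def derivCoeff (f : Vec p n → ℝ) (h ξ : Vec p n) : ℝ :=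
  ‖∑ x, ((f x * f (x + h) : ℝ) : ℂ) * chi (ξ ⬝ᵥ x)‖ ^ 2

lemma sum_derivCoeff_sq (f : Vec p n → ℝ) :
    ∑ h, ∑ ξ, derivCoeff f h ξ ^ 2 = Fintype.card (Vec p n) * U3pow8 f := by
  simp only [derivCoeff]
  have h1 : ∀ h : Vec p n,
      ∑ ξ : Vec p n, (‖∑ x, ((f x * f (x + h) : ℝ) : ℂ) * chi (ξ ⬝ᵥ x)‖ ^ 2) ^ 2
      = _ := fun h => sum_fourier_pow_four (fun x => f x * f (x + h))
  simp_rw [h1]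
  rw [← mul_sum]
  congr 1
  simp_rw [sum_sq_autocorr]
  rw [U3pow8, sum_comm]
  refine sum_congr rfl fun x _ => sum_congr rfl fun h _ => sum_congr rfl fun k _ =>
    sum_congr rfl fun l _ => ?_
  rw [cubeProd, show x + k + h = x + h + k by abel, show x + l + h = x + h + l by abel,
    show x + k + l + h = x + h + k + l by abel]
  ring

lemma abs_mul_le_one {a b : ℝ} (ha : |a| ≤ 1) (hb : |b| ≤ 1) : |a * b| ≤ 1 := by
  rw [abs_mul]; exact mul_le_one₀ ha (abs_nonneg _) hb

lemma sum_derivCoeff_le (f : Vec p n → ℝ) (hf : ∀ x, |f x| ≤ 1) (h : Vec p n) :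
    ∑ ξ, derivCoeff f h ξ ≤ (Fintype.card (Vec p n) : ℝ) ^ 2 := by
  simp only [derivCoeff]
  rw [parseval, sq]
  gcongr
  calc ∑ x, ‖((f x * f (x + h) : ℝ) : ℂ)‖ ^ 2 ≤ ∑ _x : Vec p n, (1 : ℝ) := by
        gcongr with x
        rw [Complex.norm_real, Real.norm_eq_abs]
        exact pow_le_one₀ (abs_nonneg _) (abs_mul_le_one (hf _) (hf _))
    _ = _ := by simp

lemma exists_large_derivCoeff (f : Vec p n → ℝ) (hf : ∀ x, |f x| ≤ 1) {ε : ℝ} (hε : 0 < ε)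
    (hU : ε * (Fintype.card (Vec p n) : ℝ) ^ 4 ≤ U3pow8 f) :
    ∃ (H : Finset (Vec p n)) (ξ : Vec p n → Vec p n),
      (∀ h ∈ H, ε / 2 * (Fintype.card (Vec p n) : ℝ) ^ 2 ≤ derivCoeff f h (ξ h)) ∧
      ε / 2 * (Fintype.card (Vec p n) : ℝ) ^ 3 ≤ ∑ h ∈ H, derivCoeff f h (ξ h) := by
  set N : ℝ := (Fintype.card (Vec p n) : ℝ) with hN
  have hNpos : 0 < N := by rw [hN]; exact_mod_cast Fintype.card_pos
  have hmax : ∀ h : Vec p n, ∃ ξ, ∀ ξ', derivCoeff f h ξ' ≤ derivCoeff f h ξ := fun h =>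
    Finite.exists_max (derivCoeff f h)
  choose ξ hξ using hmax
  have h1 : ε * N ^ 3 ≤ ∑ h, derivCoeff f h (ξ h) := by
    have h2 : N * U3pow8 f ≤ (∑ h, derivCoeff f h (ξ h)) * N ^ 2 := by
      rw [hN, ← sum_derivCoeff_sq, sum_mul]
      refine sum_le_sum fun h _ => ?_
      calc ∑ ξ', derivCoeff f h ξ' ^ 2 ≤ ∑ ξ', derivCoeff f h (ξ h) * derivCoeff f h ξ' := by
            gcongr with ξ'
            rw [sq]
            exact mul_le_mul_of_nonneg_right (hξ h ξ') (sq_nonneg _)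
        _ ≤ _ := by
            rw [← mul_sum]
            exact mul_le_mul_of_nonneg_left (sum_derivCoeff_le f hf h) (sq_nonneg _)
    have h3 : (ε * N ^ 3) * N ^ 2 ≤ (∑ h, derivCoeff f h (ξ h)) * N ^ 2 := by
      refine le_trans ?_ h2
      nlinarith [mul_le_mul_of_nonneg_left hU hNpos.le]
    exact le_of_mul_le_mul_right h3 (by positivity)
  refine ⟨univ.filter fun h => ε / 2 * N ^ 2 ≤ derivCoeff f h (ξ h), ξ,
    fun h hh => by simpa using hh, ?_⟩
  have h4 := sum_filter_add_sum_filter_not univ (fun h => ε / 2 * N ^ 2 ≤ derivCoeff f h (ξ h))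
    (fun h => derivCoeff f h (ξ h))
  have h5 : ∑ h ∈ univ.filter (fun h => ¬ ε / 2 * N ^ 2 ≤ derivCoeff f h (ξ h)),
      derivCoeff f h (ξ h) ≤ ε / 2 * N ^ 3 := by
    calc _ ≤
          ∑ h ∈ univ.filter (fun h => ¬ ε / 2 * N ^ 2 ≤ derivCoeff f h (ξ h)), ε / 2 * N ^ 2 := by
          refine sum_le_sum fun h hh => ?_
          simp only [mem_filter, not_le] at hh
          exact hh.2.le
      _ ≤ ∑ h : Vec p n, ε / 2 * N ^ 2 :=
          sum_le_sum_of_subset_of_nonneg (filter_subset _ _) fun _ _ _ => by positivity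
      _ = _ := by simp only [sum_const, card_univ, nsmul_eq_mul, ← hN]; ring
  linarith

lemma norm_ofReal_le_one {a : ℝ} (ha : |a| ≤ 1) : ‖(a : ℂ)‖ ≤ 1 := by
  rwa [Complex.norm_real, Real.norm_eq_abs]

/-- The number of `h` in `H` with `h + s ∈ H` along which `ξ` decreases by `t`. -/
noncomputable def diffCount {G : Type*} [AddCommGroup G] [DecidableEq G] (H : Finset G)
    (ξ : G → G) (s t : G) : ℕ :=
  #{h ∈ H | h + s ∈ H ∧ ξ h - ξ (h + s) = t}

lemma sum_correlation_sq (H : Finset (Vec p n)) (ξ : Vec p n → Vec p n) (s : Vec p n) :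
    ∑ k : Vec p n, ‖∑ h, (if h ∈ H then chi (ξ h ⬝ᵥ k) else 0) *
        conj (if h + s ∈ H then chi (ξ (h + s) ⬝ᵥ k) else 0)‖ ^ 2 =
      Fintype.card (Vec p n) * ∑ t, (diffCount H ξ s t : ℝ) ^ 2 := by
  have h1 := parseval (fun t : Vec p n => (diffCount H ξ s t : ℂ))
  simp only [Complex.norm_natCast] at h1
  rw [← h1]
  refine sum_congr rfl fun k _ => ?_
  congr 2
  have h2 : ∀ t : Vec p n, (diffCount H ξ s t : ℂ) * chi (k ⬝ᵥ t) =
      ∑ h, if h ∈ H ∧ h + s ∈ H ∧ ξ h - ξ (h + s) = t then chi (k ⬝ᵥ t) else 0 := by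
    intro t
    rw [← sum_filter, sum_const, nsmul_eq_mul]
    congr 2
    rw [diffCount]
    congr 1
    ext h
    simp
  simp_rw [h2]
  rw [sum_comm]
  refine sum_congr rfl fun h _ => ?_
  by_cases hh : h ∈ H
  · by_cases hs : h + s ∈ H
    · simp only [hh, hs, if_true, true_and]
      rw [sum_ite_eq, if_pos (mem_univ _), dotProduct_sub, chi_sub, dotProduct_comm k,
      dotProduct_comm k]
    · simp [hh, hs]
  · simp [hh]

lemma sum_correlation_shift (F u : Vec p n → ℂ) :
    ((∑ x, ‖∑ h, F (x + h) * u h‖ ^ 2 : ℝ) : ℂ) =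
      ∑ s, (∑ y, F y * conj (F (y + s))) * ∑ h, u h * conj (u (h + s)) := by
  rw [Complex.ofReal_sum]
  simp_rw [ofReal_sq_norm_sum]
  calc ∑ x, ∑ h, ∑ h', F (x + h) * u h * conj (F (x + h') * u h')
      = ∑ x, ∑ h, ∑ s, F (x + h) * u h * conj (F (x + h + s) * u (h + s)) := by
        refine sum_congr rfl fun x _ => sum_congr rfl fun h _ => ?_
        refine (Fintype.sum_equiv (Equiv.addLeft h) _ _ fun k => ?_).symm
        simp [add_assoc]
    _ = ∑ s, ∑ h, ∑ x, F (x + h) * u h * conj (F (x + h + s) * u (h + s)) := by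
        rw [sum_comm]
        rw [sum_congr rfl fun h _ => sum_comm]
        rw [sum_comm]
    _ = ∑ s, ∑ h, ∑ y, F y * u h * conj (F (y + s) * u (h + s)) := by
        refine sum_congr rfl fun s _ => sum_congr rfl fun h _ => ?_
        exact Fintype.sum_equiv (Equiv.addRight h) _ _ fun x => rfl
    _ = _ := by
        refine sum_congr rfl fun s _ => ?_
        rw [sum_mul_sum, sum_comm]
        refine sum_congr rfl fun y _ => sum_congr rfl fun h _ => ?_
        rw [map_mul]
        ring

lemma energy_of_derivCoeff (f : Vec p n → ℝ) (hf : ∀ x, |f x| ≤ 1) (H : Finset (Vec p n))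
    (ξ : Vec p n → Vec p n) {c : ℝ} (hc : 0 ≤ c)
    (hH : c * (Fintype.card (Vec p n) : ℝ) ^ 3 ≤ ∑ h ∈ H, derivCoeff f h (ξ h)) :
    c ^ 4 * (Fintype.card (Vec p n) : ℝ) ^ 3 ≤ ∑ s, ∑ t, (diffCount H ξ s t : ℝ) ^ 2 := by
  set N : ℝ := (Fintype.card (Vec p n) : ℝ) with hN
  have hNpos : 0 < N := by rw [hN]; exact_mod_cast Fintype.card_pos
  set u : Vec p n → Vec p n → ℂ := fun k h => if h ∈ H then chi (ξ h ⬝ᵥ k) else 0 with hu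
  set F : Vec p n → Vec p n → ℂ := fun k y => ((f y * f (y + k) : ℝ) : ℂ) with hF
  set X : ℝ := ∑ k, ∑ x, ‖∑ h, F k (x + h) * u k h‖ ^ 2 with hX
  set E : ℝ := ∑ s, ∑ t, (diffCount H ξ s t : ℝ) ^ 2 with hE
  have hFn : ∀ k y, ‖F k y‖ ≤ 1 := fun k y => norm_ofReal_le_one (abs_mul_le_one (hf _) (hf _))
  have e1 : ((∑ h ∈ H, derivCoeff f h (ξ h) : ℝ) : ℂ) =
      ∑ kx : Vec p n × Vec p n, F kx.1 kx.2 * ∑ h, F kx.1 (kx.2 + h) * u kx.1 h := by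
    rw [Fintype.sum_prod_type, Complex.ofReal_sum]
    simp only [derivCoeff]
    simp_rw [sq_norm_fourier (fun x => f x * f (x + _))]
    rw [sum_comm]
    refine sum_congr rfl fun k _ => ?_
    simp_rw [mul_sum]
    conv_rhs => rw [sum_comm]
    conv_lhs => rw [← univ_inter H, ← sum_ite_mem]
    refine sum_congr rfl fun h _ => ?_
    by_cases hh : h ∈ H
    · simp only [hu, hh, if_true, hF, autocorr]
      rw [Complex.ofReal_sum, sum_mul]
      refine sum_congr rfl fun x _ => ?_
      rw [show x + h + k = x + k + h by abel]
      push_cast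
      ring
    · simp [hu, hh]
  have e2 : (c * N ^ 3) ^ 2 ≤ N ^ 2 * X := by
    have h1 := sq_norm_sum_mul_le_card (fun kx : Vec p n × Vec p n => F kx.1 kx.2)
      (fun kx => ∑ h, F kx.1 (kx.2 + h) * u kx.1 h) (fun kx => hFn _ _)
    rw [← e1, Complex.norm_real, Real.norm_eq_abs, sq_abs, Fintype.card_prod,
      Fintype.sum_prod_type] at h1
    push_cast at h1
    rw [← hN, ← sq] at h1
    refine le_trans ?_ h1
    gcongr
  have e3 : X ^ 2 ≤ N ^ 5 * E := by
    have h1 : (X : ℂ) = ∑ ks : Vec p n × Vec p n,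
        (∑ y, F ks.1 y * conj (F ks.1 (y + ks.2))) *
          ∑ h, u ks.1 h * conj (u ks.1 (h + ks.2)) := by
      rw [hX, Complex.ofReal_sum, Fintype.sum_prod_type]
      exact sum_congr rfl fun k _ => sum_correlation_shift _ _
    have h2 := sq_norm_sum_mul_le univ (fun ks : Vec p n × Vec p n =>
      (∑ y, F ks.1 y * conj (F ks.1 (y + ks.2))))
        (fun ks => ∑ h, u ks.1 h * conj (u ks.1 (h + ks.2)))
    rw [← h1, Complex.norm_real, Real.norm_eq_abs, sq_abs] at h2
    refine h2.trans ?_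
    have h3 : ∑ ks : Vec p n × Vec p n, ‖∑ y, F ks.1 y * conj (F ks.1 (y + ks.2))‖ ^ 2 ≤ N ^ 4 := by
      calc _ ≤ ∑ ks : Vec p n × Vec p n, N ^ 2 := by
            gcongr with ks
            refine (norm_sum_le _ _).trans ?_
            calc _ ≤ ∑ y : Vec p n, (1 : ℝ) := by
                  gcongr with y
                  rw [norm_mul, RCLike.norm_conj]
                  exact mul_le_one₀ (hFn _ _) (norm_nonneg _) (hFn _ _)
              _ = N := by simp [hN]
        _ = N ^ 4 := by
            rw [sum_const, card_univ, Fintype.card_prod, nsmul_eq_mul]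
            push_cast
            rw [← hN]
            ring
    have h4 : ∑ ks : Vec p n × Vec p n, ‖∑ h, u ks.1 h * conj (u ks.1 (h + ks.2))‖ ^ 2 = N * E := by
      rw [Fintype.sum_prod_type, sum_comm, hE, mul_sum]
      exact sum_congr rfl fun s _ => sum_correlation_sq H ξ s
    rw [h4]
    have hE0 : 0 ≤ E := by positivity
    calc _ ≤ N ^ 4 * (N * E) := by gcongr
      _ = _ := by ring
  have h5 : (c ^ 2 * N ^ 4) ^ 2 ≤ X ^ 2 := by
    have : c ^ 2 * N ^ 4 ≤ X := by
      have : N ^ 2 * (c ^ 2 * N ^ 4) ≤ N ^ 2 * X := by nlinarith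
      exact le_of_mul_le_mul_left this (by positivity)
    gcongr
  have h6 : N ^ 5 * (c ^ 4 * N ^ 3) ≤ N ^ 5 * E := by nlinarith
  exact le_of_mul_le_mul_left h6 (by positivity)

end Fourier

section BalogSzemerediGowers

/-- In a dense bipartite graph there is a large set of vertices all of whose pairs are joined by
many paths of length four. -/
lemma exists_many_paths {α : Type*} (Γ : Finset α) (E : α → α → Prop) {N c : ℝ} (hN : 0 < N)
    (hΓ : (#Γ : ℝ) ≤ N) (hc : 0 < c)
    (hE : c * N ^ 2 ≤ ∑ b ∈ Γ, (#{a ∈ Γ | E a b} : ℝ)) :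
    ∃ U ⊆ Γ, c / 4 * N ≤ #U ∧ ∀ a ∈ U, ∀ a' ∈ U,
      c ^ 5 / 1024 * N ^ 3 ≤
        #{t ∈ Γ ×ˢ (Γ ×ˢ Γ) | E a t.2.1 ∧ E t.1 t.2.1 ∧ E t.1 t.2.2 ∧ E a' t.2.2} := by
  set X : α → Finset α := fun b => {a ∈ Γ | E a b} with hX
  set cod : α → α → Finset α := fun a a' => {b ∈ Γ | E a b ∧ E a' b} with hcod
  set poor : α → α → Prop := fun a a' => (#(cod a a') : ℝ) < c ^ 2 / 16 * N with hpoor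
  have hpoor_symm : ∀ a a', poor a a' → poor a' a := by
    intro a a' h
    have : cod a' a = cod a a' := by ext b; simp [hcod, and_comm]
    simpa [hpoor, this] using h
  have hsq : c ^ 2 * N ^ 3 ≤ ∑ b ∈ Γ, (#(X b) : ℝ) ^ 2 := by
    have h1 := sq_sum_le_card_mul_sum_sq (s := Γ) (f := fun b => (#(X b) : ℝ))
    have h2 : (c * N ^ 2) ^ 2 ≤ (∑ b ∈ Γ, (#(X b) : ℝ)) ^ 2 := by gcongr
    have h3 : N * (c ^ 2 * N ^ 3) ≤ N * ∑ b ∈ Γ, (#(X b) : ℝ) ^ 2 := by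
      calc N * (c ^ 2 * N ^ 3) = (c * N ^ 2) ^ 2 := by ring
        _ ≤ _ := h2.trans h1
        _ ≤ _ := mul_le_mul_of_nonneg_right hΓ (sum_nonneg fun _ _ => sq_nonneg _)
    exact le_of_mul_le_mul_left h3 hN
  have hpoorsum : ∑ b ∈ Γ, (#{aa ∈ X b ×ˢ X b | poor aa.1 aa.2} : ℝ) ≤ c ^ 2 / 16 * N ^ 3 := by
    have h1 : ∀ b ∈ Γ, #{aa ∈ X b ×ˢ X b | poor aa.1 aa.2} =
        #{aa ∈ {aa ∈ Γ ×ˢ Γ | poor aa.1 aa.2} | E aa.1 b ∧ E aa.2 b} := by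
      intro b _
      congr 1
      ext aa
      simp only [hX, mem_filter, mem_product]
      tauto
    have h2 := sum_card_bipartiteAbove_eq_sum_card_bipartiteBelow
      (s := Γ) (t := {aa ∈ Γ ×ˢ Γ | poor aa.1 aa.2}) (fun b aa => E aa.1 b ∧ E aa.2 b)
    simp only [bipartiteAbove, bipartiteBelow] at h2
    have h3 : ∑ b ∈ Γ, (#{aa ∈ X b ×ˢ X b | poor aa.1 aa.2} : ℝ) =
        ∑ aa ∈ (Γ ×ˢ Γ).filter (fun aa => poor aa.1 aa.2), (#(cod aa.1 aa.2) : ℝ) := by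
      rw [← Nat.cast_sum, ← Nat.cast_sum, sum_congr rfl h1, h2]
    rw [h3]
    calc _ ≤ ∑ aa ∈ (Γ ×ˢ Γ).filter (fun aa => poor aa.1 aa.2), c ^ 2 / 16 * N := by
          refine sum_le_sum fun aa haa => ?_
          exact (mem_filter.1 haa).2.le
      _ ≤ ∑ aa ∈ Γ ×ˢ Γ, c ^ 2 / 16 * N :=
          sum_le_sum_of_subset_of_nonneg (filter_subset _ _) fun _ _ _ => by positivity
      _ ≤ c ^ 2 / 16 * N ^ 3 := by
          rw [sum_const, card_product, nsmul_eq_mul]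
          push_cast
          have : (#Γ : ℝ) * #Γ ≤ N * N := by gcongr
          calc _ ≤ N * N * (c ^ 2 / 16 * N) := by gcongr
            _ = _ := by ring
  obtain ⟨b, hb, hbX⟩ : ∃ b ∈ Γ, c ^ 2 / 2 * N ^ 2 ≤
      (#(X b) : ℝ) ^ 2 - 8 * (#{aa ∈ X b ×ˢ X b | poor aa.1 aa.2} : ℝ) := by
    by_contra! hcon
    have hne : Γ.Nonempty := by
      rw [nonempty_iff_ne_empty]
      rintro rfl
      simp only [sum_empty] at hsq
      have : 0 < c ^ 2 * N ^ 3 := by positivity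
      linarith
    have h1 := sum_lt_sum_of_nonempty hne hcon
    rw [sum_sub_distrib, ← mul_sum, sum_const, nsmul_eq_mul] at h1
    have h2 : (#Γ : ℝ) * (c ^ 2 / 2 * N ^ 2) ≤ N * (c ^ 2 / 2 * N ^ 2) := by gcongr
    nlinarith
  set V := X b with hV
  have hVc : c / 2 * N ≤ #V := by
    have h1 : (c / 2 * N) ^ 2 ≤ (#V : ℝ) ^ 2 := by
      have : (0 : ℝ) ≤ #{aa ∈ V ×ˢ V | poor aa.1 aa.2} := by positivity
      have : 0 ≤ c ^ 2 * N ^ 2 := by positivity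
      nlinarith
    exact le_of_sq_le_sq h1 (by positivity)
  have hVpos : (0 : ℝ) < #V := lt_of_lt_of_le (by positivity) hVc
  have hVΓ : V ⊆ Γ := filter_subset _ _
  set P : α → Finset α := fun a => {a' ∈ V | poor a a'} with hP
  have hPsum : ∑ a ∈ V, (#(P a) : ℝ) ≤ (#V : ℝ) ^ 2 / 8 := by
    have h1 : ∑ a ∈ V, #(P a) = #{aa ∈ V ×ˢ V | poor aa.1 aa.2} := by
      rw [card_filter, sum_product]
      exact sum_congr rfl fun a _ => card_filter _ _
    have h2 : ∑ a ∈ V, (#(P a) : ℝ) = #{aa ∈ V ×ˢ V | poor aa.1 aa.2} := by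
      rw [← h1]; push_cast; rfl
    rw [h2]
    have : 0 ≤ c ^ 2 / 2 * N ^ 2 := by positivity
    linarith
  have hbad : (#{a ∈ V | ¬ (#(P a) : ℝ) ≤ #V / 4} : ℝ) ≤ #V / 2 := by
    have h1 : (#{a ∈ V | ¬ (#(P a) : ℝ) ≤ #V / 4} : ℝ) * (#V / 4) ≤ #V / 2 * (#V / 4) := by
      calc _ = ∑ a ∈ V.filter (fun a => ¬ (#(P a) : ℝ) ≤ #V / 4), (#V / 4 : ℝ) := by
            rw [sum_const, nsmul_eq_mul]
        _ ≤ ∑ a ∈ V.filter (fun a => ¬ (#(P a) : ℝ) ≤ #V / 4), (#(P a) : ℝ) :=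
            sum_le_sum fun a ha => (not_le.1 (mem_filter.1 ha).2).le
        _ ≤ ∑ a ∈ V, (#(P a) : ℝ) :=
            sum_le_sum_of_subset_of_nonneg (filter_subset _ _) fun _ _ _ => Nat.cast_nonneg _
        _ ≤ _ := hPsum
        _ = _ := by ring
    exact le_of_mul_le_mul_right h1 (by positivity)
  have hUcard : (#{a ∈ V | (#(P a) : ℝ) ≤ #V / 4} : ℝ) +
      #{a ∈ V | ¬ (#(P a) : ℝ) ≤ #V / 4} = #V := by
    exact_mod_cast card_filter_add_card_filter_not (s := V) (fun a => (#(P a) : ℝ) ≤ #V / 4)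
  refine ⟨{a ∈ V | (#(P a) : ℝ) ≤ #V / 4}, (filter_subset _ _).trans hVΓ, by linarith, ?_⟩
  intro a ha a' ha'
  rw [mem_filter] at ha ha'
  set C : Finset α := {e ∈ V | ¬ poor a e ∧ ¬ poor e a'} with hC
  have hCc : (#V : ℝ) / 2 ≤ #C := by
    have h1 : V ⊆ C ∪ (P a ∪ P a') := by
      intro e he
      by_cases h1 : poor a e
      · exact mem_union_right _ (mem_union_left _ (mem_filter.2 ⟨he, h1⟩))
      by_cases h2 : poor e a'
      · exact mem_union_right _ (mem_union_right _ (mem_filter.2 ⟨he, hpoor_symm _ _ h2⟩))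
      exact mem_union_left _ (mem_filter.2 ⟨he, h1, h2⟩)
    have h2 : #V ≤ #C + (#(P a) + #(P a')) :=
      (card_le_card h1).trans ((card_union_le _ _).trans (by gcongr; exact card_union_le _ _))
    have h3 : (#V : ℝ) ≤ #C + (#(P a) + #(P a')) := by exact_mod_cast h2
    linarith [ha.2, ha'.2]
  have hinj : #(C.sigma fun e => cod a e ×ˢ cod e a') ≤
      #{t ∈ Γ ×ˢ (Γ ×ˢ Γ) | E a t.2.1 ∧ E t.1 t.2.1 ∧ E t.1 t.2.2 ∧ E a' t.2.2} := by
    refine card_le_card_of_injOn (fun t => (t.1, t.2)) ?_ ?_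
    · rintro ⟨e, b1, b2⟩ h
      simp only [hC, hcod, coe_sigma, Set.mem_sigma_iff, mem_coe, mem_product, mem_filter] at h
      simp only [coe_filter, Set.mem_ofPred_eq, mem_product]
      exact ⟨⟨hVΓ h.1.1, h.2.1.1, h.2.2.1⟩, h.2.1.2.1, h.2.1.2.2, h.2.2.2.1, h.2.2.2.2⟩
    · rintro ⟨e, x⟩ _ ⟨e', x'⟩ _ h
      simp only [Prod.mk.injEq] at h
      obtain ⟨rfl, rfl⟩ := h
      rfl
  have hsum : (#V : ℝ) / 2 * (c ^ 2 / 16 * N) ^ 2 ≤ #(C.sigma fun e => cod a e ×ˢ cod e a') := by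
    rw [card_sigma]
    push_cast
    calc _ ≤ (#C : ℝ) * (c ^ 2 / 16 * N) ^ 2 := by gcongr
      _ = ∑ e ∈ C, (c ^ 2 / 16 * N) ^ 2 := by rw [sum_const, nsmul_eq_mul]
      _ ≤ _ := by
        refine sum_le_sum fun e he => ?_
        have h1 := (mem_filter.1 he).2
        simp only [hpoor, not_lt] at h1
        rw [card_product, sq]
        push_cast
        exact mul_le_mul h1.1 h1.2 (by positivity) (by positivity)
  have hinj' : (#(C.sigma fun e => cod a e ×ˢ cod e a') : ℝ) ≤
      #{t ∈ Γ ×ˢ (Γ ×ˢ Γ) | E a t.2.1 ∧ E t.1 t.2.1 ∧ E t.1 t.2.2 ∧ E a' t.2.2} := by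
    exact_mod_cast hinj
  refine le_trans ?_ (hsum.trans hinj')
  calc c ^ 5 / 1024 * N ^ 3 = c / 2 * N / 2 * (c ^ 2 / 16 * N) ^ 2 := by ring
    _ ≤ _ := by gcongr

/-- The number of representations of `d` as a difference of two elements of `Γ`. -/
noncomputable def repCount {G : Type*} [AddCommGroup G] [DecidableEq G] (Γ : Finset G)
    (d : G) : ℕ :=
  #{ab ∈ Γ ×ˢ Γ | ab.1 - ab.2 = d}

/-- The Balog-Szemerédi-Gowers theorem. -/
lemma balog_szemeredi_gowers {G : Type*} [AddCommGroup G] [DecidableEq G] [Fintype G] (Γ : Finset G)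
    {N c : ℝ}
    (hN : 0 < N) (hΓ : (#Γ : ℝ) ≤ N) (hc : 0 < c)
    (hE : 2 * c * N ^ 3 ≤ ∑ d, (repCount Γ d : ℝ) ^ 2) :
    ∃ U ⊆ Γ, c / 4 * N ≤ #U ∧ (#(U - U) : ℝ) ≤ 4096 / c ^ 10 * #U := by
  have hr1 : ∀ d, (repCount Γ d : ℝ) ≤ N := by
    intro d
    refine le_trans ?_ hΓ
    norm_cast
    refine card_le_card_of_injOn Prod.fst ?_ ?_
    · intro x hx
      simp only [coe_filter, mem_product, Set.mem_ofPred_eq] at hx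
      exact hx.1.1
    · rintro ⟨a, b⟩ h ⟨a', b'⟩ h' (rfl : a = a')
      simp only [coe_filter, mem_product, Set.mem_ofPred_eq] at h h'
      rw [← h'.2] at h
      have := sub_right_injective h.2
      rw [this]
  have hr2 : ∑ d, (repCount Γ d : ℝ) = (#Γ : ℝ) ^ 2 := by
    have h1 := card_eq_sum_card_fiberwise (s := Γ ×ˢ Γ) (t := univ)
      (f := fun ab : G × G => ab.1 - ab.2)
      (fun _ _ => mem_coe.2 (mem_univ _))
    rw [card_product] at h1
    rw [sq]
    exact_mod_cast h1.symm
  have hr3 : ∑ d, (repCount Γ d : ℝ) ≤ N ^ 2 := by rw [hr2]; gcongr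
  set D : Finset G := {d | c * N ≤ repCount Γ d} with hD
  have hDc : (#D : ℝ) * c ≤ N := by
    have h1 : (#D : ℝ) * c * N ≤ N * N := by
      calc (#D : ℝ) * c * N = ∑ d ∈ D, c * N := by rw [sum_const, nsmul_eq_mul]; ring
        _ ≤ ∑ d ∈ D, (repCount Γ d : ℝ) := sum_le_sum fun d hd => (mem_filter.1 hd).2
        _ ≤ ∑ d, (repCount Γ d : ℝ) :=
            sum_le_sum_of_subset_of_nonneg (subset_univ _) fun _ _ _ => Nat.cast_nonneg _
        _ ≤ _ := by rw [← sq]; exact hr3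
    exact le_of_mul_le_mul_right h1 hN
  have hDsum : c * N ^ 2 ≤ ∑ d ∈ D, (repCount Γ d : ℝ) := by
    have h1 := sum_filter_add_sum_filter_not univ (fun d => c * N ≤ repCount Γ d)
      (fun d => (repCount Γ d : ℝ) ^ 2)
    have h2 : ∑ d ∈ univ.filter (fun d => ¬ c * N ≤ repCount Γ d), (repCount Γ d : ℝ) ^ 2
        ≤ c * N * N ^ 2 := by
      calc _ ≤ ∑ d ∈ univ.filter (fun d => ¬ c * N ≤ repCount Γ d), c * N * (repCount Γ d : ℝ) := by
            refine sum_le_sum fun d hd => ?_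
            have := (mem_filter.1 hd).2
            rw [sq]
            gcongr
            exact (not_le.1 this).le
        _ ≤ ∑ d, c * N * (repCount Γ d : ℝ) :=
            sum_le_sum_of_subset_of_nonneg (subset_univ _) fun _ _ _ => by positivity
        _ ≤ _ := by rw [← mul_sum]; gcongr
    have h3 : ∑ d ∈ D, (repCount Γ d : ℝ) ^ 2 ≤ N * ∑ d ∈ D, (repCount Γ d : ℝ) := by
      rw [mul_sum]
      refine sum_le_sum fun d _ => ?_
      rw [sq]
      exact mul_le_mul_of_nonneg_right (hr1 d) (Nat.cast_nonneg _)
    have h4 : N * (c * N ^ 2) ≤ N * ∑ d ∈ D, (repCount Γ d : ℝ) := by nlinarith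
    exact le_of_mul_le_mul_left h4 hN
  have hEdge : c * N ^ 2 ≤ ∑ b ∈ Γ, (#{a ∈ Γ | a - b ∈ D} : ℝ) := by
    refine hDsum.trans (le_of_eq ?_)
    have h1 : ∑ d ∈ D, repCount Γ d = #{ab ∈ Γ ×ˢ Γ | ab.1 - ab.2 ∈ D} := by
      rw [card_eq_sum_card_fiberwise (f := fun ab : G × G => ab.1 - ab.2) (t := D)]
      · refine sum_congr rfl fun d hd => ?_
        rw [repCount]
        congr 1
        ext ab
        simp only [mem_filter]
        constructor
        · rintro ⟨h, rfl⟩; exact ⟨⟨h, hd⟩, rfl⟩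
        · rintro ⟨⟨h, _⟩, rfl⟩; exact ⟨h, rfl⟩
      · intro ab hab
        exact (mem_filter.1 (mem_coe.1 hab)).2
    have h2 : #{ab ∈ Γ ×ˢ Γ | ab.1 - ab.2 ∈ D} = ∑ b ∈ Γ, #{a ∈ Γ | a - b ∈ D} := by
      rw [card_filter, sum_product_right]
      exact sum_congr rfl fun a _ => (card_filter _ _).symm
    rw [h2] at h1
    exact_mod_cast h1
  obtain ⟨U, hUΓ, hUc, hU⟩ := exists_many_paths Γ (fun a b => a - b ∈ D) hN hΓ hc
    (by convert hEdge)
  refine ⟨U, hUΓ, hUc, ?_⟩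
  have hcount : (#(U - U) : ℝ) * (c ^ 5 / 1024 * N ^ 3) ≤ (#D : ℝ) ^ 4 := by
    have h1 : ∀ e ∈ U - U, c ^ 5 / 1024 * N ^ 3 ≤
        #{t ∈ D ×ˢ (D ×ˢ (D ×ˢ D)) | t.1 - t.2.1 + t.2.2.1 - t.2.2.2 = e} := by
      intro e he
      obtain ⟨a, ha, a', ha', rfl⟩ := mem_sub.1 he
      refine (hU a ha a' ha').trans ?_
      norm_cast
      refine card_le_card_of_injOn
        (fun t => (a - t.2.1, t.1 - t.2.1, t.1 - t.2.2, a' - t.2.2)) ?_ ?_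
      · intro t ht
        simp only [coe_filter, Set.mem_ofPred_eq, mem_product] at ht ⊢
        exact ⟨⟨ht.2.1, ht.2.2.1, ht.2.2.2.1, ht.2.2.2.2⟩, by abel⟩
      · rintro ⟨e, b, b'⟩ _ ⟨e1, b1, b1'⟩ _ h
        simp only [Prod.mk.injEq] at h
        obtain ⟨h1, h2, h3, h4⟩ := h
        have h5 := sub_right_injective h1
        have h6 := sub_right_injective h4
        subst h5 h6
        have := sub_left_injective h2
        rw [this]
    have h2 : ∑ e ∈ U - U, #{t ∈ D ×ˢ (D ×ˢ (D ×ˢ D)) | t.1 - t.2.1 + t.2.2.1 - t.2.2.2 = e} ≤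
        #(D ×ˢ (D ×ˢ (D ×ˢ D))) := by
      rw [card_eq_sum_card_fiberwise (s := D ×ˢ (D ×ˢ (D ×ˢ D))) (t := univ)
        (f := fun t : G × G × G × G => t.1 - t.2.1 + t.2.2.1 - t.2.2.2)
        (fun _ _ => mem_coe.2 (mem_univ _))]
      exact sum_le_sum_of_subset (subset_univ _)
    calc _ = ∑ e ∈ U - U, c ^ 5 / 1024 * N ^ 3 := by rw [sum_const, nsmul_eq_mul]
      _ ≤ ∑ e ∈ U - U, (#{t ∈ D ×ˢ (D ×ˢ (D ×ˢ D)) | t.1 - t.2.1 + t.2.2.1 - t.2.2.2 = e} : ℝ) :=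
          sum_le_sum h1
      _ ≤ (#(D ×ˢ (D ×ˢ (D ×ˢ D))) : ℝ) := by exact_mod_cast h2
      _ = _ := by simp only [card_product]; push_cast; ring
  have h5 : (#(U - U) : ℝ) * c ^ 9 ≤ 1024 * N := by
    have h1 : ((#D : ℝ) * c) ^ 4 ≤ N ^ 4 := by gcongr
    have h2 : ((#(U - U) : ℝ) * c ^ 9) * N ^ 3 ≤ (1024 * N) * N ^ 3 := by
      have h3 := mul_le_mul_of_nonneg_right hcount (show 0 ≤ c ^ 4 by positivity)
      nlinarith
    exact le_of_mul_le_mul_right h2 (by positivity)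
  rw [div_mul_eq_mul_div, le_div_iff₀ (by positivity)]
  have h6 := mul_le_mul_of_nonneg_right h5 hc.le
  nlinarith

end BalogSzemerediGowers

section Freiman

variable {p : ℕ} [Fact p.Prime]

lemma exists_add_of_mem_span {V : Type*} [AddCommGroup V] [Module (ZMod p) V] {W X F : Set V}
    (h0 : 0 ∈ X) (h : ∀ w ∈ W, ∀ x ∈ X, ∃ f ∈ F, ∃ x' ∈ X, w + x = f + x') {v : V}
    (hv : v ∈ Submodule.span (ZMod p) W) :
    ∃ f ∈ Submodule.span (ZMod p) F, ∃ x ∈ X, v = f + x := by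
  let A : AddSubmonoid V :=
    { carrier := {v | ∀ x ∈ X, ∃ f ∈ Submodule.span (ZMod p) F, ∃ x' ∈ X, v + x = f + x'}
      zero_mem' := fun x hx => ⟨0, zero_mem _, x, hx, rfl⟩
      add_mem' := by
        intro a b ha hb x hx
        obtain ⟨f, hf, x', hx', e⟩ := hb x hx
        obtain ⟨f', hf', x'', hx'', e'⟩ := ha x' hx'
        refine ⟨f + f', add_mem hf hf', x'', hx'', ?_⟩
        rw [add_assoc, e, add_left_comm, e', add_assoc] }
  let S : Submodule (ZMod p) V :=
    { A with
      smul_mem' := by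
        intro c v hv
        have h1 : c • v = c.val • v := by
          rw [← Nat.cast_smul_eq_nsmul (ZMod p), ZMod.natCast_val, ZMod.cast_id]
        rw [h1]
        exact A.nsmul_mem hv _ }
  have hWS : Submodule.span (ZMod p) W ≤ S := by
    rw [Submodule.span_le]
    intro w hw x hx
    obtain ⟨f, hf, x', hx', e⟩ := h w hw x hx
    exact ⟨f, Submodule.subset_span hf, x', hx', e⟩
  obtain ⟨f, hf, x, hx, e⟩ := hWS hv 0 h0
  exact ⟨f, hf, x, hx, by rw [← e, add_zero]⟩

lemma card_span_le {V : Type*} [AddCommGroup V] [Module (ZMod p) V] [Finite V] (F : Finset V) :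
    Nat.card (Submodule.span (ZMod p) (F : Set V)) ≤ p ^ #F := by
  rw [Module.natCard_eq_pow_finrank (K := ZMod p), Nat.card_zmod]
  exact Nat.pow_le_pow_right (Fact.out : p.Prime).pos (finrank_span_finset_le_card F)

lemma card_span_sub_le {V : Type*} [AddCommGroup V] [DecidableEq V] [Module (ZMod p) V] [Fintype V]
    {U : Finset V}
    (hU : U.Nonempty) {K : ℕ} (hK : #(U - U) ≤ K * #U) :
    Nat.card (Submodule.span (ZMod p) ((U - U : Finset V) : Set V)) ≤ p ^ K ^ 5 * (K * #U) := by
  have hUpos : 0 < #U := hU.card_pos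
  have h1 : #((2 • U - 2 • U) + U) ≤ K ^ 5 * #U := by
    have h2 := pluennecke_ruzsa_inequality_nsmul_sub_nsmul_sub hU U 3 2
    have h3 : (2 • U - 2 • U) + U = 3 • U - 2 • U := by
      rw [sub_add_eq_add_sub, ← succ_nsmul]
    have h4 : ((#(U - U) : ℚ≥0) / #U) ≤ K := by
      rw [div_le_iff₀ (by exact_mod_cast hUpos)]
      exact_mod_cast hK
    have h5 : ((#(3 • U - 2 • U) : ℚ≥0)) ≤ (K : ℚ≥0) ^ 5 * #U := h2.trans (by gcongr)
    rw [h3]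
    exact_mod_cast h5
  obtain ⟨F, _, hF, hcov⟩ := ruzsa_covering_add (K := ((K ^ 5 : ℕ) : ℝ)) hU (by exact_mod_cast h1)
  have hF' : #F ≤ K ^ 5 := by exact_mod_cast hF
  have hspan : ∀ v ∈ Submodule.span (ZMod p) ((U - U : Finset V) : Set V),
      ∃ f ∈ Submodule.span (ZMod p) (F : Set V), ∃ x ∈ ((U - U : Finset V) : Set V), v = f + x := by
    intro v hv
    refine exists_add_of_mem_span ?_ ?_ hv
    · obtain ⟨u, hu⟩ := hU
      exact mem_coe.2 (mem_sub.2 ⟨u, hu, u, hu, sub_self u⟩)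
    · intro w hw x hx
      obtain ⟨a, ha, b, hb, rfl⟩ := mem_sub.1 (mem_coe.1 hw)
      obtain ⟨a', ha', b', hb', rfl⟩ := mem_sub.1 (mem_coe.1 hx)
      have h6 : a - b + (a' - b') ∈ 2 • U - 2 • U := by
        rw [two_nsmul, sub_add_sub_comm]
        exact sub_mem_sub (add_mem_add ha ha') (add_mem_add hb hb')
      obtain ⟨f, hf, x', hx', e⟩ := mem_add.1 (hcov h6)
      exact ⟨f, hf, x', hx', e.symm⟩
  have hinj : Nat.card (Submodule.span (ZMod p) ((U - U : Finset V) : Set V)) ≤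
      Nat.card (Submodule.span (ZMod p) (F : Set V) × (U - U : Finset V)) := by
    choose! f hf x hx e using hspan
    refine Nat.card_le_card_of_injective
      (fun v => (⟨f v, hf v v.2⟩, ⟨x v, mem_coe.1 (hx v v.2)⟩)) ?_
    intro v w h
    simp only [Prod.mk.injEq, Subtype.mk.injEq] at h
    apply Subtype.ext
    rw [e v v.2, e w w.2, h.1, h.2]
  refine hinj.trans ?_
  rw [Nat.card_prod, Nat.card_eq_fintype_card (α := (U - U : Finset V)), Fintype.card_coe]
  exact Nat.mul_le_mul ((card_span_le F).trans
    (Nat.pow_le_pow_right (Fact.out : p.Prime).pos hF')) hK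

lemma exists_affine_on_large_subset {n : ℕ} (ξ : Vec p n → Vec p n) {U : Finset (Vec p n × Vec p n)}
    (hU : U.Nonempty) (hgraph : ∀ u ∈ U, u.2 = ξ u.1) {L : ℕ}
    (hspan : Nat.card (Submodule.span (ZMod p) ((U - U : Finset (Vec p n × Vec p n)) :
      Set (Vec p n × Vec p n))) ≤
      L * #U) :
    ∃ (M : Matrix (Fin n) (Fin n) (ZMod p)) (b : Vec p n) (H : Finset (Vec p n)),
      (∀ h ∈ H, (h, ξ h) ∈ U ∧ ξ h = M *ᵥ h + b) ∧ (#U : ℝ) / L ≤ #H := by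
  set H0 := Submodule.span (ZMod p) ((U - U : Finset (Vec p n × Vec p n)) :
      Set (Vec p n × Vec p n)) with hH0
  let π : H0 →ₗ[ZMod p] Vec p n := (LinearMap.fst _ _ _).comp H0.subtype
  obtain ⟨σ, hσ⟩ := π.rangeRestrict.exists_rightInverse_of_surjective (by simp)
  obtain ⟨M, hM⟩ := LinearMap.exists_extend (((LinearMap.snd _ _ _).comp H0.subtype).comp σ)
  have hMmem : ∀ v ∈ H0, ((v.1, M v.1) : Vec p n × Vec p n) ∈ H0 := by
    intro v hv
    let r : LinearMap.range π := ⟨v.1, ⟨⟨v, hv⟩, rfl⟩⟩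
    have h1 : (σ r : Vec p n × Vec p n).1 = v.1 := by
      have := LinearMap.congr_fun hσ r
      exact congrArg Subtype.val this
    have h2 : M v.1 = (σ r : Vec p n × Vec p n).2 := by
      have := LinearMap.congr_fun hM r
      exact this
    rw [h2, ← h1]
    exact (σ r).2
  obtain ⟨u0, hu0⟩ := hU
  have hsub : ∀ u ∈ U, u - u0 ∈ H0 := fun u hu =>
    Submodule.subset_span (mem_coe.2 (sub_mem_sub hu hu0))
  let K0 : Finset (Vec p n) := {κ | ((0, κ) : Vec p n × Vec p n) ∈ H0}
  have hK0 : #K0 ≤ L := by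
    have h1 : #K0 * #U ≤ L * #U := by
      refine le_trans ?_ hspan
      rw [← card_product, Nat.card_eq_fintype_card, ← Fintype.card_coe]
      refine Fintype.card_le_of_injective
        (fun x => (⟨(x.1.2 - u0) + (0, x.1.1), add_mem (hsub _ (mem_product.1 x.2).2)
          (mem_filter.1 (mem_product.1 x.2).1).2⟩ : H0)) ?_
      rintro ⟨⟨κ, u⟩, hx⟩ ⟨⟨κ', u'⟩, hx'⟩ h
      have hx := (mem_product.1 hx).2
      have hx' := (mem_product.1 hx').2
      simp only [Subtype.mk.injEq, Prod.ext_iff, Prod.fst_add, Prod.snd_add, Prod.fst_sub,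
        Prod.snd_sub, add_zero] at h
      have h2 : u.1 = u'.1 := sub_left_injective h.1
      have h3 : u.2 = u'.2 := by rw [hgraph u hx, hgraph u' hx', h2]
      have h4 := h.2
      rw [h3] at h4
      simp only [Subtype.mk.injEq, Prod.mk.injEq]
      exact ⟨add_left_cancel h4, Prod.ext h2 h3⟩
    exact Nat.le_of_mul_le_mul_right h1 (card_pos.2 ⟨u0, hu0⟩)
  have hmaps : ∀ u ∈ U, u.2 - u0.2 - M (u.1 - u0.1) ∈ K0 := by
    intro u hu
    refine mem_filter.2 ⟨mem_univ _, ?_⟩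
    have h1 := H0.sub_mem (hsub u hu) (hMmem _ (hsub u hu))
    convert h1 using 1
    ext1 <;> simp
  have hK0pos : 0 < #K0 := card_pos.2 ⟨_, hmaps u0 hu0⟩
  obtain ⟨κ, _, hκ⟩ := exists_le_card_fiber_of_nsmul_le_card_of_maps_to hmaps (card_pos.1 hK0pos)
    (b := (#U : ℝ) / #K0) (by
      rw [nsmul_eq_mul, mul_div_cancel₀]
      exact_mod_cast hK0pos.ne')
  refine ⟨LinearMap.toMatrix' M, κ + u0.2 - M u0.1,
    ({u ∈ U | u.2 - u0.2 - M (u.1 - u0.1) = κ}).image Prod.fst, ?_, ?_⟩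
  · intro h hh
    obtain ⟨u, hu, rfl⟩ := mem_image.1 hh
    obtain ⟨hu, e⟩ := mem_filter.1 hu
    refine ⟨by rw [← hgraph u hu]; exact hu, ?_⟩
    rw [LinearMap.toMatrix'_mulVec, ← hgraph u hu, ← e, map_sub]
    abel
  · rw [card_image_of_injOn]
    · refine le_trans ?_ hκ
      gcongr
    · intro u hu u' hu' h
      have hu := (mem_filter.1 (mem_coe.1 hu)).1
      have hu' := (mem_filter.1 (mem_coe.1 hu')).1
      exact Prod.ext h (by rw [hgraph u hu, hgraph u' hu', h])

lemma repCount_graph {G : Type*} [AddCommGroup G] [DecidableEq G] (H : Finset G) (ξ : G → G)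
    (s t : G) :
    repCount (H.image fun h => (h, ξ h)) (-s, t) = diffCount H ξ s t := by
  symm
  refine card_bij (fun h _ => ((h, ξ h), (h + s, ξ (h + s)))) ?_ ?_ ?_
  · intro h hh
    rw [mem_filter] at hh
    rw [mem_filter, mem_product]
    refine ⟨⟨mem_image_of_mem _ hh.1, mem_image.2 ⟨_, hh.2.1, rfl⟩⟩, ?_⟩
    exact Prod.ext (by simp) hh.2.2
  · intro h _ h' _ e
    exact congrArg (fun x => x.1.1) e
  · rintro ⟨x, y⟩ h
    rw [mem_filter, mem_product] at h
    obtain ⟨⟨hx, hy⟩, e⟩ := h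
    obtain ⟨a, ha, rfl⟩ := mem_image.1 hx
    obtain ⟨b, hb, rfl⟩ := mem_image.1 hy
    have e1 : a - b = -s := congrArg Prod.fst e
    have e2 : ξ a - ξ b = t := congrArg Prod.snd e
    have e3 : b = a + s := by rw [← neg_neg s, ← e1]; abel
    subst e3
    exact ⟨a, mem_filter.2 ⟨ha, hb, e2⟩, rfl⟩

/-- The doubling constant produced by the Balog-Szemerédi-Gowers step at density `ε`. -/
noncomputable def doublingConst (ε : ℝ) : ℕ := ⌈4096 / (ε ^ 4 / 32) ^ 10⌉₊

/-- The proportion of derivatives on which the frequency function is affine. -/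
noncomputable def affineConst (p : ℕ) (ε : ℝ) : ℝ :=
  ε ^ 4 / 128 / (p ^ doublingConst ε ^ 5 * doublingConst ε : ℕ)

lemma doublingConst_pos {ε : ℝ} (hε : 0 < ε) : 0 < doublingConst ε :=
  Nat.ceil_pos.2 (by positivity)

lemma affineConst_pos {ε : ℝ} (hε : 0 < ε) : 0 < affineConst p ε := by
  have h1 := doublingConst_pos hε
  have h2 : 0 < p := (Fact.out : p.Prime).pos
  rw [affineConst]
  positivity

lemma exists_affine_derivCoeff {n : ℕ} (f : Vec p n → ℝ) (hf : ∀ x, |f x| ≤ 1) {ε : ℝ} (hε : 0 < ε)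
    (hU : ε * (Fintype.card (Vec p n) : ℝ) ^ 4 ≤ U3pow8 f) :
    ∃ (M : Matrix (Fin n) (Fin n) (ZMod p)) (b : Vec p n) (H : Finset (Vec p n)),
      (∀ h ∈ H, ε / 2 * (Fintype.card (Vec p n) : ℝ) ^ 2 ≤ derivCoeff f h (M *ᵥ h + b)) ∧
      affineConst p ε * Fintype.card (Vec p n) ≤ #H := by
  have hNpos : (0 : ℝ) < Fintype.card (Vec p n) := by exact_mod_cast Fintype.card_pos
  obtain ⟨H, ξ, hH1, hH2⟩ := exists_large_derivCoeff f hf hε hU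
  have hen := energy_of_derivCoeff f hf H ξ (by positivity) hH2
  set Γ := H.image fun h => (h, ξ h) with hΓ
  have hΓc : (#Γ : ℝ) ≤ Fintype.card (Vec p n) := by
    norm_cast
    exact card_image_le.trans (card_le_univ _)
  have hE : ∑ d, (repCount Γ d : ℝ) ^ 2 = ∑ s, ∑ t, (diffCount H ξ s t : ℝ) ^ 2 := by
    rw [Fintype.sum_prod_type]
    refine (Fintype.sum_equiv (Equiv.neg _) _ _ fun s => ?_).symm
    refine sum_congr rfl fun t _ => ?_
    rw [Equiv.neg_apply, hΓ, repCount_graph]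
  obtain ⟨U, hUΓ, hUc, hUd⟩ := balog_szemeredi_gowers Γ (c := ε ^ 4 / 32) hNpos hΓc (by positivity)
    (by rw [hE]; refine le_trans (le_of_eq ?_) hen; ring)
  have hUne : U.Nonempty := by
    rw [← card_pos]
    have : (0 : ℝ) < #U := lt_of_lt_of_le (by positivity) hUc
    exact_mod_cast this
  have hKd : #(U - U) ≤ doublingConst ε * #U := by
    have h1 : (#(U - U) : ℝ) ≤ doublingConst ε * #U := by
      refine hUd.trans ?_
      gcongr
      exact Nat.le_ceil _
    exact_mod_cast h1
  have hgraph : ∀ u ∈ U, u.2 = ξ u.1 := by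
    intro u hu
    obtain ⟨h, _, rfl⟩ := mem_image.1 (hUΓ hu)
    rfl
  obtain ⟨M, b, H', hH', hc⟩ := exists_affine_on_large_subset (p := p)
    (L := p ^ doublingConst ε ^ 5 * doublingConst ε) ξ hUne hgraph
    ((card_span_sub_le hUne hKd).trans_eq (mul_assoc _ _ _).symm)
  refine ⟨M, b, H', ?_, ?_⟩
  · intro h hh
    obtain ⟨h1, h2⟩ := hH' h hh
    rw [← h2]
    obtain ⟨h', hh', e⟩ := mem_image.1 (hUΓ h1)
    have : h' = h := congrArg Prod.fst e
    exact hH1 h (this ▸ hh')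
  · refine le_trans ?_ hc
    rw [affineConst, div_mul_eq_mul_div]
    gcongr
    refine le_trans (le_of_eq ?_) hUc
    ring

end Freiman

section InverseTheorem

variable {p : ℕ} [Fact p.Prime] {n : ℕ}

lemma exists_le_norm {ι : Type*} [Fintype ι] [Nonempty ι] (g : ι → ℂ) {c : ℝ}
    (h : Fintype.card ι * c ≤ ‖∑ i, g i‖) : ∃ i, c ≤ ‖g i‖ := by
  by_contra! hcon
  have h1 : ‖∑ i, g i‖ < ∑ _i : ι, c :=
    (norm_sum_le _ _).trans_lt (sum_lt_sum_of_nonempty univ_nonempty fun i _ => hcon i)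
  simp only [sum_const, card_univ, nsmul_eq_mul] at h1
  linarith

lemma dot_mulVec_transpose (A : Matrix (Fin n) (Fin n) (ZMod p)) (u v : Vec p n) :
    u ⬝ᵥ Aᵀ *ᵥ v = v ⬝ᵥ A *ᵥ u := by
  rw [Matrix.mulVec_transpose, dotProduct_comm, Matrix.dotProduct_mulVec]

lemma dot_mulVec_antisymm {T : Matrix (Fin n) (Fin n) (ZMod p)} (hT : Tᵀ = -T) (u v : Vec p n) :
    u ⬝ᵥ T *ᵥ v = -(v ⬝ᵥ T *ᵥ u) := by
  rw [← dot_mulVec_transpose, hT, Matrix.neg_mulVec, dotProduct_neg]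

lemma dot_mulVec_self_eq_zero (h2 : (2 : ZMod p) ≠ 0) {T : Matrix (Fin n) (Fin n) (ZMod p)}
    (hT : Tᵀ = -T) (v : Vec p n) : v ⬝ᵥ T *ᵥ v = 0 := by
  have h := dot_mulVec_antisymm hT v v
  have h3 : (2 : ZMod p) * (v ⬝ᵥ T *ᵥ v) = 0 := by linear_combination h
  exact (mul_eq_zero.1 h3).resolve_left h2

lemma dot_mulVec_symm {S : Matrix (Fin n) (Fin n) (ZMod p)} (hS : S.IsSymm) (u v : Vec p n) :
    u ⬝ᵥ S *ᵥ v = v ⬝ᵥ S *ᵥ u := by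
  rw [← dot_mulVec_transpose, hS.eq]

/-- The kernel of a matrix. -/
noncomputable def kerSet (T : Matrix (Fin n) (Fin n) (ZMod p)) : Finset (Vec p n) :=
  {v | T *ᵥ v = 0}

lemma sq_norm_bilinear_sum_le (T : Matrix (Fin n) (Fin n) (ZMod p)) (a b : Vec p n → ℂ)
    (ha : ∀ x, ‖a x‖ ≤ 1) (hb : ∀ x, ‖b x‖ ≤ 1) :
    ‖∑ v, ∑ v', a v * b v' * chi (v ⬝ᵥ T *ᵥ v')‖ ^ 2 ≤
      (Fintype.card (Vec p n) : ℝ) ^ 3 * #(kerSet T) := by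
  have h1 : ∑ v, ∑ v', a v * b v' * chi (v ⬝ᵥ T *ᵥ v') =
      ∑ v, a v * ∑ v', b v' * chi (v ⬝ᵥ T *ᵥ v') := by
    simp_rw [mul_sum, mul_assoc]
  rw [h1]
  refine (sq_norm_sum_mul_le_card _ _ ha).trans ?_
  have h2 : ((∑ v, ‖∑ v', b v' * chi (v ⬝ᵥ T *ᵥ v')‖ ^ 2 : ℝ) : ℂ) =
      ∑ v', ∑ v'', if v' - v'' ∈ kerSet T then
        b v' * conj (b v'') * Fintype.card (Vec p n) else 0 := by
    rw [Complex.ofReal_sum]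
    simp_rw [ofReal_sq_norm_sum]
    rw [sum_comm]
    refine sum_congr rfl fun v' _ => ?_
    rw [sum_comm]
    refine sum_congr rfl fun v'' _ => ?_
    calc _ = b v' * conj (b v'') * ∑ v : Vec p n, chi (v ⬝ᵥ (T *ᵥ (v' - v''))) := by
          rw [mul_sum]
          refine sum_congr rfl fun v _ => ?_
          rw [Matrix.mulVec_sub, dotProduct_sub, chi_sub, map_mul]
          ring
      _ = _ := by
          rw [sum_chi_dot', mul_ite, mul_zero]
          simp [kerSet]
  have h3 : ∑ v, ‖∑ v', b v' * chi (v ⬝ᵥ T *ᵥ v')‖ ^ 2 ≤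
      (Fintype.card (Vec p n) : ℝ) ^ 2 * #(kerSet T) := by
    have h4 : (0 : ℝ) ≤ ∑ v, ‖∑ v', b v' * chi (v ⬝ᵥ T *ᵥ v')‖ ^ 2 := by positivity
    rw [← abs_of_nonneg h4, ← Real.norm_eq_abs, ← Complex.norm_real, h2]
    calc _ ≤ ∑ v' : Vec p n,
          ∑ v'' : Vec p n, if v' - v'' ∈ kerSet T then (Fintype.card (Vec p n) : ℝ) else 0 := by
          refine (norm_sum_le _ _).trans (sum_le_sum fun v' _ => (norm_sum_le _ _).trans
            (sum_le_sum fun v'' _ => ?_))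
          split_ifs
          · rw [norm_mul, norm_mul, RCLike.norm_conj, Complex.norm_natCast]
            exact mul_le_of_le_one_left (Nat.cast_nonneg _)
              (mul_le_one₀ (hb _) (norm_nonneg _) (hb _))
          · simp
      _ = ∑ v' : Vec p n, ∑ u : Vec p n, if u ∈ kerSet T then (Fintype.card (Vec p n) : ℝ) else 0 :=
          sum_congr rfl fun v' _ => Fintype.sum_equiv (Equiv.subLeft v') _ _ fun v'' => rfl
      _ = _ := by
          simp only [sum_ite_mem, univ_inter, sum_const, nsmul_eq_mul, card_univ]
          ring
  calc _ ≤ (Fintype.card (Vec p n) : ℝ) * ((Fintype.card (Vec p n) : ℝ) ^ 2 * #(kerSet T)) :=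
      by gcongr
    _ = _ := by ring

/-- A sum over parallelograms of four functions twisted by an antisymmetric bilinear phase can only
be large if the form has a large kernel. -/
lemma kerSet_large (h2 : (2 : ZMod p) ≠ 0) {T : Matrix (Fin n) (Fin n) (ZMod p)} (hT : Tᵀ = -T)
    (F₁ F₂ F₃ F₄ : Vec p n → ℂ)
    (h₁ : ∀ x, ‖F₁ x‖ ≤ 1) (h₂ : ∀ x, ‖F₂ x‖ ≤ 1) (h₃ : ∀ x, ‖F₃ x‖ ≤ 1) (h₄ : ∀ x, ‖F₄ x‖ ≤ 1)
    {c : ℝ} (hc : 0 ≤ c)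
    (hI : c * (Fintype.card (Vec p n) : ℝ) ^ 3 ≤
      ‖∑ h, ∑ x, ∑ k, F₁ x * F₂ (x + h) * F₃ (x + k) * F₄ (x + h + k) * chi (k ⬝ᵥ T *ᵥ h)‖) :
    c ^ 4 * Fintype.card (Vec p n) ≤ #(kerSet T) := by
  set N : ℝ := (Fintype.card (Vec p n) : ℝ) with hN
  have hNpos : 0 < N := by rw [hN]; exact_mod_cast Fintype.card_pos
  have chi1 : ∀ a : ZMod p, ‖chi a‖ ≤ 1 := fun a => (norm_chi a).le
  have mul1 : ∀ {a b : ℂ}, ‖a‖ ≤ 1 → ‖b‖ ≤ 1 → ‖a * b‖ ≤ 1 := fun ha hb => by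
    rw [norm_mul]; exact mul_le_one₀ ha (norm_nonneg _) hb
  have conj1 : ∀ {a : ℂ}, ‖a‖ ≤ 1 → ‖conj a‖ ≤ 1 := fun ha => by rwa [RCLike.norm_conj]
  let e : Vec p n × Vec p n × Vec p n ≃ Vec p n × Vec p n × Vec p n :=
    { toFun := fun t => (t.2.1 + t.1 + t.2.2, t.2.1 + t.1, t.2.1 + t.2.2)
      invFun := fun t => (t.1 - t.2.2, t.2.1 + t.2.2 - t.1, t.1 - t.2.1)
      left_inv := fun t => by ext1 <;> [skip; ext1] <;> simp only [] <;> abel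
      right_inv := fun t => by ext1 <;> [skip; ext1] <;> simp only [] <;> abel }
  have hrep : ∑ h, ∑ x, ∑ k, F₁ x * F₂ (x + h) * F₃ (x + k) * F₄ (x + h + k) * chi (k ⬝ᵥ T *ᵥ h) =
      ∑ w, ∑ u, ∑ v, F₁ (u + v - w) * F₂ u * F₃ v * F₄ w * chi ((w - u) ⬝ᵥ T *ᵥ (w - v)) := by
    have h1 := Fintype.sum_equiv e
      (fun t => F₁ t.2.1 * F₂ (t.2.1 + t.1) * F₃ (t.2.1 + t.2.2) * F₄ (t.2.1 + t.1 + t.2.2) *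
        chi (t.2.2 ⬝ᵥ T *ᵥ t.1))
      (fun t => F₁ (t.2.1 + t.2.2 - t.1) * F₂ t.2.1 * F₃ t.2.2 * F₄ t.1 *
        chi ((t.1 - t.2.1) ⬝ᵥ T *ᵥ (t.1 - t.2.2))) (fun t => by
          simp only [e, Equiv.coe_fn_mk]
          rw [show t.2.1 + t.1 + (t.2.1 + t.2.2) - (t.2.1 + t.1 + t.2.2) = t.2.1 by abel,
            show t.2.1 + t.1 + t.2.2 - (t.2.1 + t.1) = t.2.2 by abel,
            show t.2.1 + t.1 + t.2.2 - (t.2.1 + t.2.2) = t.1 by abel])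
    simpa only [Fintype.sum_prod_type] using h1
  rw [hrep] at hI
  obtain ⟨w, hw⟩ := exists_le_norm _ (c := c * N ^ 2) (le_trans (le_of_eq (by rw [← hN]; ring)) hI)
  set G₂ : Vec p n → ℂ := fun u => F₂ u * chi (-(u ⬝ᵥ T *ᵥ w)) with hG2
  set G₃ : Vec p n → ℂ := fun v => F₃ v * chi (w ⬝ᵥ T *ᵥ (w - v)) with hG3
  set G₁ : Vec p n → ℂ := fun z => F₁ (z - w) * F₄ w with hG1
  have b2 : ∀ u, ‖G₂ u‖ ≤ 1 := fun u => mul1 (h₂ _) (chi1 _)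
  have b3 : ∀ u, ‖G₃ u‖ ≤ 1 := fun u => mul1 (h₃ _) (chi1 _)
  have b1 : ∀ u, ‖G₁ u‖ ≤ 1 := fun u => mul1 (h₁ _) (h₄ _)
  have hw2 : ∑ u, ∑ v, F₁ (u + v - w) * F₂ u * F₃ v * F₄ w * chi ((w - u) ⬝ᵥ T *ᵥ (w - v)) =
      ∑ u, G₂ u * ∑ v, G₃ v * G₁ (u + v) * chi (u ⬝ᵥ T *ᵥ v) := by
    refine sum_congr rfl fun u _ => ?_
    rw [mul_sum]
    refine sum_congr rfl fun v _ => ?_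
    have : (w - u) ⬝ᵥ T *ᵥ (w - v) = -(u ⬝ᵥ T *ᵥ w) + w ⬝ᵥ T *ᵥ (w - v) + u ⬝ᵥ T *ᵥ v := by
      simp only [sub_dotProduct, Matrix.mulVec_sub, dotProduct_sub]
      ring
    rw [this, chi_add, chi_add]
    simp only [hG1, hG2, hG3]
    ring
  rw [hw2] at hw
  have hz : c ^ 2 * N ^ 3 ≤ ∑ u, ‖∑ v, G₃ v * G₁ (u + v) * chi (u ⬝ᵥ T *ᵥ v)‖ ^ 2 := by
    have h1 := sq_norm_sum_mul_le_card _ (fun u => ∑ v, G₃ v * G₁ (u + v) * chi (u ⬝ᵥ T *ᵥ v)) b2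
    have h2 : (c * N ^ 2) ^ 2 ≤ ‖∑ u, G₂ u * ∑ v, G₃ v * G₁ (u + v) * chi (u ⬝ᵥ T *ᵥ v)‖ ^ 2 :=
      pow_le_pow_left₀ (by positivity) hw 2
    have h3 : N * (c ^ 2 * N ^ 3) ≤
        N * ∑ u, ‖∑ v, G₃ v * G₁ (u + v) * chi (u ⬝ᵥ T *ᵥ v)‖ ^ 2 := by
      refine le_trans (le_of_eq (by ring)) (h2.trans h1)
    exact le_of_mul_le_mul_left h3 hNpos
  have hzz : ((∑ u, ‖∑ v, G₃ v * G₁ (u + v) * chi (u ⬝ᵥ T *ᵥ v)‖ ^ 2 : ℝ) : ℂ) =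
      ∑ z, ∑ v, ∑ v', (G₃ v * conj (G₁ (z - v)) * chi (z ⬝ᵥ T *ᵥ v)) *
        (conj (G₃ v') * G₁ (z - v') * conj (chi (z ⬝ᵥ T *ᵥ v'))) *
          chi (v ⬝ᵥ ((2 : ZMod p) • T) *ᵥ v') := by
    rw [Complex.ofReal_sum]
    simp_rw [ofReal_sq_norm_sum]
    rw [sum_comm]
    conv_rhs => rw [sum_comm]
    refine sum_congr rfl fun v _ => ?_
    rw [sum_comm]
    conv_rhs => rw [sum_comm]
    refine sum_congr rfl fun v' _ => ?_
    refine Fintype.sum_equiv (Equiv.addRight (v + v')) _ _ fun u => ?_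
    simp only [Equiv.coe_addRight]
    rw [show u + (v + v') - v = u + v' by abel, show u + (v + v') - v' = u + v by abel]
    have hp : u ⬝ᵥ T *ᵥ v - u ⬝ᵥ T *ᵥ v' =
        (u + (v + v')) ⬝ᵥ T *ᵥ v - (u + (v + v')) ⬝ᵥ T *ᵥ v' + v ⬝ᵥ ((2 : ZMod p) • T) *ᵥ v' := by
      simp only [add_dotProduct, Matrix.smul_mulVec, dotProduct_smul, smul_eq_mul]
      have e1 := dot_mulVec_self_eq_zero h2 hT v
      have e2 := dot_mulVec_self_eq_zero h2 hT v'
      have e3 := dot_mulVec_antisymm hT v' v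
      linear_combination -e1 + e2 - e3
    have hp2 := congrArg chi hp
    simp only [chi_add, chi_sub] at hp2
    simp only [map_mul]
    linear_combination (G₃ v * G₁ (u + v) * conj (G₃ v') * conj (G₁ (u + v'))) * hp2
  have hz2 : N * (c ^ 2 * N ^ 2) ≤ ‖∑ z, ∑ v, ∑ v', (G₃ v * conj (G₁ (z - v)) * chi (z ⬝ᵥ T *ᵥ v)) *
        (conj (G₃ v') * G₁ (z - v') * conj (chi (z ⬝ᵥ T *ᵥ v'))) *
          chi (v ⬝ᵥ ((2 : ZMod p) • T) *ᵥ v')‖ := by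
    rw [← hzz, Complex.norm_real, Real.norm_eq_abs]
    refine le_trans ?_ (le_abs_self _)
    refine le_trans (le_of_eq ?_) hz
    ring
  obtain ⟨z, hz3⟩ := exists_le_norm _ hz2
  have h5 := sq_norm_bilinear_sum_le ((2 : ZMod p) • T)
    (fun v => G₃ v * conj (G₁ (z - v)) * chi (z ⬝ᵥ T *ᵥ v))
    (fun v' => conj (G₃ v') * G₁ (z - v') * conj (chi (z ⬝ᵥ T *ᵥ v')))
    (fun v => mul1 (mul1 (b3 _) (conj1 (b1 _))) (chi1 _))
    (fun v => mul1 (mul1 (conj1 (b3 _)) (b1 _)) (conj1 (chi1 _)))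
  have hker : kerSet ((2 : ZMod p) • T) = kerSet T := by
    ext v
    simp [kerSet, Matrix.smul_mulVec, h2]
  rw [hker, ← hN] at h5
  have h6 : (c ^ 2 * N ^ 2) ^ 2 ≤ N ^ 3 * #(kerSet T) :=
    (pow_le_pow_left₀ (by positivity) hz3 2).trans h5
  have h7 : N ^ 3 * (c ^ 4 * N) ≤ N ^ 3 * #(kerSet T) := le_trans (le_of_eq (by ring)) h6
  exact le_of_mul_le_mul_left h7 (by positivity)

end InverseTheorem

section QuadraticCorrelation

variable {p : ℕ} [Fact p.Prime] {n : ℕ}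

lemma exists_large_fourier_of_kerSet (T : Matrix (Fin n) (Fin n) (ZMod p))
    (F₁ F₂ F₃ F₄ : Vec p n → ℂ)
    (h₁ : ∀ x, ‖F₁ x‖ ≤ 1) (h₂ : ∀ x, ‖F₂ x‖ ≤ 1) (h₃ : ∀ x, ‖F₃ x‖ ≤ 1)
    {c : ℝ} (hc : 0 ≤ c)
    (hI : c * (Fintype.card (Vec p n) : ℝ) ^ 3 ≤
      ‖∑ h, ∑ x, ∑ k, F₁ x * F₂ (x + h) * F₃ (x + k) * F₄ (x + h + k) * chi (k ⬝ᵥ T *ᵥ h)‖)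
    (hW : c ^ 4 * Fintype.card (Vec p n) ≤ #(kerSet T)) :
    ∃ ξ : Vec p n, c ^ 3 * Fintype.card (Vec p n) ≤ ‖∑ x, F₄ x * chi (ξ ⬝ᵥ x)‖ := by
  set N : ℝ := (Fintype.card (Vec p n) : ℝ) with hN
  have hNpos : 0 < N := by rw [hN]; exact_mod_cast Fintype.card_pos
  have chi1 : ∀ a : ZMod p, ‖chi a‖ ≤ 1 := fun a => (norm_chi a).le
  have mul1 : ∀ {a b : ℂ}, ‖a‖ ≤ 1 → ‖b‖ ≤ 1 → ‖a * b‖ ≤ 1 := fun ha hb => by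
    rw [norm_mul]; exact mul_le_one₀ ha (norm_nonneg _) hb
  set J : Vec p n → ℂ := fun h =>
    ∑ x, ∑ k, F₁ x * F₂ (x + h) * F₃ (x + k) * F₄ (x + h + k) * chi (k ⬝ᵥ T *ᵥ h) with hJ
  set w : ℝ := (#(kerSet T) : ℝ) with hw
  have hwpos : 0 < w := by
    rw [hw]; exact_mod_cast card_pos.2 ⟨0, by simp [kerSet]⟩
  have hsum : ∑ h, ∑ u ∈ kerSet T, J (h + u) = (w : ℂ) * ∑ h, J h := by
    rw [sum_comm]
    rw [sum_congr rfl fun u _ => Fintype.sum_equiv (Equiv.addRight u) (fun h => J (h + u)) J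
      fun h => rfl]
    simp [hw]
  obtain ⟨h0, hh0⟩ : ∃ h0, w * c * N ^ 2 ≤ ‖∑ u ∈ kerSet T, J (h0 + u)‖ := by
    apply exists_le_norm
    rw [hsum, norm_mul, Complex.norm_real, Real.norm_eq_abs, abs_of_pos hwpos, ← hN]
    calc N * (w * c * N ^ 2) = w * (c * N ^ 3) := by ring
      _ ≤ _ := mul_le_mul_of_nonneg_left hI hwpos.le
  set A : Vec p n → ℂ := fun y => F₃ y * chi (y ⬝ᵥ T *ᵥ h0) with hA
  have hA1 : ∀ y, ‖A y‖ ≤ 1 := fun y => mul1 (h₃ _) (chi1 _)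
  set P : Vec p n → ℂ := fun u => ∑ x, F₁ x * chi (-(x ⬝ᵥ T *ᵥ h0)) * F₂ (x + h0 + u) with hP
  set R : Vec p n → ℂ := fun u => ∑ y, A y * F₄ (y + h0 + u) with hR
  have hPN : ∀ u, ‖P u‖ ≤ N := fun u => by
    refine (norm_sum_le _ _).trans ((sum_le_sum fun x _ =>
      mul1 (mul1 (h₁ _) (chi1 _)) (h₂ _)).trans ?_)
    simp [hN]
  have hJP : ∀ u ∈ kerSet T, J (h0 + u) = P u * R u := by
    intro u hu
    have hu' : T *ᵥ u = 0 := by simpa [kerSet] using hu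
    simp only [hJ, hP, hR, sum_mul]
    refine sum_congr rfl fun x _ => ?_
    rw [mul_sum]
    refine Fintype.sum_equiv (Equiv.addLeft x) _ _ fun k => ?_
    simp only [Equiv.coe_addLeft, hA]
    rw [Matrix.mulVec_add, hu', add_zero, add_dotProduct, chi_add, chi_neg]
    have h1 : chi (x ⬝ᵥ T *ᵥ h0) * conj (chi (x ⬝ᵥ T *ᵥ h0)) = 1 := by
      rw [Complex.mul_conj, Complex.normSq_eq_norm_sq, norm_chi]; simp
    rw [show x + (h0 + u) = x + h0 + u by abel, show x + k + h0 + u = x + h0 + u + k by abel]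
    linear_combination -(F₁ x * F₂ (x + h0 + u) * F₃ (x + k) *
      F₄ (x + h0 + u + k) * chi (k ⬝ᵥ T *ᵥ h0)) * h1
  rw [sum_congr rfl hJP] at hh0
  have hRW : c ^ 6 * N ^ 3 ≤ ∑ u, ‖R u‖ ^ 2 := by
    have e1 := pow_le_pow_left₀ (by positivity) hh0 2
    have e2 := e1.trans (sq_norm_sum_mul_le (kerSet T) P R)
    have e3 : ∑ u ∈ kerSet T, ‖P u‖ ^ 2 ≤ w * N ^ 2 := by
      refine (sum_le_sum fun u _ => pow_le_pow_left₀ (norm_nonneg _) (hPN u) 2).trans ?_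
      simp [hw]
    have e4 : ∑ u ∈ kerSet T, ‖R u‖ ^ 2 ≤ ∑ u, ‖R u‖ ^ 2 :=
      sum_le_sum_of_subset_of_nonneg (subset_univ _) fun _ _ _ => by positivity
    have e5 : (w * N ^ 2) * (w * c ^ 2 * N ^ 2) ≤ (w * N ^ 2) * ∑ u, ‖R u‖ ^ 2 :=
      calc _ = (w * c * N ^ 2) ^ 2 := by ring
        _ ≤ _ := e2.trans (mul_le_mul e3 e4 (sum_nonneg fun _ _ => by positivity) (by positivity))
    have e6 := le_of_mul_le_mul_left e5 (by positivity)
    calc c ^ 6 * N ^ 3 = (c ^ 4 * N) * (c ^ 2 * N ^ 2) := by ring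
      _ ≤ w * (c ^ 2 * N ^ 2) := mul_le_mul_of_nonneg_right hW (by positivity)
      _ = w * c ^ 2 * N ^ 2 := by ring
      _ ≤ _ := e6
  obtain ⟨ξ₀, hξ₀⟩ := Finite.exists_max fun ξ : Vec p n => ‖∑ x, F₄ x * chi (ξ ⬝ᵥ x)‖
  refine ⟨ξ₀, ?_⟩
  set m := ‖∑ x, F₄ x * chi (ξ₀ ⬝ᵥ x)‖
  have hfac : ∀ ξ : Vec p n, ∑ u, R u * chi (ξ ⬝ᵥ u) =
      (∑ y, A y * chi (-ξ ⬝ᵥ y)) * chi (-ξ ⬝ᵥ h0) * ∑ x, F₄ x * chi (ξ ⬝ᵥ x) := by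
    intro ξ
    simp only [hR, sum_mul]
    rw [sum_comm]
    refine sum_congr rfl fun y _ => ?_
    rw [mul_sum]
    refine Fintype.sum_equiv (Equiv.addLeft (y + h0)) _ _ fun u => ?_
    simp only [Equiv.coe_addLeft]
    have : chi (ξ ⬝ᵥ u) = chi (-ξ ⬝ᵥ y) * chi (-ξ ⬝ᵥ h0) * chi (ξ ⬝ᵥ (y + h0 + u)) := by
      rw [← chi_add, ← chi_add]
      simp only [dotProduct_add, neg_dotProduct]
      congr 1; ring
    rw [this]; ring
  have hpars := parseval R
  have hA2 : ∑ ξ : Vec p n, ‖∑ y, A y * chi (-ξ ⬝ᵥ y)‖ ^ 2 ≤ N ^ 2 := by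
    rw [Fintype.sum_equiv (Equiv.neg _) (fun ξ : Vec p n => ‖∑ y, A y * chi (-ξ ⬝ᵥ y)‖ ^ 2)
      (fun ξ => ‖∑ y, A y * chi (ξ ⬝ᵥ y)‖ ^ 2) fun ξ => rfl, parseval A]
    have : ∑ y, ‖A y‖ ^ 2 ≤ N := by
      refine (sum_le_sum fun y _ => pow_le_one₀ (norm_nonneg _) (hA1 y)).trans ?_
      simp [hN]
    calc _ ≤ N * N := mul_le_mul_of_nonneg_left this hNpos.le
      _ = _ := by ring
  have hup : N * ∑ u, ‖R u‖ ^ 2 ≤ m ^ 2 * N ^ 2 := by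
    rw [← hpars]
    calc _ ≤ ∑ ξ : Vec p n, m ^ 2 * ‖∑ y, A y * chi (-ξ ⬝ᵥ y)‖ ^ 2 := by
          refine sum_le_sum fun ξ _ => ?_
          rw [hfac, norm_mul, norm_mul, norm_chi, mul_one, mul_pow, mul_comm]
          exact mul_le_mul_of_nonneg_right (pow_le_pow_left₀ (norm_nonneg _) (hξ₀ ξ) 2)
            (by positivity)
      _ ≤ _ := by
          rw [← mul_sum]
          exact mul_le_mul_of_nonneg_left hA2 (by positivity)
  have h1 : N ^ 2 * (c ^ 3 * N) ^ 2 ≤ N ^ 2 * m ^ 2 := by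
    have := (mul_le_mul_of_nonneg_left hRW hNpos.le).trans hup
    linarith
  exact le_of_sq_le_sq (le_of_mul_le_mul_left h1 (by positivity)) (norm_nonneg _)
where le_of_sq_le_sq {a b : ℝ} (h : a ^ 2 ≤ b ^ 2) (hb : 0 ≤ b) : a ≤ b :=
  le_of_not_gt fun hlt => absurd h (not_le.2 (pow_lt_pow_left₀ hlt hb two_ne_zero))

lemma derivCoeff_eq (f : Vec p n → ℝ) (h ξ : Vec p n) :
    ((derivCoeff f h ξ : ℝ) : ℂ) =
      ∑ x, ∑ k, (f x : ℂ) * f (x + h) * f (x + k) * f (x + h + k) * chi (k ⬝ᵥ ξ) := by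
  rw [derivCoeff, ofReal_sq_norm_sum, sum_comm]
  refine sum_congr rfl fun x _ => ?_
  symm
  refine Fintype.sum_equiv (Equiv.addLeft x) _ _ fun k => ?_
  simp only [Equiv.coe_addLeft]
  rw [dotProduct_add, chi_add, map_mul, Complex.conj_ofReal]
  have h1 : chi (ξ ⬝ᵥ x) * conj (chi (ξ ⬝ᵥ x)) = 1 := by
    rw [Complex.mul_conj, Complex.normSq_eq_norm_sq, norm_chi]; simp
  rw [dotProduct_comm k ξ, show x + k + h = x + h + k by abel]
  push_cast
  linear_combination -((f x : ℂ) * f (x + h) * f (x + k) * f (x + h + k) * chi (ξ ⬝ᵥ k)) * h1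

/-- The correlation constant in the inverse theorem. -/
noncomputable def corrConst (p : ℕ) (ε : ℝ) : ℝ := (affineConst p ε * (ε / 2)) ^ 3

/-- Inverse theorem for the `U³` norm over `𝔽_p^n`. -/
theorem exists_quadratic_correlation (h2 : (2 : ZMod p) ≠ 0) (f : Vec p n → ℝ)
    (hf : ∀ x, |f x| ≤ 1) {ε : ℝ} (hε : 0 < ε)
    (hU : ε * (Fintype.card (Vec p n) : ℝ) ^ 4 ≤ U3pow8 f) :
    ∃ (M : Matrix (Fin n) (Fin n) (ZMod p)) (b : Vec p n), M.IsSymm ∧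
      corrConst p ε * Fintype.card (Vec p n) ≤
        ‖∑ x, (f x : ℂ) * chi (x ⬝ᵥ M *ᵥ x + b ⬝ᵥ x)‖ := by
  obtain ⟨M, b, H, hH, hHc⟩ := exists_affine_derivCoeff f hf hε hU
  set N : ℝ := (Fintype.card (Vec p n) : ℝ) with hN
  have hNpos : 0 < N := by rw [hN]; exact_mod_cast Fintype.card_pos
  set c : ℝ := affineConst p ε * (ε / 2) with hc
  have hcpos : 0 < c := mul_pos (affineConst_pos hε) (by positivity)
  set S : Matrix (Fin n) (Fin n) (ZMod p) := ((2 : ZMod p)⁻¹ * (2 : ZMod p)⁻¹) • (M + Mᵀ) with hS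
  set T : Matrix (Fin n) (Fin n) (ZMod p) := (2 : ZMod p)⁻¹ • (M - Mᵀ) with hT
  have hSs : S.IsSymm := by
    simp only [Matrix.IsSymm, hS, Matrix.transpose_smul, Matrix.transpose_add,
      Matrix.transpose_transpose, add_comm]
  have hTa : Tᵀ = -T := by
    simp only [hT, Matrix.transpose_smul, Matrix.transpose_sub, Matrix.transpose_transpose,
      ← smul_neg, neg_sub]
  have hMST : M = (2 : ZMod p) • S + T := by
    simp only [hS, hT, smul_smul, mul_inv_cancel_left₀ h2, ← smul_add]
    rw [add_add_sub_cancel, ← two_smul (ZMod p) M, smul_smul, inv_mul_cancel₀ h2, one_smul]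
  have chi1 : ∀ a : ZMod p, ‖chi a‖ ≤ 1 := fun a => (norm_chi a).le
  have mul1 : ∀ {a b : ℂ}, ‖a‖ ≤ 1 → ‖b‖ ≤ 1 → ‖a * b‖ ≤ 1 := fun ha hb => by
    rw [norm_mul]; exact mul_le_one₀ ha (norm_nonneg _) hb
  have hf1 : ∀ x, ‖(f x : ℂ)‖ ≤ 1 := fun x => by
    rw [Complex.norm_real]; exact hf x
  set Q : Vec p n → ZMod p := fun x => x ⬝ᵥ S *ᵥ x with hQ
  have hI : c * N ^ 3 ≤ ‖∑ h, ∑ x, ∑ k, ((f x : ℂ) * chi (Q x)) *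
      ((f (x + h) : ℂ) * chi (-Q (x + h) - b ⬝ᵥ (x + h))) * ((f (x + k) : ℂ) * chi (-Q (x + k))) *
      ((f (x + h + k) : ℂ) * chi (Q (x + h + k) + b ⬝ᵥ (x + h + k))) * chi (k ⬝ᵥ T *ᵥ h)‖ := by
    have e1 : c * N ^ 3 ≤ ∑ h, derivCoeff f h (M *ᵥ h + b) := by
      calc c * N ^ 3 = (affineConst p ε * N) * (ε / 2 * N ^ 2) := by rw [hc]; ring
        _ ≤ #H * (ε / 2 * N ^ 2) := mul_le_mul_of_nonneg_right hHc (by positivity)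
        _ ≤ ∑ h ∈ H, derivCoeff f h (M *ᵥ h + b) := by
            rw [← nsmul_eq_mul]; exact card_nsmul_le_sum _ _ _ hH
        _ ≤ _ := sum_le_sum_of_subset_of_nonneg (subset_univ _) fun _ _ _ => by
            unfold derivCoeff; positivity
    refine e1.trans (le_of_eq ?_)
    have e2 : 0 ≤ ∑ h, derivCoeff f h (M *ᵥ h + b) := le_trans (by positivity) e1
    rw [← abs_of_nonneg e2, ← Real.norm_eq_abs, ← Complex.norm_real, Complex.ofReal_sum]
    congr 1
    refine sum_congr rfl fun h _ => ?_
    rw [derivCoeff_eq]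
    refine sum_congr rfl fun x _ => sum_congr rfl fun k _ => ?_
    have e3 : k ⬝ᵥ (M *ᵥ h + b) = Q x + (-Q (x + h) - b ⬝ᵥ (x + h)) + -Q (x + k) +
        (Q (x + h + k) + b ⬝ᵥ (x + h + k)) + k ⬝ᵥ T *ᵥ h := by
      simp only [hQ, hMST, dotProduct_add, add_dotProduct, Matrix.mulVec_add, Matrix.add_mulVec,
        Matrix.smul_mulVec, dotProduct_smul, smul_eq_mul]
      have s1 := dot_mulVec_symm hSs h k
      have s2 := dotProduct_comm k b
      linear_combination s2 - s1
    rw [e3]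
    simp only [chi_add]
    ring
  have hI1 := kerSet_large h2 hTa (fun x => (f x : ℂ) * chi (Q x))
    (fun x => (f x : ℂ) * chi (-Q x - b ⬝ᵥ x)) (fun x => (f x : ℂ) * chi (-Q x))
    (fun x => (f x : ℂ) * chi (Q x + b ⬝ᵥ x))
    (fun x => mul1 (hf1 _) (chi1 _)) (fun x => mul1 (hf1 _) (chi1 _))
    (fun x => mul1 (hf1 _) (chi1 _)) (fun x => mul1 (hf1 _) (chi1 _)) hcpos.le hI
  obtain ⟨ξ, hξ⟩ := exists_large_fourier_of_kerSet T (fun x => (f x : ℂ) * chi (Q x))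
    (fun x => (f x : ℂ) * chi (-Q x - b ⬝ᵥ x)) (fun x => (f x : ℂ) * chi (-Q x))
    (fun x => (f x : ℂ) * chi (Q x + b ⬝ᵥ x))
    (fun x => mul1 (hf1 _) (chi1 _)) (fun x => mul1 (hf1 _) (chi1 _))
    (fun x => mul1 (hf1 _) (chi1 _)) hcpos.le hI hI1
  refine ⟨S, b + ξ, hSs, hξ.trans (le_of_eq ?_)⟩
  congr 1
  refine sum_congr rfl fun x _ => ?_
  rw [mul_assoc, ← chi_add, add_dotProduct, add_assoc]

lemma corrConst_pos {ε : ℝ} (hε : 0 < ε) : 0 < corrConst p ε :=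
  pow_pos (mul_pos (affineConst_pos hε) (by positivity)) 3

end QuadraticCorrelation

section FibreAverage

variable {G α β : Type*} [Fintype G]

/-- The average of `f` over the fibres of `φ`. -/
noncomputable def fibreAvg (f : G → ℝ) (φ : G → α) (x : G) : ℝ :=
  (∑ y with φ y = φ x, f y) / #{y | φ y = φ x}

lemma fibreAvg_congr (f : G → ℝ) (φ : G → α) {x y : G} (h : φ x = φ y) :
    fibreAvg f φ x = fibreAvg f φ y := by
  simp only [fibreAvg, h]

lemma fibre_card_pos (φ : G → α) (x : G) : (0 : ℝ) < #{y | φ y = φ x} := by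
  exact_mod_cast card_pos.2 ⟨x, by simp⟩

lemma fibreAvg_nonneg {f : G → ℝ} (hf : ∀ x, 0 ≤ f x) (φ : G → α) (x : G) : 0 ≤ fibreAvg f φ x :=
  div_nonneg (sum_nonneg fun _ _ => hf _) (Nat.cast_nonneg _)

lemma fibreAvg_le_one {f : G → ℝ} (hf : ∀ x, f x ≤ 1) (φ : G → α) (x : G) :
    fibreAvg f φ x ≤ 1 := by
  rw [fibreAvg, div_le_one (fibre_card_pos φ x)]
  exact (sum_le_sum fun y _ => hf y).trans (by simp)

lemma sum_fibreAvg_mul (f : G → ℝ) (φ : G → α) (u : G → ℝ)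
    (hu : ∀ x y, φ x = φ y → u x = u y) :
    ∑ x, fibreAvg f φ x * u x = ∑ x, f x * u x := by
  have h1 : ∀ x, fibreAvg f φ x * u x =
      ∑ y, if φ y = φ x then f y * u y / #{z | φ z = φ y} else 0 := by
    intro x
    rw [← sum_filter, fibreAvg, sum_div, sum_mul]
    refine sum_congr rfl fun y hy => ?_
    have hy' : φ y = φ x := (mem_filter.1 hy).2
    rw [hu y x hy', hy']
    ring
  simp_rw [h1]
  rw [sum_comm]
  refine sum_congr rfl fun y _ => ?_
  rw [← sum_filter, sum_const, nsmul_eq_mul]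
  have h2 : (univ.filter fun x => φ y = φ x) = univ.filter fun z => φ z = φ y :=
    filter_congr fun z _ => eq_comm
  rw [h2]
  have := fibre_card_pos φ y
  field_simp

lemma sum_sub_fibreAvg_mul (f : G → ℝ) (φ : G → α) (u : G → ℝ)
    (hu : ∀ x y, φ x = φ y → u x = u y) :
    ∑ x, (f x - fibreAvg f φ x) * u x = 0 := by
  simp_rw [sub_mul]
  rw [sum_sub_distrib, sum_fibreAvg_mul f φ u hu, sub_self]

lemma sum_fibreAvg_sq_add (f : G → ℝ) (φ : G → α) (ψ : G → β)
    (h : ∀ x y, ψ x = ψ y → φ x = φ y) :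
    ∑ x, (fibreAvg f ψ x - fibreAvg f φ x) ^ 2 =
      ∑ x, fibreAvg f ψ x ^ 2 - ∑ x, fibreAvg f φ x ^ 2 := by
  have h1 := sum_fibreAvg_mul f ψ (fibreAvg f φ) fun x y hxy => fibreAvg_congr f φ (h x y hxy)
  have h2 := sum_fibreAvg_mul f φ (fibreAvg f φ) fun x y hxy => fibreAvg_congr f φ hxy
  have h3 : ∀ x, (fibreAvg f ψ x - fibreAvg f φ x) ^ 2 = fibreAvg f ψ x ^ 2 -
      2 * (fibreAvg f ψ x * fibreAvg f φ x) + fibreAvg f φ x * fibreAvg f φ x := fun x => by ring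
  simp_rw [h3]
  rw [sum_add_distrib, sum_sub_distrib, ← mul_sum, h1, h2, ← h2]
  simp_rw [← sq]
  simp_rw [← sq] at h2
  rw [h2]
  ring

/-- Correlation of `f - 𝔼(f | φ)` with a function measurable with respect to a refinement `ψ`
gives an energy increment. -/
lemma energy_increment (f : G → ℝ) (φ : G → α) (ψ : G → β)
    (h : ∀ x y, ψ x = ψ y → φ x = φ y) (e : G → ℂ) (he : ∀ x, ‖e x‖ ≤ 1)
    (heψ : ∀ x y, ψ x = ψ y → e x = e y) {c : ℝ} (hc : 0 ≤ c)
    (hcorr : c * Fintype.card G ≤ ‖∑ x, ((f x - fibreAvg f φ x : ℝ) : ℂ) * e x‖) :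
    c ^ 2 * Fintype.card G + ∑ x, fibreAvg f φ x ^ 2 ≤ ∑ x, fibreAvg f ψ x ^ 2 := by
  have hzero : ∑ x, ((f x - fibreAvg f ψ x : ℝ) : ℂ) * e x = 0 := by
    have hre := sum_sub_fibreAvg_mul f ψ (fun x => (e x).re) fun x y hxy => by rw [heψ x y hxy]
    have him := sum_sub_fibreAvg_mul f ψ (fun x => (e x).im) fun x y hxy => by rw [heψ x y hxy]
    apply Complex.ext
    · rw [Complex.re_sum]; simpa [Complex.re_ofReal_mul] using hre
    · rw [Complex.im_sum]; simpa [Complex.im_ofReal_mul] using him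
  have h1 : ∑ x, ((f x - fibreAvg f φ x : ℝ) : ℂ) * e x =
      ∑ x, e x * ((fibreAvg f ψ x - fibreAvg f φ x : ℝ) : ℂ) := by
    rw [← sub_zero (∑ x, ((f x - fibreAvg f φ x : ℝ) : ℂ) * e x), ← hzero, ← sum_sub_distrib]
    refine sum_congr rfl fun x _ => ?_
    push_cast; ring
  rw [h1] at hcorr
  have h2 := (pow_le_pow_left₀ (by positivity) hcorr 2).trans (sq_norm_sum_mul_le_card _ _ he)
  have h3 : ∑ x, ‖((fibreAvg f ψ x - fibreAvg f φ x : ℝ) : ℂ)‖ ^ 2 =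
      ∑ x, fibreAvg f ψ x ^ 2 - ∑ x, fibreAvg f φ x ^ 2 := by
    rw [← sum_fibreAvg_sq_add f φ ψ h]
    simp only [Complex.norm_real, Real.norm_eq_abs, sq_abs]
  rw [h3] at h2
  rcases isEmpty_or_nonempty G with hG | hG
  · simp
  have hN : (0 : ℝ) < Fintype.card G := by exact_mod_cast Fintype.card_pos
  have h4 := le_of_mul_le_mul_left (a := (Fintype.card G : ℝ))
    (b := c ^ 2 * Fintype.card G) (le_trans (le_of_eq (by ring)) h2) hN
  linarith

end FibreAverage

section EnergyIncrement

variable {p : ℕ} [Fact p.Prime] {n : ℕ}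

/-- The labels of a point with respect to a family of quadratic and linear forms. -/
noncomputable def quadLabel {m : ℕ} (M : Fin m → Matrix (Fin n) (Fin n) (ZMod p))
    (b : Fin m → Vec p n) (x : Vec p n) : Fin m → ZMod p × ZMod p :=
  fun i => (x ⬝ᵥ M i *ᵥ x, b i ⬝ᵥ x)

/-- Koopman–von Neumann type decomposition: every bounded function is `U³`-close to its average
over the atoms of a factor generated by boundedly many quadratic phases. -/
theorem exists_quadratic_structure (h2 : (2 : ZMod p) ≠ 0) (f : Vec p n → ℝ)
    (hf0 : ∀ x, 0 ≤ f x) (hf1 : ∀ x, f x ≤ 1) {ε : ℝ} (hε : 0 < ε) :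
    ∃ (m : ℕ) (M : Fin m → Matrix (Fin n) (Fin n) (ZMod p)) (b : Fin m → Vec p n),
      (m : ℝ) ≤ 1 / corrConst p ε ^ 2 ∧ (∀ i, (M i).IsSymm) ∧
      U3pow8 (fun x => f x - fibreAvg f (quadLabel M b) x) <
        ε * (Fintype.card (Vec p n) : ℝ) ^ 4 := by
  set N : ℝ := (Fintype.card (Vec p n) : ℝ) with hN
  have hNpos : 0 < N := by rw [hN]; exact_mod_cast Fintype.card_pos
  have hc := corrConst_pos (p := p) hε
  set c := corrConst p ε
  have henergy : ∀ (m : ℕ) (M : Fin m → Matrix (Fin n) (Fin n) (ZMod p)) (b : Fin m → Vec p n),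
      (m : ℝ) * c ^ 2 * N ≤ ∑ x, fibreAvg f (quadLabel M b) x ^ 2 → (m : ℝ) ≤ 1 / c ^ 2 := by
    intro m M b h
    have h3 : ∑ x, fibreAvg f (quadLabel M b) x ^ 2 ≤ N := by
      refine (sum_le_sum fun x _ => pow_le_one₀ (fibreAvg_nonneg hf0 _ x)
        (fibreAvg_le_one hf1 _ x)).trans ?_
      simp [hN]
    have h4 : (m : ℝ) * c ^ 2 ≤ 1 := le_of_mul_le_mul_right (by linarith) hNpos
    rwa [le_div_iff₀ (by positivity)]
  by_contra! hcon
  have hstep : ∀ m : ℕ, ∃ (M : Fin m → Matrix (Fin n) (Fin n) (ZMod p)) (b : Fin m → Vec p n),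
      (∀ i, (M i).IsSymm) ∧ (m : ℝ) * c ^ 2 * N ≤ ∑ x, fibreAvg f (quadLabel M b) x ^ 2 := by
    intro m
    induction m with
    | zero => exact ⟨Fin.elim0, Fin.elim0, fun i => i.elim0, by
        simpa using sum_nonneg fun x _ => sq_nonneg _⟩
    | succ m ih =>
      obtain ⟨M, b, hM, hE⟩ := ih
      have hU := hcon m M b (henergy m M b hE) hM
      obtain ⟨M', b', hM', hcorr⟩ := exists_quadratic_correlation h2
        (fun x => f x - fibreAvg f (quadLabel M b) x)
        (fun x => abs_le.2 ⟨by linarith [hf0 x, fibreAvg_le_one hf1 (quadLabel M b) x],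
          by linarith [hf1 x, fibreAvg_nonneg hf0 (quadLabel M b) x]⟩) hε hU
      refine ⟨Fin.cons M' M, Fin.cons b' b, fun i => ?_, ?_⟩
      · refine Fin.cases ?_ (fun i => ?_) i
        · simpa using hM'
        · simpa using hM i
      · have hinc := energy_increment f (quadLabel M b)
          (quadLabel (Fin.cons M' M : Fin (m + 1) → _) (Fin.cons b' b : Fin (m + 1) → _))
          (fun x y hxy => by
            funext i
            simpa [quadLabel] using congrFun hxy i.succ)
          (fun x => chi (x ⬝ᵥ M' *ᵥ x + b' ⬝ᵥ x)) (fun x => (norm_chi _).le)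
          (fun x y hxy => by
            have h0 := congrFun hxy 0
            simp only [quadLabel, Fin.cons_zero, Prod.mk.injEq] at h0
            rw [h0.1, h0.2]) hc.le hcorr
        push_cast
        linarith
  obtain ⟨m, hm⟩ := exists_nat_gt (1 / c ^ 2)
  obtain ⟨M, b, -, hE⟩ := hstep m
  exact absurd (henergy m M b hE) (not_le.2 hm)

end EnergyIncrement

section GeneralizedVonNeumann

lemma sq_sum_mul_sum_le {A B : Type*} [Fintype A] [Fintype B] (w : A → ℝ) (hw : ∀ a, |w a| ≤ 1)
    (F : A → B → ℝ) :
    (∑ a, w a * ∑ b, F a b) ^ 2 ≤ Fintype.card A * ∑ a, ∑ b, ∑ b', F a b * F a b' := by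
  calc (∑ a, w a * ∑ b, F a b) ^ 2 ≤ (∑ a, w a ^ 2) * ∑ a, (∑ b, F a b) ^ 2 :=
        sum_mul_sq_le_sq_mul_sq _ _ _
    _ ≤ Fintype.card A * ∑ a, (∑ b, F a b) ^ 2 := by
        refine mul_le_mul_of_nonneg_right ?_ (sum_nonneg fun _ _ => sq_nonneg _)
        refine (sum_le_sum fun a _ => (sq_le_one_iff_abs_le_one _).2 (hw a)).trans ?_
        simp
    _ = _ := by
        congr 1
        refine sum_congr rfl fun a _ => ?_
        rw [sq, sum_mul_sum]

variable {G : Type*} [AddCommGroup G] [Fintype G]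

lemma sum_cube_eq (D : G → ℝ) :
    ∑ x, ∑ x', ∑ y, ∑ y', ∑ z, ∑ z', (D (x + y + z) * D (x' + y + z) *
      (D (x + y' + z) * D (x' + y' + z))) * (D (x + y + z') * D (x' + y + z') *
      (D (x + y' + z') * D (x' + y' + z'))) = (Fintype.card G : ℝ) ^ 2 * U3pow8 D := by
  have h1 : ∀ x y z : G, ∑ x', ∑ y', ∑ z', (D (x + y + z) * D (x' + y + z) *
      (D (x + y' + z) * D (x' + y' + z))) * (D (x + y + z') * D (x' + y + z') *
      (D (x + y' + z') * D (x' + y' + z'))) =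
      ∑ h₁, ∑ h₂, ∑ h₃, cubeProd D (x + y + z) h₁ h₂ h₃ := by
    intro x y z
    refine (Fintype.sum_equiv (Equiv.addLeft x) _ _ fun h₁ => ?_).symm
    refine (Fintype.sum_equiv (Equiv.addLeft y) _ _ fun h₂ => ?_)
    refine (Fintype.sum_equiv (Equiv.addLeft z) _ _ fun h₃ => ?_)
    simp only [Equiv.coe_addLeft, cubeProd]
    rw [show x + h₁ + y + z = x + y + z + h₁ by abel,
      show x + (y + h₂) + z = x + y + z + h₂ by abel,
      show x + y + (z + h₃) = x + y + z + h₃ by abel,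
      show x + h₁ + (y + h₂) + z = x + y + z + h₁ + h₂ by abel,
      show x + h₁ + y + (z + h₃) = x + y + z + h₁ + h₃ by abel,
      show x + (y + h₂) + (z + h₃) = x + y + z + h₂ + h₃ by abel,
      show x + h₁ + (y + h₂) + (z + h₃) = x + y + z + h₁ + h₂ + h₃ by abel]
    ring
  have h2 : ∀ x y : G, ∑ z, ∑ h₁, ∑ h₂, ∑ h₃, cubeProd D (x + y + z) h₁ h₂ h₃ = U3pow8 D :=
    fun x y => Fintype.sum_equiv (Equiv.addLeft (x + y)) _ _ fun z => rfl
  calc _ = ∑ x, ∑ y, ∑ z, ∑ x', ∑ y', ∑ z', (D (x + y + z) * D (x' + y + z) *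
      (D (x + y' + z) * D (x' + y' + z))) * (D (x + y + z') * D (x' + y + z') *
      (D (x + y' + z') * D (x' + y' + z'))) := by
        refine sum_congr rfl fun x _ => ?_
        rw [sum_comm]
        refine sum_congr rfl fun y _ => ?_
        rw [sum_comm]
        conv_rhs => rw [sum_comm]; enter [2, y']; rw [sum_comm]
        rw [sum_comm]
    _ = _ := by
        simp_rw [h1, h2]
        simp only [sum_const, card_univ, nsmul_eq_mul]
        ring

lemma U3pow8_neg (D : G → ℝ) : U3pow8 (fun x => -D x) = U3pow8 D := by
  simp only [U3pow8, cubeProd]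
  refine sum_congr rfl fun x _ => sum_congr rfl fun _ _ => sum_congr rfl fun _ _ =>
    sum_congr rfl fun _ _ => by ring

lemma U3pow8_shift (D : G → ℝ) (c : G) : U3pow8 (fun x => D (c + x)) = U3pow8 D := by
  simp only [U3pow8, cubeProd]
  refine Fintype.sum_equiv (Equiv.addLeft c) _ _ fun x => ?_
  simp only [Equiv.coe_addLeft, add_assoc]

/-- Generalised von Neumann inequality for a single additive edge. -/
lemma abs_sum_edge_le (D : G → ℝ) (a b c : G → G → ℝ) (ha : ∀ x y, |a x y| ≤ 1)
    (hb : ∀ x y, |b x y| ≤ 1) (hc : ∀ x y, |c x y| ≤ 1) {κ : ℝ} (hκ : 0 ≤ κ)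
    (hD : U3pow8 D ≤ κ ^ 8 * (Fintype.card G : ℝ) ^ 4) :
    |∑ x, ∑ y, ∑ z, D (x + y + z) * a x y * b x z * c y z| ≤ κ * (Fintype.card G : ℝ) ^ 3 := by
  set N : ℝ := (Fintype.card G : ℝ) with hN
  have hN0 : 0 ≤ N := Nat.cast_nonneg _
  set S := ∑ x, ∑ y, ∑ z, D (x + y + z) * a x y * b x z * c y z with hS
  have mul1 : ∀ {s t : ℝ}, |s| ≤ 1 → |t| ≤ 1 → |s * t| ≤ 1 := fun hs ht => by
    rw [abs_mul]; exact mul_le_one₀ hs (abs_nonneg _) ht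
  have e1 : S = ∑ t : G × G, c t.1 t.2 * ∑ x, D (x + t.1 + t.2) * a x t.1 * b x t.2 := by
    rw [Fintype.sum_prod_type, hS, sum_comm]
    refine sum_congr rfl fun y _ => ?_
    rw [sum_comm]
    refine sum_congr rfl fun z _ => ?_
    rw [mul_sum]
    exact sum_congr rfl fun x _ => by ring
  set S2 := ∑ t : G × G × G, (b t.1 t.2.2 * b t.2.1 t.2.2) *
    ∑ y, D (t.1 + y + t.2.2) * D (t.2.1 + y + t.2.2) * (a t.1 y * a t.2.1 y) with hS2
  have i1 : S ^ 2 ≤ N ^ 2 * S2 := by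
    rw [e1]
    refine (sq_sum_mul_sum_le _ (fun t => hc _ _) _).trans (le_of_eq ?_)
    rw [Fintype.card_prod, Nat.cast_mul, ← hN, ← sq, hS2]
    congr 1
    simp only [Fintype.sum_prod_type]
    rw [sum_comm]
    have : ∀ z y : G, ∑ x, ∑ x', D (x + y + z) * a x y * b x z * (D (x' + y + z) * a x' y * b x' z)
        = ∑ x, ∑ x', (b x z * b x' z) * (D (x + y + z) * D (x' + y + z) * (a x y * a x' y)) :=
      fun z y => sum_congr rfl fun x _ => sum_congr rfl fun x' _ => by ring
    simp_rw [this, mul_sum]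
    calc _ = ∑ z, ∑ x, ∑ x', ∑ y, (b x z * b x' z) *
          (D (x + y + z) * D (x' + y + z) * (a x y * a x' y)) := by
          refine sum_congr rfl fun z _ => ?_
          rw [sum_comm]
          exact sum_congr rfl fun x _ => sum_comm
      _ = _ := by
          rw [sum_comm]
          exact sum_congr rfl fun x _ => sum_comm
  set S3 := ∑ t : G × G × G × G,
    (a t.1 t.2.2.1 * a t.2.1 t.2.2.1 * (a t.1 t.2.2.2 * a t.2.1 t.2.2.2)) *
    ∑ z, D (t.1 + t.2.2.1 + z) * D (t.2.1 + t.2.2.1 + z) *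
      (D (t.1 + t.2.2.2 + z) * D (t.2.1 + t.2.2.2 + z)) with hS3
  have i2 : S2 ^ 2 ≤ N ^ 3 * S3 := by
    rw [hS2]
    refine (sq_sum_mul_sum_le _ (fun t => mul1 (hb _ _) (hb _ _)) _).trans (le_of_eq ?_)
    rw [Fintype.card_prod, Fintype.card_prod, Nat.cast_mul, Nat.cast_mul, ← hN,
      show N * (N * N) = N ^ 3 by ring, hS3]
    congr 1
    simp only [Fintype.sum_prod_type]
    refine sum_congr rfl fun x _ => sum_congr rfl fun x' _ => ?_
    simp_rw [mul_sum]
    rw [sum_comm]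
    refine sum_congr rfl fun y _ => ?_
    rw [sum_comm]
    refine sum_congr rfl fun y' _ => sum_congr rfl fun z _ => ?_
    ring
  have i3 : S3 ^ 2 ≤ N ^ 4 * (N ^ 2 * U3pow8 D) := by
    rw [hS3]
    refine (sq_sum_mul_sum_le _ (fun t => mul1 (mul1 (ha _ _) (ha _ _)) (mul1 (ha _ _) (ha _ _)))
      _).trans (le_of_eq ?_)
    rw [← sum_cube_eq]
    simp only [Fintype.card_prod, Nat.cast_mul, ← hN, Fintype.sum_prod_type]
    ring
  have j1 : (S ^ 2) ^ 2 ≤ N ^ 7 * S3 := by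
    calc (S ^ 2) ^ 2 ≤ (N ^ 2 * S2) ^ 2 := pow_le_pow_left₀ (sq_nonneg _) i1 2
      _ = N ^ 4 * S2 ^ 2 := by ring
      _ ≤ N ^ 4 * (N ^ 3 * S3) := mul_le_mul_of_nonneg_left i2 (by positivity)
      _ = _ := by ring
  have j2 : |S| ^ 8 ≤ (κ * N ^ 3) ^ 8 := by
    calc |S| ^ 8 = ((S ^ 2) ^ 2) ^ 2 := by
          rw [← pow_mul, ← pow_mul]
          norm_num
          exact Even.pow_abs (by decide) S
      _ ≤ (N ^ 7 * S3) ^ 2 := pow_le_pow_left₀ (by positivity) j1 2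
      _ = N ^ 14 * S3 ^ 2 := by ring
      _ ≤ N ^ 14 * (N ^ 4 * (N ^ 2 * U3pow8 D)) := mul_le_mul_of_nonneg_left i3 (by positivity)
      _ = N ^ 20 * U3pow8 D := by ring
      _ ≤ N ^ 20 * (κ ^ 8 * N ^ 4) := mul_le_mul_of_nonneg_left hD (by positivity)
      _ = _ := by ring
  exact le_of_not_gt fun hlt =>
    absurd j2 (not_le.2 (pow_lt_pow_left₀ hlt (by positivity) (by norm_num)))

end GeneralizedVonNeumann

section TripartiteDensity

lemma blowup_le {A X I : Type*} [Fintype A] [Fintype X] [Fintype I] [DecidableEq I] (F : A → X → ℝ)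
    (hF : ∀ a x, 0 ≤ F a x) {t : ℝ} (ht : 0 ≤ t) (hI : 0 < Fintype.card I)
    (h : t * (Fintype.card A * Fintype.card X) ≤ ∑ a, ∑ x, F a x) :
    t ^ Fintype.card I * (Fintype.card A * Fintype.card (I → X)) ≤
      ∑ a, ∑ x : I → X, ∏ i, F a (x i) := by
  have h1 : ∀ a, ∑ x : I → X, ∏ i, F a (x i) = (∑ x, F a x) ^ Fintype.card I := fun a => by
    rw [← Fintype.prod_sum (fun (_ : I) x => F a x)]
    simp
  simp_rw [h1]
  obtain ⟨r, hr⟩ := Nat.exists_eq_add_of_lt hI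
  rw [zero_add] at hr
  rw [hr]
  rcases isEmpty_or_nonempty A with hA | hA
  · simp
  have hApos : (0 : ℝ) < Fintype.card A := by exact_mod_cast Fintype.card_pos
  have h2 := pow_sum_div_card_le_sum_pow (s := (univ : Finset A)) (f := fun a => ∑ x, F a x)
    (fun a _ => sum_nonneg fun x _ => hF a x) r
  refine le_trans ?_ h2
  rw [card_univ, le_div_iff₀ (by positivity)]
  refine le_trans (le_of_eq ?_) (pow_le_pow_left₀ (by positivity) h (r + 1))
  rw [Fintype.card_fun, hr]
  push_cast
  ring

variable {G : Type*} [AddCommGroup G] [Fintype G]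

lemma tripartite_le {I J K : Type*} [Fintype I] [Fintype J] [Fintype K]
    [DecidableEq I] [DecidableEq J]
    [DecidableEq K] (hI : 0 < Fintype.card I)
    (hJ : 0 < Fintype.card J) (hK : 0 < Fintype.card K) (u : G → ℝ) (hu : ∀ x, 0 ≤ u x) {t : ℝ}
    (ht : 0 ≤ t) (h : t * Fintype.card G ≤ ∑ x, u x) :
    t ^ (Fintype.card I * Fintype.card J * Fintype.card K) *
      (Fintype.card (I → G) * Fintype.card (J → G) * Fintype.card (K → G)) ≤
      ∑ x : I → G, ∑ y : J → G, ∑ z : K → G, ∏ i, ∏ j, ∏ l, u (x i + y j + z l) := by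
  have s1 := blowup_le (A := G × G) (X := G) (I := I) (fun a x => u (x + a.1 + a.2))
    (fun _ _ => hu _) ht hI (by
      have h1 : ∀ a : G × G, ∑ x, u (x + a.1 + a.2) = ∑ x, u x := fun a =>
        Fintype.sum_equiv (Equiv.addRight (a.1 + a.2)) _ _ fun x => by
          simp only [Equiv.coe_addRight, add_assoc]
      simp_rw [h1]
      rw [sum_const, card_univ, nsmul_eq_mul, mul_left_comm]
      exact mul_le_mul_of_nonneg_left h (Nat.cast_nonneg _))
  have s2 := blowup_le (A := (I → G) × G) (X := G) (I := J)
    (fun a y => ∏ i, u (a.1 i + y + a.2))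
    (fun _ _ => prod_nonneg fun _ _ => hu _) (pow_nonneg ht _) hJ (by
      refine le_trans (le_of_eq ?_) (s1.trans (le_of_eq ?_))
      · simp only [Fintype.card_prod]; push_cast; ring
      · simp only [Fintype.sum_prod_type]
        calc _ = ∑ z : G, ∑ y : G, ∑ x : I → G, ∏ i, u (x i + y + z) := sum_comm
          _ = ∑ z : G, ∑ x : I → G, ∑ y : G, ∏ i, u (x i + y + z) :=
            sum_congr rfl fun z _ => sum_comm
          _ = _ := sum_comm)
  have s3 := blowup_le (A := (I → G) × (J → G)) (X := G) (I := K)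
    (fun a z => ∏ i, ∏ j, u (a.1 i + a.2 j + z))
    (fun _ _ => prod_nonneg fun _ _ => prod_nonneg fun _ _ => hu _)
    (pow_nonneg (pow_nonneg ht (Fintype.card I)) (Fintype.card J)) hK (by
      refine le_trans (le_of_eq ?_) (s2.trans (le_of_eq ?_))
      · simp only [Fintype.card_prod]; push_cast; ring
      · simp only [Fintype.sum_prod_type]
        refine sum_congr rfl fun x _ => ?_
        rw [sum_comm]
        exact sum_congr rfl fun y _ => sum_congr rfl fun z _ => prod_comm)
  refine le_trans (le_of_eq ?_) (s3.trans (le_of_eq ?_))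
  · simp only [Fintype.card_prod, ← pow_mul]; push_cast; ring
  · simp only [Fintype.sum_prod_type]
    refine sum_congr rfl fun x _ => sum_congr rfl fun y _ => sum_congr rfl fun z _ => ?_
    rw [prod_comm]
    refine prod_congr rfl fun i _ => ?_
    rw [prod_comm]

end TripartiteDensity

section TripartiteCounting

variable {G I J K : Type*} [AddCommGroup G] [Fintype G] [Fintype I] [Fintype J] [Fintype K]
  [DecidableEq I] [DecidableEq J] [DecidableEq K]

/-- The number of homomorphic copies of a complete tripartite pattern weighted by `u`. -/
noncomputable def tripartiteCount (u : I × J × K → G → ℝ) : ℝ :=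
  ∑ x : I → G, ∑ y : J → G, ∑ z : K → G, ∏ e, u e (x e.1 + y e.2.1 + z e.2.2)

lemma abs_prod_le_one {ι : Type*} (s : Finset ι) (f : ι → ℝ) (hf : ∀ i ∈ s, |f i| ≤ 1) :
    |∏ i ∈ s, f i| ≤ 1 := by
  rw [abs_prod]
  exact prod_le_one (fun _ _ => abs_nonneg _) hf

lemma abs_sum_edge_mul_prod_le (D : G → ℝ) (w : I × J × K → G → ℝ) (hw : ∀ e x, |w e x| ≤ 1)
    {κ : ℝ} (hκ : 0 ≤ κ) (hD : U3pow8 D ≤ κ ^ 8 * (Fintype.card G : ℝ) ^ 4) (e₀ : I × J × K) :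
    |∑ x : I → G, ∑ y : J → G, ∑ z : K → G, D (x e₀.1 + y e₀.2.1 + z e₀.2.2) *
      ∏ e ∈ univ.erase e₀, w e (x e.1 + y e.2.1 + z e.2.2)| ≤
      κ * (Fintype.card (I → G) * Fintype.card (J → G) * Fintype.card (K → G)) := by
  obtain ⟨i, j, l⟩ := e₀
  set Φ : (I → G) → (J → G) → (K → G) → ℝ := fun x y z => D (x i + y j + z l) *
      ∏ e ∈ univ.erase (i, j, l), w e (x e.1 + y e.2.1 + z e.2.2) with hΦ
  have hN : (0 : ℝ) < Fintype.card G := by exact_mod_cast Fintype.card_pos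
  have hinner : ∀ (x : I → G) (y : J → G) (z : K → G),
      |∑ s, ∑ t, ∑ r, Φ (x + Pi.single i s) (y + Pi.single j t)
      (z + Pi.single l r)| ≤ κ * (Fintype.card G : ℝ) ^ 3 := by
    intro x y z
    have key := abs_sum_edge_le (fun v => D (x i + y j + z l + v))
      (fun s t => ∏ e ∈ univ.erase (i, j, l) with e.2.2 ≠ l, w e ((x + Pi.single i s : I → G) e.1 +
        (y + Pi.single j t : J → G) e.2.1 + z e.2.2))
      (fun s r => ∏ e ∈ (univ.erase (i, j, l)).filter (fun e => ¬ e.2.2 ≠ l) with e.2.1 ≠ j,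
        w e ((x + Pi.single i s : I → G) e.1 + y e.2.1 + (z + Pi.single l r : K → G) e.2.2))
      (fun t r => ∏ e ∈ (univ.erase (i, j, l)).filter (fun e => ¬ e.2.2 ≠ l) with ¬ e.2.1 ≠ j,
        w e (x e.1 + (y + Pi.single j t : J → G) e.2.1 + (z + Pi.single l r : K → G) e.2.2))
      (fun _ _ => abs_prod_le_one _ _ fun _ _ => hw _ _)
      (fun _ _ => abs_prod_le_one _ _ fun _ _ => hw _ _)
      (fun _ _ => abs_prod_le_one _ _ fun _ _ => hw _ _) hκ (by rwa [U3pow8_shift])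
    refine le_trans (le_of_eq ?_) key
    congr 1
    refine sum_congr rfl fun s _ => sum_congr rfl fun t _ => sum_congr rfl fun r _ => ?_
    simp only [hΦ]
    rw [← prod_filter_mul_prod_filter_not (univ.erase (i, j, l)) (fun e => e.2.2 ≠ l),
      ← prod_filter_mul_prod_filter_not ((univ.erase (i, j, l)).filter (fun e => ¬ e.2.2 ≠ l))
        (fun e => e.2.1 ≠ j)]
    simp only [mul_assoc]
    congr 1
    · congr 1
      simp only [Pi.add_apply, Pi.single_eq_same]
      abel
    congr 1
    · refine prod_congr rfl fun e he => ?_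
      have : e.2.2 ≠ l := (mem_filter.1 he).2
      simp [Pi.single_eq_of_ne this]
    congr 1
    · refine prod_congr rfl fun e he => ?_
      have : e.2.1 ≠ j := (mem_filter.1 he).2
      simp [Pi.single_eq_of_ne this]
    · refine prod_congr rfl fun e he => ?_
      simp only [mem_filter, mem_erase, mem_univ, and_true, not_not] at he
      have : e.1 ≠ i := fun h => he.1.1 (Prod.ext h (Prod.ext he.2 he.1.2))
      simp [Pi.single_eq_of_ne this]
  have hshift : (Fintype.card G : ℝ) ^ 3 * ∑ x, ∑ y, ∑ z, Φ x y z =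
      ∑ x : I → G, ∑ y : J → G, ∑ z : K → G, ∑ s, ∑ t, ∑ r, Φ (x + Pi.single i s)
        (y + Pi.single j t) (z + Pi.single l r) := by
    have h1 : ∀ (s t r : G),
        ∑ x : I → G, ∑ y : J → G, ∑ z : K → G, Φ (x + Pi.single i s) (y + Pi.single j t)
        (z + Pi.single l r) = ∑ x, ∑ y, ∑ z, Φ x y z := fun s t r =>
      Fintype.sum_equiv (Equiv.addRight (Pi.single i s)) _ _ fun x =>
      Fintype.sum_equiv (Equiv.addRight (Pi.single j t)) _ _ fun y =>
      Fintype.sum_equiv (Equiv.addRight (Pi.single l r)) _ _ fun z => rfl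
    have h2 := Fintype.sum_congr (fun q : G × G × G => ∑ v : (I → G) × (J → G) × (K → G),
        Φ (v.1 + Pi.single i q.1) (v.2.1 + Pi.single j q.2.1) (v.2.2 + Pi.single l q.2.2))
      (fun q => ∑ x, ∑ y, ∑ z, Φ x y z) fun q => by
        rw [← h1 q.1 q.2.1 q.2.2]; simp only [Fintype.sum_prod_type]
    rw [sum_comm] at h2
    simp only [Fintype.sum_prod_type, sum_const, card_univ, nsmul_eq_mul] at h2
    rw [h2, Fintype.card_prod, Fintype.card_prod]
    push_cast
    ring
  have h3 : (Fintype.card G : ℝ) ^ 3 * |∑ x, ∑ y, ∑ z, Φ x y z| ≤ (Fintype.card G : ℝ) ^ 3 *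
      (κ * (Fintype.card (I → G) * Fintype.card (J → G) * Fintype.card (K → G))) := by
    rw [← abs_of_pos (pow_pos hN 3), ← abs_mul, abs_of_pos (pow_pos hN 3), hshift]
    refine (abs_sum_le_sum_abs _ _).trans ((sum_le_sum fun x _ => (abs_sum_le_sum_abs _ _).trans
      (sum_le_sum fun y _ => (abs_sum_le_sum_abs _ _).trans
        (sum_le_sum fun z _ => hinner x y z))).trans (le_of_eq ?_))
    simp only [sum_const, card_univ, nsmul_eq_mul]
    ring
  exact le_of_mul_le_mul_left h3 (pow_pos hN 3)

lemma abs_tripartiteCount_sub_le (f g : I × J × K → G → ℝ) (hf : ∀ e x, |f e x| ≤ 1)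
    (hg : ∀ e x, |g e x| ≤ 1) {κ : ℝ} (hκ : 0 ≤ κ)
    (hD : ∀ e, U3pow8 (fun x => g e x - f e x) ≤ κ ^ 8 * (Fintype.card G : ℝ) ^ 4) :
    |tripartiteCount g - tripartiteCount f| ≤ Fintype.card (I × J × K) *
      (κ * (Fintype.card (I → G) * Fintype.card (J → G) * Fintype.card (K → G))) := by
  have key : ∀ s : Finset (I × J × K),
      |tripartiteCount (fun e => if e ∈ s then g e else f e) - tripartiteCount f| ≤ #s *
      (κ * (Fintype.card (I → G) * Fintype.card (J → G) * Fintype.card (K → G))) := by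
    intro s
    induction s using Finset.induction_on with
    | empty => simp
    | insert e₀ s he ih =>
      have h1 := abs_sum_edge_mul_prod_le (fun x => g e₀ x - f e₀ x)
        (fun e => if e ∈ s then g e else f e)
        (fun e x => by split_ifs; exacts [hg _ _, hf _ _]) hκ (hD e₀) e₀
      have h2 : tripartiteCount (fun e => if e ∈ insert e₀ s then g e else f e) -
          tripartiteCount (fun e => if e ∈ s then g e else f e) =
          ∑ x : I → G, ∑ y : J → G, ∑ z : K → G, (g e₀ (x e₀.1 + y e₀.2.1 + z e₀.2.2) -
            f e₀ (x e₀.1 + y e₀.2.1 + z e₀.2.2)) *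
      ∏ e ∈ univ.erase e₀, (if e ∈ s then g e else f e) (x e.1 + y e.2.1 + z e.2.2) := by
        simp only [tripartiteCount, ← sum_sub_distrib]
        refine sum_congr rfl fun x _ => sum_congr rfl fun y _ => sum_congr rfl fun z _ => ?_
        rw [← mul_prod_erase univ _ (mem_univ e₀), ← mul_prod_erase univ
          (fun e => (if e ∈ s then g e else f e) (x e.1 + y e.2.1 + z e.2.2)) (mem_univ e₀)]
        rw [if_pos (mem_insert_self _ _), if_neg he, sub_mul]
        congr 2
        refine prod_congr rfl fun e hee => ?_
        have : e ≠ e₀ := (mem_erase.1 hee).1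
        simp [mem_insert, this]
      rw [← h2] at h1
      rw [card_insert_of_notMem he]
      push_cast
      have h3 := abs_add_le (tripartiteCount (fun e => if e ∈ insert e₀ s then g e else f e) -
          tripartiteCount (fun e => if e ∈ s then g e else f e))
          (tripartiteCount (fun e => if e ∈ s then g e else f e) - tripartiteCount f)
      rw [sub_add_sub_cancel] at h3
      linarith
  have h := key univ
  simpa using h

/-- If `A` has no shattered `m`-configuration, then any `U³`-approximation of its indicator
function is close to `{0, 1}`-valued. -/
theorem card_middle_lt {A : Set G} {m : ℕ} (hm : 0 < m) (hA : ¬ HasVC2Dim A m) (g : G → ℝ)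
    (hg0 : ∀ x, 0 ≤ g x) (hg1 : ∀ x, g x ≤ 1) {δ κ : ℝ} (hδ : 0 < δ) (hκ : 0 ≤ κ)
    (hU : U3pow8 (fun x => ind1 A x - g x) ≤ κ ^ 8 * (Fintype.card G : ℝ) ^ 4)
    (hκδ : (m * m * 2 ^ (m * m) : ℕ) * κ < δ ^ (2 * (m * m * 2 ^ (m * m)))) :
    (#{x | δ ≤ g x ∧ g x ≤ 1 - δ} : ℝ) < δ * Fintype.card G := by
  by_contra! hcon
  set E : ℕ := m * m * 2 ^ (m * m) with hE
  have hcardE : Fintype.card (Fin m) * Fintype.card (Fin m) *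
      Fintype.card (Set (Fin m × Fin m)) = E := by
    rw [Fintype.card_set, Fintype.card_prod, Fintype.card_fin]
  set T : Finset G := {x | δ ≤ g x ∧ g x ≤ 1 - δ} with hT
  set f₁ : Fin m × Fin m × Set (Fin m × Fin m) → G → ℝ := fun e x =>
    if (e.1, e.2.1) ∈ e.2.2 then ind1 A x else 1 - ind1 A x with hf₁
  set g₁ : Fin m × Fin m × Set (Fin m × Fin m) → G → ℝ := fun e x =>
    if (e.1, e.2.1) ∈ e.2.2 then g x else 1 - g x with hg₁
  have hind : ∀ x, 0 ≤ ind1 A x ∧ ind1 A x ≤ 1 := fun x => by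
    by_cases hx : x ∈ A <;> simp [ind1, hx]
  have hzero : tripartiteCount f₁ = 0 := by
    refine sum_eq_zero fun x _ => sum_eq_zero fun y _ => sum_eq_zero fun z _ => ?_
    by_contra hne
    refine hA ⟨x, y, z, fun i j S => ?_⟩
    have h1 := prod_ne_zero_iff.1 hne (i, j, S) (mem_univ _)
    simp only [hf₁] at h1
    split_ifs at h1 with h2
    · refine ⟨fun _ => h2, fun _ => ?_⟩
      by_contra h3
      exact h1 (by simp [ind1, h3])
    · refine ⟨fun h3 => absurd (by simp [ind1, h3]) h1, fun h3 => absurd h3 h2⟩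
  have hlow := tripartite_le (I := Fin m) (J := Fin m) (K := Set (Fin m × Fin m))
    (by simpa using hm) (by simpa using hm) Fintype.card_pos
    (fun x => if x ∈ T then (1 : ℝ) else 0) (fun x => by split_ifs <;> norm_num) hδ.le
    (by simpa using hcon)
  rw [hcardE] at hlow
  set V : ℝ := (Fintype.card (Fin m → G) : ℝ) * Fintype.card (Fin m → G) *
    Fintype.card (Set (Fin m × Fin m) → G) with hV
  have hVpos : 0 < V := by
    have h1 : (0 : ℝ) < Fintype.card (Fin m → G) := by exact_mod_cast Fintype.card_pos
    have h2 : (0 : ℝ) < Fintype.card (Set (Fin m × Fin m) → G) := by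
      exact_mod_cast Fintype.card_pos
    positivity
  have hlow2 : δ ^ E * (δ ^ E * V) ≤ tripartiteCount g₁ := by
    refine (mul_le_mul_of_nonneg_left hlow (pow_nonneg hδ.le E)).trans ?_
    rw [tripartiteCount, mul_sum]
    refine sum_le_sum fun x _ => ?_
    rw [mul_sum]
    refine sum_le_sum fun y _ => ?_
    rw [mul_sum]
    refine sum_le_sum fun z _ => ?_
    rw [← hcardE]
    have h1 : (∏ i, ∏ j, ∏ l, if x i + y j + z l ∈ T then (1 : ℝ) else 0) =
        ∏ e : Fin m × Fin m × Set (Fin m × Fin m),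
          if x e.1 + y e.2.1 + z e.2.2 ∈ T then (1 : ℝ) else 0 := by
      simp only [Fintype.prod_prod_type]
    rw [h1, mul_assoc, ← Fintype.card_prod, ← Fintype.card_prod, ← card_univ, ← prod_const,
      ← prod_mul_distrib]
    refine prod_le_prod (fun e _ => mul_nonneg hδ.le (by split_ifs <;> norm_num)) fun e _ => ?_
    simp only [hg₁]
    split_ifs with h2 h3 h3
    · rw [mul_one]; exact (mem_filter.1 h2).2.1
    · rw [mul_one]; linarith [(mem_filter.1 h2).2.2]
    · rw [mul_zero]; exact hg0 _
    · rw [mul_zero]; linarith [hg1 (x e.1 + y e.2.1 + z e.2.2)]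
  have hdiff := abs_tripartiteCount_sub_le f₁ g₁
    (fun e x => by
      have := hind x
      simp only [hf₁]
      split_ifs <;> exact abs_le.2 ⟨by linarith, by linarith⟩)
    (fun e x => by
      have h0 := hg0 x
      have h1 := hg1 x
      simp only [hg₁]
      split_ifs <;> exact abs_le.2 ⟨by linarith, by linarith⟩) hκ
    (fun e => by
      simp only [hf₁, hg₁]
      split_ifs with h
      · rw [← U3pow8_neg]; simpa only [neg_sub] using hU
      · simpa only [sub_sub_sub_cancel_left] using hU)
  rw [hzero, sub_zero, Fintype.card_prod, Fintype.card_prod, ← mul_assoc (Fintype.card (Fin m)),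
    hcardE] at hdiff
  have h1 : (δ ^ (2 * E)) * V ≤ ((E : ℝ) * κ) * V := by
    calc (δ ^ (2 * E)) * V = δ ^ E * (δ ^ E * V) := by ring
      _ ≤ _ := hlow2.trans ((le_abs_self _).trans hdiff)
      _ = _ := by rw [← hV]; ring
  exact absurd (le_of_mul_le_mul_right h1 hVpos) (not_le.2 hκδ)

end TripartiteCounting

section ApproximationByQuadraticFactor

variable {p : ℕ} [Fact p.Prime] {n : ℕ}

/-- The number of edges of the tripartite pattern witnessing VC₂-dimension `m`. -/
def patternSize (m : ℕ) : ℕ := m * m * 2 ^ (m * m)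

/-- The uniformity parameter used in the structure theorem. -/
noncomputable def uniformityParam (m : ℕ) (δ : ℝ) : ℝ :=
  (δ ^ (2 * patternSize m) / (patternSize m + 1)) ^ 8

lemma uniformityParam_pos (m : ℕ) {δ : ℝ} (hδ : 0 < δ) : 0 < uniformityParam m δ := by
  unfold uniformityParam; positivity

lemma sum_ind1_mul_eq {G : Type*} [Fintype G] (A Y : Set G) :
    ((A ∆ Y).ncard : ℝ) = ∑ x, if x ∈ Y then 1 - ind1 A x else ind1 A x := by
  have h : (A ∆ Y) = ((univ.filter (· ∈ A ∆ Y) : Finset G) : Set G) := by ext; simp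
  rw [h, Set.ncard_coe_finset, card_eq_sum_ones, sum_filter, Nat.cast_sum]
  refine sum_congr rfl fun x _ => ?_
  by_cases h1 : x ∈ A <;> by_cases h2 : x ∈ Y <;> simp [ind1, h1, h2, Set.mem_symmDiff]

/-- A set without large shattered patterns is close to a union of atoms of a factor generated by a
bounded number of quadratic forms. -/
theorem exists_quadratic_approximation (h2 : (2 : ZMod p) ≠ 0) {A : Set (Vec p n)} {m : ℕ}
    (hm : 0 < m) (hA : ¬ HasVC2Dim A m) {δ : ℝ} (hδ : 0 < δ) :
    ∃ (r : ℕ) (M : Fin r → Matrix (Fin n) (Fin n) (ZMod p)) (b : Fin r → Vec p n)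
      (Y : Set (Vec p n)), (r : ℝ) ≤ 1 / corrConst p (uniformityParam m δ) ^ 2 ∧
      (∀ i, (M i).IsSymm) ∧ (∀ x y, quadLabel M b x = quadLabel M b y → (x ∈ Y ↔ y ∈ Y)) ∧
      ((A ∆ Y).ncard : ℝ) ≤ 2 * δ * Fintype.card (Vec p n) := by
  have hind : ∀ x, 0 ≤ ind1 A x ∧ ind1 A x ≤ 1 := fun x => by
    by_cases hx : x ∈ A <;> simp [ind1, hx]
  obtain ⟨r, M, b, hr, hM, hU⟩ := exists_quadratic_structure h2 (ind1 A) (fun x => (hind x).1)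
    (fun x => (hind x).2) (uniformityParam_pos m hδ)
  set g := fibreAvg (ind1 A) (quadLabel M b) with hg
  have hg0 : ∀ x, 0 ≤ g x := fibreAvg_nonneg (fun x => (hind x).1) _
  have hg1 : ∀ x, g x ≤ 1 := fibreAvg_le_one (fun x => (hind x).2) _
  refine ⟨r, M, b, {x | 1 / 2 < g x}, hr, hM, fun x y hxy => ?_, ?_⟩
  · simp only [Set.mem_ofPred_eq, hg, fibreAvg_congr _ _ hxy]
  set Y : Set (Vec p n) := {x | 1 / 2 < g x} with hY
  have hT := card_middle_lt hm hA g hg0 hg1 (δ := δ)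
    (κ := δ ^ (2 * patternSize m) / (patternSize m + 1)) hδ (by positivity) hU.le (by
      change (patternSize m : ℝ) * _ < δ ^ (2 * patternSize m)
      rw [mul_div_assoc', div_lt_iff₀ (by positivity)]
      have := pow_pos hδ (2 * patternSize m)
      nlinarith)
  rw [sum_ind1_mul_eq]
  have h1 : ∑ x, (if x ∈ Y then 1 - ind1 A x else ind1 A x) =
      ∑ x, (if x ∈ Y then 1 - g x else g x) := by
    have h3 := sum_sub_fibreAvg_mul (ind1 A) (quadLabel M b)
      (fun x => if x ∈ Y then (-1 : ℝ) else 1) fun x y hxy => by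
        simp only [hY, Set.mem_ofPred_eq, hg, fibreAvg_congr _ _ hxy]
    rw [← sub_eq_zero, ← sum_sub_distrib, ← h3]
    refine sum_congr rfl fun x _ => ?_
    split_ifs <;> ring
  rw [h1]
  calc ∑ x, (if x ∈ Y then 1 - g x else g x)
      ≤ ∑ x, (δ + if δ ≤ g x ∧ g x ≤ 1 - δ then (1 : ℝ) else 0) := by
        refine sum_le_sum fun x _ => ?_
        have a0 := hg0 x
        have a1 := hg1 x
        by_cases hx : δ ≤ g x ∧ g x ≤ 1 - δ
        · rw [if_pos hx]
          split_ifs <;> linarith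
        · rw [if_neg hx]
          simp only [hY, Set.mem_ofPred_eq]
          rcases lt_or_ge (g x) δ with h4 | h4
          · split_ifs <;> linarith
          · have h5 : 1 - δ < g x := lt_of_not_ge fun h6 => hx ⟨h4, h6⟩
            split_ifs <;> linarith
    _ ≤ _ := by
        rw [sum_add_distrib, sum_const, card_univ, nsmul_eq_mul, sum_boole]
        linarith

end ApproximationByQuadraticFactor

section RankRepair

variable {p : ℕ} [Fact p.Prime] {n : ℕ}

/-- Membership in `Y` only depends on the values of the linear forms in `V` and of the quadratic
forms in `𝓜`. -/
def Determines (V : Submodule (ZMod p) (Vec p n))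
    (𝓜 : Submodule (ZMod p) (Matrix (Fin n) (Fin n) (ZMod p))) (Y : Set (Vec p n)) : Prop :=
  ∀ x y, (∀ v ∈ V, v ⬝ᵥ x = v ⬝ᵥ y) → (∀ M ∈ 𝓜, x ⬝ᵥ M *ᵥ x = y ⬝ᵥ M *ᵥ y) → (x ∈ Y ↔ y ∈ Y)

lemma quadForm_eq_of_range {U : Matrix (Fin n) (Fin n) (ZMod p)} (hU : U.IsSymm) {x y : Vec p n}
    (h : ∀ v ∈ LinearMap.range U.mulVecLin, v ⬝ᵥ x = v ⬝ᵥ y) : x ⬝ᵥ U *ᵥ x = y ⬝ᵥ U *ᵥ y := by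
  have h1 := h (U *ᵥ x) ⟨x, rfl⟩
  have h2 := h (U *ᵥ y) ⟨y, rfl⟩
  rw [dotProduct_comm x, h1, dotProduct_comm y, ← h2, dotProduct_comm, dot_mulVec_symm hU,
    dotProduct_comm]

lemma monotone_add_self {ρ : ℕ → ℕ} (hρ : Monotone ρ) : Monotone fun t => t + ρ t :=
  fun _ _ h => Nat.add_le_add h (hρ h)

lemma le_iterate_add {ρ : ℕ → ℕ} (t r : ℕ) : t ≤ (fun t => t + ρ t)^[r] t :=
  Function.id_le_iterate_of_id_le (fun t => Nat.le_add_right t (ρ t)) r t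

lemma iterate_add_mono {ρ : ℕ → ℕ} {r s : ℕ} (h : r ≤ s) (t : ℕ) :
    (fun t => t + ρ t)^[r] t ≤ (fun t => t + ρ t)^[s] t :=
  Function.monotone_iterate_of_id_le (fun t => Nat.le_add_right t (ρ t)) h t

lemma exists_high_rank_submodules {ρ : ℕ → ℕ} (hρ : Monotone ρ) (Y : Set (Vec p n)) (q : ℕ) :
    ∀ (V : Submodule (ZMod p) (Vec p n))
      (𝓜 : Submodule (ZMod p) (Matrix (Fin n) (Fin n) (ZMod p))),
      Module.finrank (ZMod p) 𝓜 = q → (∀ M ∈ 𝓜, M.IsSymm) → Determines V 𝓜 Y →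
    ∃ (V' : Submodule (ZMod p) (Vec p n))
      (𝓜' : Submodule (ZMod p) (Matrix (Fin n) (Fin n) (ZMod p))),
      (∀ M ∈ 𝓜', M.IsSymm) ∧ Determines V' 𝓜' Y ∧ Module.finrank (ZMod p) 𝓜' ≤ q ∧
      Module.finrank (ZMod p) V' + Module.finrank (ZMod p) 𝓜' ≤
        (fun t => t + ρ t)^[q] (Module.finrank (ZMod p) V + q) ∧
      ∀ U ∈ 𝓜', U ≠ 0 →
        ρ (Module.finrank (ZMod p) V' + Module.finrank (ZMod p) 𝓜') ≤ U.rank := by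
  induction q using Nat.strong_induction_on with
  | _ q ih =>
    intro V 𝓜 hq hsymm hdet
    by_cases hgood : ∀ U ∈ 𝓜, U ≠ 0 →
        ρ (Module.finrank (ZMod p) V + Module.finrank (ZMod p) 𝓜) ≤ U.rank
    · exact ⟨V, 𝓜, hsymm, hdet, hq.le, by rw [hq]; exact le_iterate_add _ _, hgood⟩
    push Not at hgood
    obtain ⟨U, hU, hU0, hrank⟩ := hgood
    rw [hq] at hrank
    obtain ⟨C, hC⟩ := Submodule.exists_isCompl (Submodule.span (ZMod p) {U})
    have hspan : Submodule.span (ZMod p) {U} ≤ 𝓜 := by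
      rw [Submodule.span_singleton_le_iff_mem]; exact hU
    have hUC : U ∉ C := fun h => hU0 ((Submodule.disjoint_def.1 hC.disjoint) U
      (Submodule.mem_span_singleton_self U) h)
    have hsup : Submodule.span (ZMod p) {U} ⊔ C ⊓ 𝓜 = 𝓜 := by
      rw [← sup_inf_assoc_of_le C hspan, hC.sup_eq_top, top_inf_eq]
    have hlt : Module.finrank (ZMod p) (C ⊓ 𝓜 : Submodule _ _) < q := by
      rw [← hq]
      exact Submodule.finrank_lt_finrank_of_lt (lt_of_le_of_ne inf_le_right fun h =>
        hUC (Submodule.mem_inf.1 (h.symm ▸ hU : U ∈ C ⊓ 𝓜)).1)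
    obtain ⟨V', 𝓜', h1, h2, h3, h4, h5⟩ := ih _ hlt (V ⊔ LinearMap.range U.mulVecLin) (C ⊓ 𝓜) rfl
      (fun M hM => hsymm M hM.2) (fun x y hV hM => hdet x y
        (fun v hv => hV v (Submodule.mem_sup_left hv)) fun M hM' => by
          rw [← hsup] at hM'
          obtain ⟨W, hW, M₁, hM₁, rfl⟩ := Submodule.mem_sup.1 hM'
          obtain ⟨c, rfl⟩ := Submodule.mem_span_singleton.1 hW
          have e1 := quadForm_eq_of_range (hsymm U hU) fun v hv => hV v (Submodule.mem_sup_right hv)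
          simp only [Matrix.add_mulVec, dotProduct_add, Matrix.smul_mulVec, dotProduct_smul, e1,
            hM M₁ hM₁])
    refine ⟨V', 𝓜', h1, h2, h3.trans hlt.le, h4.trans ?_, h5⟩
    obtain ⟨r, rfl⟩ := Nat.exists_eq_add_of_lt hlt
    set q₁ := Module.finrank (ZMod p) (C ⊓ 𝓜 : Submodule _ _)
    have hV' : Module.finrank (ZMod p) (V ⊔ LinearMap.range U.mulVecLin : Submodule _ _) ≤
        Module.finrank (ZMod p) V + U.rank := Submodule.finrank_add_le_finrank_add_finrank _ _
    set t := Module.finrank (ZMod p) V + (q₁ + r + 1)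
    calc _ ≤ (fun t => t + ρ t)^[q₁] (t + ρ t) :=
          (monotone_add_self hρ).iterate q₁ (by omega)
      _ = (fun t => t + ρ t)^[q₁ + 1] t := rfl
      _ ≤ _ := iterate_add_mono (by omega) t

lemma dotProduct_eq_of_mem_span {s : Set (Vec p n)} {x y : Vec p n}
    (h : ∀ v ∈ s, v ⬝ᵥ x = v ⬝ᵥ y) {v : Vec p n} (hv : v ∈ Submodule.span (ZMod p) s) :
    v ⬝ᵥ x = v ⬝ᵥ y := by
  induction hv using Submodule.span_induction with
  | mem v hv => exact h v hv
  | zero => simp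
  | add u w _ _ hu hw => rw [add_dotProduct, add_dotProduct, hu, hw]
  | smul c u _ hu => rw [smul_dotProduct, smul_dotProduct, hu]

lemma quadForm_eq_of_mem_span {s : Set (Matrix (Fin n) (Fin n) (ZMod p))} {x y : Vec p n}
    (h : ∀ M ∈ s, x ⬝ᵥ M *ᵥ x = y ⬝ᵥ M *ᵥ y) {M : Matrix (Fin n) (Fin n) (ZMod p)}
    (hM : M ∈ Submodule.span (ZMod p) s) : x ⬝ᵥ M *ᵥ x = y ⬝ᵥ M *ᵥ y := by
  induction hM using Submodule.span_induction with
  | mem v hv => exact h v hv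
  | zero => simp
  | add u w _ _ hu hw => simp only [Matrix.add_mulVec, dotProduct_add, hu, hw]
  | smul c u _ hu => simp only [Matrix.smul_mulVec, dotProduct_smul, hu]

/-- Any set determined by `r` linear and quadratic forms is a union of atoms of a quadratic factor
of controlled complexity and high rank. -/
theorem exists_high_rank_factor {ρ : ℕ → ℕ} (hρ : Monotone ρ) {r : ℕ}
    (M : Fin r → Matrix (Fin n) (Fin n) (ZMod p)) (b : Fin r → Vec p n)
    (hM : ∀ i, (M i).IsSymm) (Y : Set (Vec p n))
    (hY : ∀ x y, quadLabel M b x = quadLabel M b y → (x ∈ Y ↔ y ∈ Y)) :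
    ∃ (ℓ q : ℕ) (B : QuadFactor p n ℓ q) (S : Set (Label p ℓ q)),
      q ≤ r ∧ ℓ + q ≤ (fun t => t + ρ t)^[r] (2 * r) ∧
      (∀ c : Fin q → ZMod p, c ≠ 0 → ρ (ℓ + q) ≤ (∑ j, c j • B.Q j).rank) ∧
      Y = {x | B.betaB x ∈ S} := by
  have hsymm : ∀ N ∈ Submodule.span (ZMod p) (Set.range M), N.IsSymm := by
    intro N hN
    induction hN using Submodule.span_induction with
    | mem N hN => obtain ⟨i, rfl⟩ := hN; exact hM i
    | zero => exact Matrix.isSymm_zero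
    | add _ _ _ _ h1 h2 => exact h1.add h2
    | smul c _ _ h1 => exact h1.smul c
  obtain ⟨V, 𝓜, h1, h2, h3, h4, h5⟩ := exists_high_rank_submodules hρ Y _
    (Submodule.span (ZMod p) (Set.range b)) (Submodule.span (ZMod p) (Set.range M)) rfl hsymm
    (fun x y hx hy => hY x y (funext fun i => Prod.ext
      (hy _ (Submodule.subset_span ⟨i, rfl⟩)) (hx _ (Submodule.subset_span ⟨i, rfl⟩))))
  have hb : Module.finrank (ZMod p) (Submodule.span (ZMod p) (Set.range b)) ≤ r :=
    (finrank_range_le_card (R := ZMod p) b).trans (by simp)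
  have hMr : Module.finrank (ZMod p) (Submodule.span (ZMod p) (Set.range M)) ≤ r :=
    (finrank_range_le_card (R := ZMod p) M).trans (by simp)
  set ℓ := Module.finrank (ZMod p) V
  set q := Module.finrank (ZMod p) 𝓜
  let bV := Module.finBasis (ZMod p) V
  let bM := Module.finBasis (ZMod p) 𝓜
  have hspanV : V = Submodule.span (ZMod p) (Set.range fun i => (bV i : Vec p n)) := by
    have := congrArg (Submodule.map V.subtype) bV.span_eq
    rw [Submodule.map_span, Submodule.map_subtype_top, ← Set.range_comp] at this
    exact this.symm
  have hspanM : 𝓜 = Submodule.span (ZMod p)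
      (Set.range fun i => (bM i : Matrix (Fin n) (Fin n) (ZMod p))) := by
    have := congrArg (Submodule.map 𝓜.subtype) bM.span_eq
    rw [Submodule.map_span, Submodule.map_subtype_top, ← Set.range_comp] at this
    exact this.symm
  let B : QuadFactor p n ℓ q :=
    { L := fun i => bV i
      Q := fun i => bM i
      linIndep := bV.linearIndependent.map' V.subtype (Submodule.ker_subtype V)
      symm := fun j => h1 _ (bM j).2
      inj := Subtype.val_injective.comp bM.injective }
  refine ⟨ℓ, q, B, B.betaB '' Y, h3.trans hMr, ?_, fun c hc => ?_, ?_⟩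
  · refine h4.trans (((monotone_add_self hρ).iterate _ (by omega)).trans (iterate_add_mono hMr _))
  · have h6 : ∑ j, c j • B.Q j = ((∑ j, c j • bM j : 𝓜) : Matrix (Fin n) (Fin n) (ZMod p)) := by
      simp [B]
    rw [h6]
    refine h5 _ (Subtype.coe_prop _) fun h7 => hc ?_
    have h8 : ∑ j, c j • bM j = 0 := Subtype.ext h7
    exact funext (Fintype.linearIndependent_iff.1 bM.linearIndependent c h8)
  · ext x
    refine ⟨fun hx => ⟨x, hx, rfl⟩, fun ⟨y, hy, hxy⟩ => ?_⟩
    refine (h2 y x (fun v hv => ?_) fun N hN => ?_).1 hy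
    · rw [hspanV] at hv
      refine dotProduct_eq_of_mem_span (fun v hv => ?_) hv
      obtain ⟨i, rfl⟩ := hv
      have := congrFun (congrArg Prod.fst hxy) i
      simp only [QuadFactor.betaB, QuadFactor.betaL] at this
      rw [dotProduct_comm, dotProduct_comm _ x]
      exact this
    · rw [hspanM] at hN
      refine quadForm_eq_of_mem_span (fun v hv => ?_) hN
      obtain ⟨i, rfl⟩ := hv
      exact congrFun (congrArg Prod.snd hxy) i

end RankRepair

section GramCounting

variable {p : ℕ} [Fact p.Prime] {n ℓ q : ℕ} {ι : Type*} [Fintype ι]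

/-- Possible values of the linear forms and of the Gram matrix of a family of vectors. -/
abbrev GramData (p ℓ q : ℕ) (ι : Type*) :=
  (ι → Fin ℓ → ZMod p) × (ι → ι → Fin q → ZMod p)

/-- The values of the linear and bilinear forms of `B` on a family of vectors. -/
def gram (B : QuadFactor p n ℓ q) (v : ι → Vec p n) : GramData p ℓ q ι :=
  (fun i => B.betaL (v i), fun i j => B.betaQ (v i) (v j))

/-- The duality pairing on Gram data. -/
def gramPair (a : GramData p ℓ q ι) : GramData p ℓ q ι →+ ZMod p where
  toFun b := ∑ i, a.1 i ⬝ᵥ b.1 i + ∑ i, ∑ j, a.2 i j ⬝ᵥ b.2 i j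
  map_zero' := by simp
  map_add' b c := by
    simp only [Prod.fst_add, Prod.snd_add, Pi.add_apply, dotProduct_add, sum_add_distrib]
    ring

lemma gramPair_apply (a b : GramData p ℓ q ι) :
    gramPair a b = ∑ i, a.1 i ⬝ᵥ b.1 i + ∑ i, ∑ j, a.2 i j ⬝ᵥ b.2 i j := rfl

lemma gramPair_comm (a b : GramData p ℓ q ι) : gramPair a b = gramPair b a := by
  simp only [gramPair_apply, dotProduct_comm]

variable [DecidableEq ι]

lemma gramPair_eq_zero {a : GramData p ℓ q ι} : gramPair a = 0 ↔ a = 0 := by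
  refine ⟨fun h => ?_, fun h => ?_⟩
  · have h1 : ∀ b, gramPair a b = 0 := fun b => by rw [h]; rfl
    refine Prod.ext (funext fun i => funext fun u => ?_)
      (funext fun i => funext fun j => funext fun u => ?_)
    · have := h1 (Pi.single i (Pi.single u 1), 0)
      rw [gramPair_apply, sum_eq_single i (fun j _ hj => by simp [hj]) (by simp)] at this
      simpa using this
    · have := h1 (0, Pi.single i (Pi.single j (Pi.single u 1)))
      simp only [gramPair_apply, Pi.zero_apply, dotProduct_zero, sum_const_zero, zero_add] at this
      rw [sum_eq_single i (fun j _ hj => by simp [hj]) (by simp),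
        sum_eq_single j (fun i _ hi => by simp [hi]) (by simp)] at this
      simpa using this
  · ext b
    simp [h, gramPair_apply]

lemma sum_chi_gramPair (b : GramData p ℓ q ι) :
    ∑ a : GramData p ℓ q ι, chi (gramPair a b) =
      if b = 0 then (Fintype.card (GramData p ℓ q ι) : ℂ) else 0 := by
  simp only [gramPair_comm _ b, sum_chi_hom, gramPair_eq_zero]

lemma betaL_add (B : QuadFactor p n ℓ q) (x y : Vec p n) :
    B.betaL (x + y) = B.betaL x + B.betaL y :=
  funext fun _ => add_dotProduct _ _ _

lemma betaQ_add_left (B : QuadFactor p n ℓ q) (x y z : Vec p n) :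
    B.betaQ (x + y) z = B.betaQ x z + B.betaQ y z :=
  funext fun _ => add_dotProduct _ _ _

lemma betaQ_comm (B : QuadFactor p n ℓ q) (x y : Vec p n) : B.betaQ x y = B.betaQ y x :=
  funext fun j => dot_mulVec_symm (B.symm j) x y

lemma betaQ_add_right (B : QuadFactor p n ℓ q) (x y z : Vec p n) :
    B.betaQ x (y + z) = B.betaQ x y + B.betaQ x z := by
  rw [betaQ_comm, betaQ_add_left, betaQ_comm, betaQ_comm _ z]

lemma betaQ_zero_left (B : QuadFactor p n ℓ q) (x : Vec p n) : B.betaQ 0 x = 0 := by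
  simpa using betaQ_add_left B 0 0 x

lemma dot_betaL (B : QuadFactor p n ℓ q) (c : Fin ℓ → ZMod p) (x : Vec p n) :
    c ⬝ᵥ B.betaL x = (∑ i, c i • B.L i) ⬝ᵥ x := by
  rw [sum_dotProduct]
  refine sum_congr rfl fun i _ => ?_
  rw [smul_dotProduct, smul_eq_mul, dotProduct_comm]
  rfl

lemma dot_betaQ (B : QuadFactor p n ℓ q) (c : Fin q → ZMod p) (x y : Vec p n) :
    c ⬝ᵥ B.betaQ x y = x ⬝ᵥ (∑ j, c j • B.Q j) *ᵥ y := by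
  rw [Matrix.sum_mulVec, dotProduct_sum]
  refine sum_congr rfl fun j _ => ?_
  rw [Matrix.smul_mulVec, dotProduct_smul]
  rfl

lemma sq_norm_sum_mul_chi_le (j : ι) (F : (ι → Vec p n) → ℂ) (hF : ∀ v, ‖F v‖ ≤ 1)
    (hFj : ∀ v h, F (v + Pi.single j h) = F v) (P : (ι → Vec p n) → ZMod p) :
    ‖∑ v, F v * chi (P v)‖ ^ 2 * Fintype.card (Vec p n) ≤
      Fintype.card (ι → Vec p n) * ‖∑ h : Vec p n, ∑ v, chi (P (v + Pi.single j h) - P v)‖ := by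
  have hN : (0 : ℝ) < Fintype.card (Vec p n) := by exact_mod_cast Fintype.card_pos
  have h1 : (Fintype.card (Vec p n) : ℂ) * ∑ v, F v * chi (P v) =
      ∑ v, F v * ∑ h, chi (P (v + Pi.single j h)) := by
    have e : ∀ v, F v * ∑ h, chi (P (v + Pi.single j h)) =
        ∑ h, F v * chi (P (v + Pi.single j h)) := fun v => mul_sum _ _ _
    simp only [e]
    rw [sum_comm, ← card_univ, ← nsmul_eq_mul, ← sum_const]
    refine sum_congr rfl fun h _ => ?_
    rw [← Equiv.sum_comp (Equiv.addRight (Pi.single j h : ι → Vec p n))]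
    simp [hFj]
  have h2 : ((∑ v : ι → Vec p n, ‖∑ h : Vec p n, chi (P (v + Pi.single j h))‖ ^ 2 : ℝ) : ℂ) =
      Fintype.card (Vec p n) * ∑ h : Vec p n, ∑ v, chi (P (v + Pi.single j h) - P v) := by
    rw [Complex.ofReal_sum]
    simp only [ofReal_sq_norm_sum, ← chi_sub]
    rw [sum_comm_cycle, ← card_univ, ← nsmul_eq_mul, ← sum_const]
    refine sum_congr rfl fun h' _ => ?_
    rw [sum_comm, ← Equiv.sum_comp (Equiv.addRight h')]
    refine sum_congr rfl fun h _ => ?_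
    rw [← Equiv.sum_comp (Equiv.addRight (-(Pi.single j h') : ι → Vec p n))]
    refine sum_congr rfl fun v _ => ?_
    simp only [Equiv.coe_addRight, Pi.single_add]
    congr 3 <;> abel_nf
  have h3 := sq_norm_sum_mul_le_card F (fun v => ∑ h, chi (P (v + Pi.single j h))) hF
  have h4 : ∑ v : ι → Vec p n, ‖∑ h : Vec p n, chi (P (v + Pi.single j h))‖ ^ 2 =
      Fintype.card (Vec p n) * ‖∑ h : Vec p n, ∑ v, chi (P (v + Pi.single j h) - P v)‖ := by
    have := congrArg norm h2
    rw [Complex.norm_real, Real.norm_of_nonneg (sum_nonneg fun _ _ => sq_nonneg _), norm_mul,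
      Complex.norm_natCast] at this
    exact this
  rw [← h1, h4, norm_mul, Complex.norm_natCast, mul_pow] at h3
  refine le_of_mul_le_mul_left (le_trans (le_of_eq ?_) (h3.trans (le_of_eq ?_))) hN <;> ring

lemma gramPair_gram_add_single (B : QuadFactor p n ℓ q) (a : GramData p ℓ q ι)
    (v : ι → Vec p n) (j : ι) (h : Vec p n) :
    gramPair a (gram B (v + Pi.single j h)) - gramPair a (gram B v) =
      (a.1 j ⬝ᵥ B.betaL h + a.2 j j ⬝ᵥ B.betaQ h h) +
        ∑ i, (a.2 i j + a.2 j i) ⬝ᵥ B.betaQ (v i) h := by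
  have e1 : gram B (v + Pi.single j h) = gram B v +
      ((Pi.single j (B.betaL h), fun i i' => Pi.single (M := fun _ => Fin q → ZMod p) j
        (B.betaQ (v i) h) i') + ((0, fun i i' => Pi.single (M := fun _ => Fin q → ZMod p) j
        (B.betaQ (v i') h) i) + (0, Pi.single j (Pi.single j (B.betaQ h h))))) := by
    refine Prod.ext (funext fun i => ?_) (funext fun i => funext fun i' => ?_)
    · by_cases hi : i = j
      · subst hi; simp [gram, betaL_add]
      · simp [gram, hi]
    · by_cases hi : i = j <;> by_cases hi' : i' = j
      · subst hi; subst hi'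
        simp only [gram, Pi.add_apply, Prod.snd_add, Pi.single_eq_same, betaQ_add_left,
          betaQ_add_right, betaQ_comm _ h]
        abel
      · subst hi
        simp [gram, hi', betaQ_add_left, betaQ_comm _ h]
      · subst hi'
        simp [gram, hi, betaQ_add_right]
      · simp [gram, hi, hi']
  rw [e1, map_add, add_sub_cancel_left, map_add, map_add]
  have e2 : ∀ i, ∑ i', a.2 i i' ⬝ᵥ Pi.single (M := fun _ => Fin q → ZMod p) j
      (B.betaQ (v i) h) i' = a.2 i j ⬝ᵥ B.betaQ (v i) h := fun i => by
    rw [sum_eq_single j (fun i' _ hi' => by simp [hi']) (by simp)]; simp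
  have e3 : ∑ i, ∑ i', a.2 i i' ⬝ᵥ Pi.single (M := fun _ => Fin q → ZMod p) j
      (B.betaQ (v i') h) i = ∑ i', a.2 j i' ⬝ᵥ B.betaQ (v i') h := by
    rw [sum_eq_single j (fun i' _ hi' => by simp [hi']) (by simp)]; simp
  have e4 : ∑ i, a.1 i ⬝ᵥ Pi.single (M := fun _ => Fin ℓ → ZMod p) j (B.betaL h) i =
      a.1 j ⬝ᵥ B.betaL h := by
    rw [sum_eq_single j (fun i' _ hi' => by simp [hi']) (by simp)]; simp
  have e5 : ∑ i, ∑ i', a.2 i i' ⬝ᵥ (Pi.single j (Pi.single j (B.betaQ h h)) :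
      ι → ι → Fin q → ZMod p) i i' = a.2 j j ⬝ᵥ B.betaQ h h := by
    rw [sum_eq_single j (fun i' _ hi' => by simp [hi']) (by simp),
      sum_eq_single j (fun i' _ hi' => by simp [hi']) (by simp)]
    simp
  simp only [gramPair_apply, e2, e3, e4, e5, Pi.zero_apply, dotProduct_zero, sum_const_zero,
    add_dotProduct, sum_add_distrib]
  ring

lemma card_ker_mul_le (M : Matrix (Fin n) (Fin n) (ZMod p)) {t : ℕ} (ht : t ≤ M.rank) :
    #{x : Vec p n | M *ᵥ x = 0} * p ^ t ≤ Fintype.card (Vec p n) := by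
  have h1 : #{x : Vec p n | M *ᵥ x = 0} = Nat.card (LinearMap.ker M.mulVecLin) := by
    rw [← Fintype.card_subtype, ← Nat.card_eq_fintype_card]
    rfl
  have h2 := LinearMap.finrank_range_add_finrank_ker M.mulVecLin
  have h3 : Fintype.card (Vec p n) = p ^ Module.finrank (ZMod p) (Vec p n) := by
    rw [Module.card_eq_pow_finrank (K := ZMod p), ZMod.card]
  rw [h1, Module.natCard_eq_pow_finrank (K := ZMod p), Nat.card_zmod, h3, ← pow_add, ← h2]
  refine Nat.pow_le_pow_right (Fact.out : p.Prime).pos ?_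
  have : M.rank = Module.finrank (ZMod p) (LinearMap.range M.mulVecLin) := rfl
  omega

/-- The phases other than those depending only on the forbidden coordinates do not resonate. -/
lemma norm_sum_mul_chi_gram_le (h2 : (2 : ZMod p) ≠ 0) (B : QuadFactor p n ℓ q) {t : ℕ}
    (hB : ∀ c : Fin q → ZMod p, c ≠ 0 → 2 * t ≤ (∑ j, c j • B.Q j).rank) (j : ι)
    (F : (ι → Vec p n) → ℂ) (hF : ∀ v, ‖F v‖ ≤ 1)
    (hFj : ∀ v h, F (v + Pi.single j h) = F v) (a : GramData p ℓ q ι)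
    (ha : a.1 j ≠ 0 ∨ ∃ i, a.2 i j + a.2 j i ≠ 0) :
    ‖∑ v, F v * chi (gramPair a (gram B v))‖ * p ^ t ≤ Fintype.card (ι → Vec p n) := by
  have hp : 0 < (p : ℝ) := by exact_mod_cast (Fact.out : p.Prime).pos
  have hN : (0 : ℝ) < Fintype.card (Vec p n) := by exact_mod_cast Fintype.card_pos
  have hV : (0 : ℝ) ≤ Fintype.card (ι → Vec p n) := Nat.cast_nonneg _
  have hmain := sq_norm_sum_mul_chi_le j F hF hFj fun v => gramPair a (gram B v)
  simp only [gramPair_gram_add_single, chi_add] at hmain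
  refine le_of_sq_le_sq ?_ hV
  rw [mul_pow, ← pow_mul, mul_comm t 2]
  by_cases hi : ∃ i, a.2 i j + a.2 j i ≠ 0
  · obtain ⟨i, hi⟩ := hi
    set M := ∑ u, (a.2 i j + a.2 j i) u • B.Q u with hM
    have hD : ∀ h, ‖∑ v : ι → Vec p n, chi (a.1 j ⬝ᵥ B.betaL h) * chi (a.2 j j ⬝ᵥ B.betaQ h h) *
        chi (∑ i, (a.2 i j + a.2 j i) ⬝ᵥ B.betaQ (v i) h)‖ ≤
        if M *ᵥ h = 0 then (Fintype.card (ι → Vec p n) : ℝ) else 0 := by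
      intro h
      let ψ : (ι → Vec p n) →+ ZMod p :=
        { toFun := fun v => ∑ i, (a.2 i j + a.2 j i) ⬝ᵥ B.betaQ (v i) h
          map_zero' := by simp [betaQ_zero_left]
          map_add' := fun v w => by simp [betaQ_add_left, sum_add_distrib] }
      have e1 := sum_chi_hom ψ
      have e2 : ∑ v : ι → Vec p n, chi (∑ i, (a.2 i j + a.2 j i) ⬝ᵥ B.betaQ (v i) h) =
        ∑ v, chi (ψ v) := rfl
      rw [← mul_sum, norm_mul, norm_mul, norm_chi, norm_chi, one_mul, one_mul, e2, e1]
      by_cases hψ : ψ = 0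
      · rw [if_pos hψ, if_pos, Complex.norm_natCast]
        refine funext fun u => ?_
        have e3 : ψ (Pi.single i (Pi.single u 1)) = 0 := by rw [hψ]; rfl
        change ∑ i', (a.2 i' j + a.2 j i') ⬝ᵥ
          B.betaQ ((Pi.single i (Pi.single u 1) : ι → Vec p n) i') h = 0 at e3
        rw [sum_eq_single i (fun i' _ hi' => by simp [hi', betaQ_zero_left]) (by simp),
          dot_betaQ, Pi.single_eq_same, single_one_dotProduct] at e3
        exact e3
      · rw [if_neg hψ, norm_zero]
        split_ifs <;> positivity
    have hcard : (#{x : Vec p n | M *ᵥ x = 0} : ℝ) * p ^ (2 * t) ≤ Fintype.card (Vec p n) := by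
      exact_mod_cast card_ker_mul_le M (hB _ hi)
    have h3 := hmain.trans (mul_le_mul_of_nonneg_left
      ((norm_sum_le _ _).trans (sum_le_sum fun h _ => hD h)) hV)
    rw [← sum_filter, sum_const, nsmul_eq_mul] at h3
    refine le_of_mul_le_mul_left (a := (Fintype.card (Vec p n) : ℝ)) ?_ hN
    calc _ = ‖∑ v, F v * chi (gramPair a (gram B v))‖ ^ 2 * Fintype.card (Vec p n) *
          p ^ (2 * t) := by ring
      _ ≤ _ := mul_le_mul_of_nonneg_right h3 (by positivity)
      _ = (Fintype.card (ι → Vec p n) : ℝ) ^ 2 * (#{x : Vec p n | M *ᵥ x = 0} * p ^ (2 * t)) := by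
        ring
      _ ≤ _ := mul_le_mul_of_nonneg_left hcard (by positivity)
      _ = _ := by ring
  · push Not at hi
    have ha1 : a.1 j ≠ 0 := ha.resolve_right (by push Not; exact hi)
    have hjj : a.2 j j = 0 := by
      have := hi j
      rw [← two_smul (ZMod p)] at this
      exact (smul_eq_zero.1 this).resolve_left h2
    have hξ : ∑ i, a.1 j i • B.L i ≠ 0 := fun h =>
      ha1 (funext (Fintype.linearIndependent_iff.1 B.linIndep (a.1 j) h))
    have h0 : ∑ h, ∑ v : ι → Vec p n, chi (a.1 j ⬝ᵥ B.betaL h) * chi (a.2 j j ⬝ᵥ B.betaQ h h) *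
        chi (∑ i, (a.2 i j + a.2 j i) ⬝ᵥ B.betaQ (v i) h) = 0 := by
      simp only [hi, hjj, zero_dotProduct, sum_const_zero, chi_zero, mul_one, sum_const,
        ← smul_sum, dot_betaL, sum_chi_dot, if_neg hξ, smul_zero]
    rw [h0, norm_zero, mul_zero] at hmain
    have h3 : ‖∑ v, F v * chi (gramPair a (gram B v))‖ ^ 2 = 0 :=
      le_antisymm (nonpos_of_mul_nonpos_left hmain hN) (sq_nonneg _)
    rw [h3, zero_mul]
    positivity

/-- Orthogonality expansion of a count of families with prescribed Gram data, in which all phases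
outside `T` are negligible. -/
lemma norm_gram_count_sub_le (B : QuadFactor p n ℓ q) (g : GramData p ℓ q ι)
    (F : (ι → Vec p n) → ℂ) (T : Finset (GramData p ℓ q ι)) (X : ℝ) (hX : 0 ≤ X)
    (hT : ∀ a ∉ T, ‖∑ v, F v * chi (gramPair a (gram B v))‖ ≤ X) :
    ‖(Fintype.card (GramData p ℓ q ι) : ℂ) * (∑ v, if gram B v = g then F v else 0) -
      ∑ a ∈ T, chi (-gramPair a g) * ∑ v, F v * chi (gramPair a (gram B v))‖ ≤
      Fintype.card (GramData p ℓ q ι) * X := by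
  have h1 : (Fintype.card (GramData p ℓ q ι) : ℂ) * (∑ v, if gram B v = g then F v else 0) =
      ∑ a, chi (-gramPair a g) * ∑ v, F v * chi (gramPair a (gram B v)) := by
    simp only [mul_sum]
    rw [sum_comm]
    refine sum_congr rfl fun v _ => ?_
    have e1 : ∀ a, chi (-gramPair a g) * (F v * chi (gramPair a (gram B v))) =
        F v * chi (gramPair a (gram B v - g)) := fun a => by
      rw [map_sub, sub_eq_add_neg, chi_add]; ring
    simp only [e1, ← mul_sum, sum_chi_gramPair, sub_eq_zero]
    split_ifs <;> ring
  rw [h1, ← sum_sdiff (subset_univ T), add_sub_cancel_right]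
  calc _ ≤ ∑ a ∈ univ \ T, X := by
        refine (norm_sum_le _ _).trans (sum_le_sum fun a ha => ?_)
        rw [norm_mul, norm_chi, one_mul]
        exact hT a (mem_sdiff.1 ha).2
    _ ≤ ∑ a : GramData p ℓ q ι, X :=
        sum_le_sum_of_subset_of_nonneg (subset_univ _) fun _ _ _ => hX
    _ = _ := by rw [sum_const, card_univ, nsmul_eq_mul]

end GramCounting

section GramConfigurations

variable {p : ℕ} [Fact p.Prime] {n ℓ q : ℕ} {ι : Type*} [Fintype ι]

/-- Frequencies orthogonal to all symmetric Gram data. -/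
def antisymmData (p ℓ q : ℕ) (ι : Type*) : Set (GramData p ℓ q ι) :=
  {a | a.1 = 0 ∧ ∀ i j, a.2 i j + a.2 j i = 0}

/-- Frequencies which, on symmetric Gram data, only see the vector with index `s`. -/
def antisymmDataOff (p ℓ q : ℕ) {ι : Type*} (s : ι) : Set (GramData p ℓ q ι) :=
  {a | (∀ i ≠ s, a.1 i = 0) ∧ ∀ i j, j ≠ s → a.2 i j + a.2 j i = 0}

lemma gramPair_antisymm (h2 : (2 : ZMod p) ≠ 0) {a g : GramData p ℓ q ι}
    (ha : a ∈ antisymmData p ℓ q ι) (hg : ∀ i j, g.2 i j = g.2 j i) : gramPair a g = 0 := by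
  have h : ∑ i, ∑ j, a.2 i j ⬝ᵥ g.2 i j = -∑ i, ∑ j, a.2 i j ⬝ᵥ g.2 i j := by
    conv_rhs => rw [sum_comm]
    simp only [← sum_neg_distrib, ← neg_dotProduct]
    refine sum_congr rfl fun i _ => sum_congr rfl fun j _ => ?_
    rw [hg j i, eq_neg_of_add_eq_zero_left (ha.2 i j)]
  rw [gramPair_apply, ha.1]
  simp only [Pi.zero_apply, zero_dotProduct, sum_const_zero, zero_add]
  have h3 : (2 : ZMod p) * ∑ i, ∑ j, a.2 i j ⬝ᵥ g.2 i j = 0 := by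
    rw [two_mul]; nth_rewrite 1 [h]; exact neg_add_cancel _
  exact (mul_eq_zero.1 h3).resolve_left h2

variable [DecidableEq ι]

lemma abs_card_gram_sub_le (h2 : (2 : ZMod p) ≠ 0) (B : QuadFactor p n ℓ q) {t : ℕ}
    (hB : ∀ c : Fin q → ZMod p, c ≠ 0 → 2 * t ≤ (∑ j, c j • B.Q j).rank)
    (g : GramData p ℓ q ι) (hg : ∀ i j, g.2 i j = g.2 j i) :
    |(Fintype.card (GramData p ℓ q ι) : ℝ) * #{v | gram B v = g} -
      #{a | a ∈ antisymmData p ℓ q ι} * Fintype.card (ι → Vec p n)| * p ^ t ≤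
      Fintype.card (GramData p ℓ q ι) * Fintype.card (ι → Vec p n) := by
  have hp : 0 < (p : ℝ) := by exact_mod_cast (Fact.out : p.Prime).pos
  have h := norm_gram_count_sub_le B g (fun _ => 1) {a | a ∈ antisymmData p ℓ q ι}
    (Fintype.card (ι → Vec p n) / p ^ t) (by positivity) fun a ha => by
      rw [le_div_iff₀ (by positivity)]
      have ha' : ∃ j, a.1 j ≠ 0 ∨ ∃ i, a.2 i j + a.2 j i ≠ 0 := by
        by_contra! h
        exact ha (by
          simp only [mem_filter, mem_univ, true_and]
          exact ⟨funext fun j => (h j).1, fun i j => (h j).2 i⟩)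
      obtain ⟨j, hj⟩ := ha'
      exact norm_sum_mul_chi_gram_le h2 B hB j (fun _ => 1) (by simp) (by simp) a hj
  have h3 : ∑ a ∈ ({a | a ∈ antisymmData p ℓ q ι} : Finset (GramData p ℓ q ι)),
      chi (-gramPair a g) * ∑ v : ι → Vec p n, 1 * chi (gramPair a (gram B v)) =
      #{a | a ∈ antisymmData p ℓ q ι} * Fintype.card (ι → Vec p n) := by
    rw [← nsmul_eq_mul, ← sum_const]
    refine sum_congr rfl fun a ha => ?_
    have ha' := (mem_filter.1 ha).2
    rw [gramPair_antisymm h2 ha' hg, neg_zero, chi_zero, one_mul, ← card_univ,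
      ← mul_one (#univ : ℂ),
      ← nsmul_eq_mul, ← sum_const]
    refine sum_congr rfl fun v _ => ?_
    rw [gramPair_antisymm h2 ha' fun i j => betaQ_comm B _ _, chi_zero, one_mul]
  rw [h3, sum_boole, mul_div_assoc', le_div_iff₀ (by positivity)] at h
  rw [← Real.norm_eq_abs, ← Complex.norm_real]
  push_cast
  exact h

lemma card_antisymmDataOff_le (s : ι) :
    #{a | a ∈ antisymmDataOff p ℓ q s} ≤ #{a | a ∈ antisymmData p ℓ q ι} * p ^ (ℓ + q) := by
  have h : #(({a | a ∈ antisymmData p ℓ q ι} : Finset (GramData p ℓ q ι)) ×ˢ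
      (univ : Finset (Label p ℓ q))) =
      #{a | a ∈ antisymmData p ℓ q ι} * p ^ (ℓ + q) := by
    rw [card_product, card_univ]
    simp [Label, pow_add, ZMod.card]
  rw [← h]
  refine card_le_card_of_injOn (fun a => ((0, Function.update a.2 s
    (Function.update (a.2 s) s 0)), (a.1 s, a.2 s s))) (fun a ha => ?_) fun a ha b hb hab => ?_
  · have ha' : a ∈ antisymmDataOff p ℓ q s := (mem_filter.1 ha).2
    simp only [coe_product, Set.mem_prod, coe_filter, mem_univ, true_and, coe_univ, Set.mem_univ,
      and_true]
    refine ⟨rfl, fun i j => ?_⟩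
    by_cases hi : i = s <;> by_cases hj : j = s
    · subst hi; subst hj; simp
    · subst hi; simpa [hj] using ha'.2 i j hj
    · subst hj; simpa [hi, add_comm] using ha'.2 j i hi
    · simpa [hi, hj] using ha'.2 i j hj
  · have ha' : a ∈ antisymmDataOff p ℓ q s := (mem_filter.1 ha).2
    have hb' : b ∈ antisymmDataOff p ℓ q s := (mem_filter.1 hb).2
    simp only [Prod.mk.injEq, true_and] at hab
    obtain ⟨h1, h3, h4⟩ := hab
    refine Prod.ext (funext fun i => ?_) (funext fun i => funext fun j => ?_)
    · by_cases hi : i = s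
      · rw [hi, h3]
      · rw [ha'.1 i hi, hb'.1 i hi]
    · have := congrFun (congrFun h1 i) j
      by_cases hi : i = s
      · subst hi
        by_cases hj : j = i
        · rw [hj, h4]
        · simpa [hj] using this
      · simpa [hi] using this

lemma card_coord_mem_mul {G : Type*} [AddCommGroup G] [Fintype G] (s : ι) (E : Set G) :
    #{v : ι → G | v s ∈ E} * Fintype.card G = #{x | x ∈ E} * Fintype.card (ι → G) := by
  have h1 : ∀ h : G, #{v : ι → G | v s + h ∈ E} = #{v : ι → G | v s ∈ E} := fun h =>
    card_equiv (Equiv.addRight (Pi.single s h)) (by simp)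
  have h3 : ∀ v : ι → G, #{h | v s + h ∈ E} = #{x | x ∈ E} := fun v =>
    card_equiv (Equiv.addLeft (v s)) (by simp)
  have h4 : ∑ h : G, #{v : ι → G | v s + h ∈ E} = ∑ v : ι → G, #{h | v s + h ∈ E} := by
    simp only [card_eq_sum_ones, sum_filter]
    exact sum_comm
  simp only [h1, h3, sum_const, smul_eq_mul, card_univ] at h4
  rw [mul_comm, h4, mul_comm]

lemma card_gram_coord_mem_le (h2 : (2 : ZMod p) ≠ 0) (B : QuadFactor p n ℓ q) {t : ℕ}
    (hB : ∀ c : Fin q → ZMod p, c ≠ 0 → 2 * t ≤ (∑ j, c j • B.Q j).rank)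
    (g : GramData p ℓ q ι) (s : ι) (E : Set (Vec p n)) :
    (Fintype.card (GramData p ℓ q ι) : ℝ) * #{v | gram B v = g ∧ v s ∈ E} * p ^ t *
      Fintype.card (Vec p n) ≤
      #{a | a ∈ antisymmData p ℓ q ι} * p ^ (ℓ + q) * #{x | x ∈ E} * p ^ t *
        Fintype.card (ι → Vec p n) +
      Fintype.card (GramData p ℓ q ι) * Fintype.card (ι → Vec p n) * Fintype.card (Vec p n) := by
  have hp : 0 < (p : ℝ) := by exact_mod_cast (Fact.out : p.Prime).pos
  set F : (ι → Vec p n) → ℂ := fun v => if v s ∈ E then 1 else 0 with hFdef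
  have hF : ∀ v, ‖F v‖ ≤ 1 := fun v => by simp only [hFdef]; split_ifs <;> simp
  have h := norm_gram_count_sub_le B g F {a | a ∈ antisymmDataOff p ℓ q s}
    (Fintype.card (ι → Vec p n) / p ^ t) (by positivity) fun a ha => by
      rw [le_div_iff₀ (by positivity)]
      have ha' : ∃ j ≠ s, a.1 j ≠ 0 ∨ ∃ i, a.2 i j + a.2 j i ≠ 0 := by
        by_contra! h
        exact ha (by
          simp only [mem_filter, mem_univ, true_and]
          exact ⟨fun j hj => (h j hj).1, fun i j hj => (h j hj).2 i⟩)
      obtain ⟨j, hjs, hj⟩ := ha'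
      refine norm_sum_mul_chi_gram_le h2 B hB j F hF (fun v h => ?_) a hj
      simp [hFdef, hjs.symm]
  have h3 : ‖∑ a ∈ ({a | a ∈ antisymmDataOff p ℓ q s} : Finset (GramData p ℓ q ι)),
      chi (-gramPair a g) * ∑ v, F v * chi (gramPair a (gram B v))‖ ≤
      #{a | a ∈ antisymmDataOff p ℓ q s} * #{v : ι → Vec p n | v s ∈ E} := by
    rw [← nsmul_eq_mul, ← sum_const]
    refine (norm_sum_le _ _).trans (sum_le_sum fun a _ => ?_)
    rw [norm_mul, norm_chi, one_mul, card_eq_sum_ones, sum_filter, Nat.cast_sum]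
    refine (norm_sum_le _ _).trans (sum_le_sum fun v _ => ?_)
    rw [norm_mul, norm_chi, mul_one]
    simp only [hFdef]
    split_ifs <;> simp
  have h4 : (∑ v, if gram B v = g then F v else 0) = #{v | gram B v = g ∧ v s ∈ E} := by
    simp only [hFdef, ← ite_and, sum_boole]
  have h5 := (norm_sub_norm_le _ _).trans h
  rw [h4, norm_mul, Complex.norm_natCast, Complex.norm_natCast] at h5
  have h6 := h5.trans' (sub_le_sub_left h3 _)
  rw [mul_div_assoc', le_div_iff₀ (by positivity), sub_mul] at h6
  have h7 : (#{v : ι → Vec p n | v s ∈ E} : ℝ) * Fintype.card (Vec p n) =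
      #{x | x ∈ E} * Fintype.card (ι → Vec p n) := by exact_mod_cast card_coord_mem_mul s E
  have h8 : (#{a | a ∈ antisymmDataOff p ℓ q s} : ℝ) ≤
      #{a | a ∈ antisymmData p ℓ q ι} * p ^ (ℓ + q) := by
    exact_mod_cast card_antisymmDataOff_le s
  calc _ ≤ ((#{a | a ∈ antisymmDataOff p ℓ q s} : ℝ) * #{v : ι → Vec p n | v s ∈ E} * p ^ t +
        Fintype.card (GramData p ℓ q ι) * Fintype.card (ι → Vec p n)) *
          Fintype.card (Vec p n) := mul_le_mul_of_nonneg_right (by linarith) (by positivity)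
    _ = #{a | a ∈ antisymmDataOff p ℓ q s} * (#{x | x ∈ E} * Fintype.card (ι → Vec p n) * p ^ t) +
        Fintype.card (GramData p ℓ q ι) * Fintype.card (ι → Vec p n) * Fintype.card (Vec p n) := by
        rw [← h7]; ring
    _ ≤ _ := by
        refine (add_le_add_left (mul_le_mul_of_nonneg_right h8 (by positivity)) _).trans
          (le_of_eq ?_)
        ring

/-- Atoms of high rank quadratic factors have about the expected size. -/
lemma card_atom_le (h2 : (2 : ZMod p) ≠ 0) (B : QuadFactor p n ℓ q) {t : ℕ}
    (hB : ∀ c : Fin q → ZMod p, c ≠ 0 → 2 * t ≤ (∑ j, c j • B.Q j).rank)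
    (ht : ℓ + q ≤ t) (ab : Label p ℓ q) :
    #{x | B.betaB x = ab} * p ^ (ℓ + q) ≤ 2 * Fintype.card (Vec p n) := by
  have hp : 0 < (p : ℝ) := by exact_mod_cast (Fact.out : p.Prime).pos
  have h := abs_card_gram_sub_le (ι := Unit) h2 B hB (fun _ => ab.1, fun _ _ => ab.2) fun _ _ => rfl
  have h3 : #{v : Unit → Vec p n | gram B v = (fun _ => ab.1, fun _ _ => ab.2)} =
      #{x | B.betaB x = ab} := by
    refine card_equiv (Equiv.funUnique Unit (Vec p n)) fun v => ?_
    simp only [mem_filter, mem_univ, true_and, gram, QuadFactor.betaB, Prod.ext_iff, funext_iff]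
    exact ⟨fun h => ⟨h.1 (), h.2 () ()⟩, fun h => ⟨fun _ => h.1, fun _ _ => h.2⟩⟩
  have h4 : #{a | a ∈ antisymmData p ℓ q Unit} = 1 := by
    rw [card_eq_one]
    refine ⟨0, eq_singleton_iff_unique_mem.2 ⟨?_, fun a ha => ?_⟩⟩
    · simp [antisymmData]
    · obtain ⟨h5, h6⟩ : a ∈ antisymmData p ℓ q Unit := (mem_filter.1 ha).2
      refine Prod.ext h5 (funext fun i => funext fun j => ?_)
      have := h6 i j
      rw [← two_smul (ZMod p)] at this
      exact (smul_eq_zero.1 this).resolve_left h2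
  have h5 : Fintype.card (GramData p ℓ q Unit) = p ^ (ℓ + q) := by
    simp [GramData, pow_add, ZMod.card]
  have h6 : Fintype.card (Unit → Vec p n) = Fintype.card (Vec p n) := by simp
  rw [h3, h4, h5, h6] at h
  push_cast at h
  have h7 : (p : ℝ) ^ (ℓ + q) ≤ p ^ t :=
    pow_le_pow_right₀ (by exact_mod_cast (Fact.out : p.Prime).one_le) ht
  have h8 := (mul_le_mul_of_nonneg_right (le_abs_self _) (by positivity)).trans
    (h.trans (mul_le_mul_of_nonneg_right h7 (by positivity)))
  rw [mul_comm _ ((p : ℝ) ^ t)] at h8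
  have h9 := le_of_mul_le_mul_left h8 (by positivity)
  rw [one_mul] at h9
  have : (#{x | B.betaB x = ab} : ℝ) * p ^ (ℓ + q) ≤ 2 * Fintype.card (Vec p n) := by linarith
  exact_mod_cast this

end GramConfigurations

section ShatteredLabels

variable {p : ℕ} [Fact p.Prime] {n ℓ q : ℕ} {ι : Type*} [DecidableEq ι]

lemma gram_update_congr (B : QuadFactor p n ℓ q) {v w : ι → Vec p n} (h : gram B v = gram B w)
    (i j s : ι) : gram B (Function.update v s (v i + v j + v s)) =
      gram B (Function.update w s (w i + w j + w s)) := by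
  have h1 : ∀ i, B.betaL (v i) = B.betaL (w i) := fun i => congrFun (congrArg Prod.fst h) i
  have h2 : ∀ i j, B.betaQ (v i) (v j) = B.betaQ (w i) (w j) := fun i j =>
    congrFun (congrFun (congrArg Prod.snd h) i) j
  refine Prod.ext (funext fun a => ?_) (funext fun a => funext fun b => ?_)
  · by_cases ha : a = s
    · subst ha; simp [gram, betaL_add, h1]
    · simp [gram, ha, h1]
  · by_cases ha : a = s <;> by_cases hb : b = s
    · subst ha; subst hb; simp [gram, betaQ_add_left, betaQ_add_right, h2]
    · subst ha; simp [gram, hb, betaQ_add_left, h2]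
    · subst hb; simp [gram, ha, betaQ_add_right, h2]
    · simp [gram, ha, hb, h2]

variable [Fintype ι]

lemma card_gram_sum_mem_le (h2 : (2 : ZMod p) ≠ 0) (B : QuadFactor p n ℓ q) {t : ℕ}
    (hB : ∀ c : Fin q → ZMod p, c ≠ 0 → 2 * t ≤ (∑ j, c j • B.Q j).rank)
    (g : GramData p ℓ q ι) {i j s : ι} (hi : i ≠ s) (hj : j ≠ s) (E : Set (Vec p n)) {R : ℝ}
    (hR : 0 ≤ R) (hE : R * (#{x | x ∈ E} * p ^ (ℓ + q)) ≤ Fintype.card (Vec p n)) :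
    R * (Fintype.card (GramData p ℓ q ι) * #{v | gram B v = g ∧ v i + v j + v s ∈ E} * p ^ t) ≤
      #{a | a ∈ antisymmData p ℓ q ι} * Fintype.card (ι → Vec p n) * p ^ t +
      R * (Fintype.card (GramData p ℓ q ι) * Fintype.card (ι → Vec p n)) := by
  have hN : (0 : ℝ) < Fintype.card (Vec p n) := by exact_mod_cast Fintype.card_pos
  rcases (({v | gram B v = g ∧ v i + v j + v s ∈ E} : Finset (ι → Vec p n))).eq_empty_or_nonempty
    with h0 | ⟨w, hw⟩
  · rw [h0]
    simp only [card_empty, Nat.cast_zero, mul_zero, zero_mul]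
    positivity
  have hwg : gram B w = g := (mem_filter.1 hw).2.1
  have h := card_gram_coord_mem_le h2 B hB
    (gram B (Function.update w s (w i + w j + w s))) s E
  have h1 : #{v | gram B v = g ∧ v i + v j + v s ∈ E} ≤
      #{v | gram B v = gram B (Function.update w s (w i + w j + w s)) ∧ v s ∈ E} := by
    refine card_le_card_of_injOn (fun v => Function.update v s (v i + v j + v s)) (fun v hv => ?_)
      fun v hv u hu hvu => ?_
    · have hv' := (mem_filter.1 hv).2
      simp only [coe_filter, mem_univ, true_and, Set.mem_ofPred_eq, Function.update_self]
      exact ⟨gram_update_congr B (hv'.1.trans hwg.symm) i j s, hv'.2⟩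
    · have e : ∀ a ≠ s, v a = u a := fun a ha => by simpa [ha] using congrFun hvu a
      funext a
      by_cases ha : a = s
      · subst ha
        have := congrFun hvu a
        simp only [Function.update_self, e i hi, e j hj] at this
        exact add_left_cancel this
      · exact e a ha
  have h3 : (#{v | gram B v = g ∧ v i + v j + v s ∈ E} : ℝ) ≤
      #{v | gram B v = gram B (Function.update w s (w i + w j + w s)) ∧ v s ∈ E} := by
    exact_mod_cast h1
  refine le_of_mul_le_mul_right ?_ hN
  have hp : 0 < (p : ℝ) := by exact_mod_cast (Fact.out : p.Prime).pos
  calc _ = R * (Fintype.card (GramData p ℓ q ι) * p ^ t * Fintype.card (Vec p n)) *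
        #{v | gram B v = g ∧ v i + v j + v s ∈ E} := by ring
    _ ≤ _ := mul_le_mul_of_nonneg_left h3 (by positivity)
    _ = R * (Fintype.card (GramData p ℓ q ι) * #{v | gram B v =
          gram B (Function.update w s (w i + w j + w s)) ∧ v s ∈ E} * p ^ t *
          Fintype.card (Vec p n)) := by ring
    _ ≤ _ := mul_le_mul_of_nonneg_left h hR
    _ = #{a | a ∈ antisymmData p ℓ q ι} * Fintype.card (ι → Vec p n) * p ^ t *
          (R * (#{x | x ∈ E} * p ^ (ℓ + q))) +
        R * (Fintype.card (GramData p ℓ q ι) * Fintype.card (ι → Vec p n)) *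
          Fintype.card (Vec p n) := by ring
    _ ≤ _ := by
      rw [add_mul]
      exact add_le_add_left (mul_le_mul_of_nonneg_left hE (by positivity)) _

lemma not_pattern_inequalities {K N T R P c : ℝ} (hT : 1 ≤ T) (hN : 0 < N) (hK : 0 < K)
    (hR : 0 < R) (hP : 2 * (1 + R) * K ≤ P) (hlow : (T * N - K * c) * P ≤ K * N)
    (hup : 4 * (K * c * P) ≤ T * N * P + 4 * R * (K * N)) : False := by
  have h0 : 0 < (1 + R) * K := by positivity
  have h1 : N * (3 * (T * P)) ≤ N * (4 * (1 + R) * K) := by linarith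
  have h2 := le_of_mul_le_mul_left h1 hN
  have h3 : P ≤ T * P := le_mul_of_one_le_left (by linarith) hT
  linarith

/-- Index set for the vertices of a tripartite pattern. -/
abbrev PatternVertex (m : ℕ) := Fin m ⊕ Fin m ⊕ Set (Fin m × Fin m)

/-- The rank required to realise all patterns of size `m`. -/
def patternRank (p m ℓ q : ℕ) : ℕ :=
  2 * (1 + patternSize m) *
    p ^ ((2 * m + 2 ^ (m * m)) * ℓ + (2 * m + 2 ^ (m * m)) ^ 2 * q)

set_option synthInstance.maxSize 1000 in
lemma patternRank_eq (p m ℓ q : ℕ) [Fact p.Prime] : patternRank p m ℓ q =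
    2 * (1 + patternSize m) * Fintype.card (GramData p ℓ q (PatternVertex m)) := by
  simp only [patternRank, Fintype.card_prod, Fintype.card_fun, Fintype.card_sum, Fintype.card_set,
    Fintype.card_fin, ZMod.card, ← pow_mul, ← pow_add]
  congr 2
  ring

/-- Gram data of a pattern whose sums `x i + y j + z S` have label
`(a i, u i + b {i | (i, j) ∈ S})`. -/
noncomputable def patternGram {m : ℕ} (a : Fin m → Fin ℓ → ZMod p) (u : Fin m → Fin q → ZMod p)
    (b : Set (Fin m) → Fin q → ZMod p) : GramData p ℓ q (PatternVertex m) :=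
  (Sum.elim a 0, Sum.elim
    (fun i => Sum.elim (fun i' => if i = i' then u i else 0) 0)
    (Sum.elim
      (fun j => Sum.elim 0 (Sum.elim 0 fun S => (2⁻¹ : ZMod p) • b {i | (i, j) ∈ S}))
      (fun S => Sum.elim 0 (Sum.elim (fun j => (2⁻¹ : ZMod p) • b {i | (i, j) ∈ S}) 0))))

lemma patternGram_comm {m : ℕ} (a : Fin m → Fin ℓ → ZMod p) (u : Fin m → Fin q → ZMod p)
    (b : Set (Fin m) → Fin q → ZMod p) (v w : PatternVertex m) :
    (patternGram a u b).2 v w = (patternGram a u b).2 w v := by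
  rcases v with i | j | S <;> rcases w with i' | j' | S' <;>
    simp only [patternGram, Sum.elim_inl, Sum.elim_inr, Pi.zero_apply]
  by_cases h : i = i'
  · subst h; rfl
  · rw [if_neg h, if_neg (Ne.symm h)]

lemma betaB_add_add (h2 : (2 : ZMod p) ≠ 0) (B : QuadFactor p n ℓ q) {m : ℕ}
    {a : Fin m → Fin ℓ → ZMod p} {u : Fin m → Fin q → ZMod p} {b : Set (Fin m) → Fin q → ZMod p}
    {v : PatternVertex m → Vec p n} (hv : gram B v = patternGram a u b) (i j : Fin m)
    (S : Set (Fin m × Fin m)) :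
    B.betaB (v (.inl i) + v (.inr (.inl j)) + v (.inr (.inr S))) =
      (a i, u i + b {i | (i, j) ∈ S}) := by
  have h1 : ∀ i, B.betaL (v i) = (patternGram a u b).1 i := fun i =>
    congrFun (congrArg Prod.fst hv) i
  have h3 : ∀ i j, B.betaQ (v i) (v j) = (patternGram a u b).2 i j := fun i j =>
    congrFun (congrFun (congrArg Prod.snd hv) i) j
  refine Prod.ext ?_ ?_
  · simp [QuadFactor.betaB, betaL_add, h1, patternGram]
  · simp only [QuadFactor.betaB, betaQ_add_left, betaQ_add_right, h3, patternGram, Sum.elim_inl,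
      Sum.elim_inr, Pi.zero_apply, add_zero, zero_add, if_true]
    rw [add_assoc, ← add_smul, ← two_mul, mul_inv_cancel₀ h2, one_smul]

set_option synthInstance.maxSize 1000 in
/-- If labels of a high rank factor shatter and the corresponding atoms are almost disjoint from the
error set, then the pattern can be realised in the set itself. -/
theorem hasVC2Dim_of_labels (h2 : (2 : ZMod p) ≠ 0) (B : QuadFactor p n ℓ q) {m t : ℕ}
    (hm : 0 < m) (hB : ∀ c : Fin q → ZMod p, c ≠ 0 → 2 * t ≤ (∑ j, c j • B.Q j).rank)
    (ht : patternRank p m ℓ q ≤ p ^ t) {A : Set (Vec p n)} {S : Set (Label p ℓ q)}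
    (a : Fin m → Fin ℓ → ZMod p) (u : Fin m → Fin q → ZMod p) (b : Set (Fin m) → Fin q → ZMod p)
    (hS : ∀ i P, (a i, u i + b P) ∈ S ↔ i ∈ P)
    (hgood : ∀ i P, 4 * patternSize m * (#{x | x ∈ A ∆ {x | B.betaB x ∈ S} ∧
      B.betaB x = (a i, u i + b P)} * p ^ (ℓ + q)) ≤ Fintype.card (Vec p n)) :
    HasVC2Dim A m := by
  have hp : 0 < (p : ℝ) := by exact_mod_cast (Fact.out : p.Prime).pos
  set g := patternGram a u b with hg
  set D := A ∆ {x | B.betaB x ∈ S} with hD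
  by_cases hgoodv : ∃ v, gram B v = g ∧ ∀ i j P,
      v (.inl i) + v (.inr (.inl j)) + v (.inr (.inr P)) ∉ D
  · obtain ⟨v, hv, hvD⟩ := hgoodv
    refine ⟨fun i => v (.inl i), fun j => v (.inr (.inl j)), fun P => v (.inr (.inr P)),
      fun i j P => ?_⟩
    have h1 := hvD i j P
    rw [hD, Set.mem_symmDiff, Set.mem_ofPred_eq, betaB_add_add h2 B hv, hS] at h1
    have h3 : i ∈ {i | (i, j) ∈ P} ↔ (i, j) ∈ P := Iff.rfl
    rw [h3] at h1
    tauto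
  exfalso
  push Not at hgoodv
  set K : ℝ := (Fintype.card (GramData p ℓ q (PatternVertex m)) : ℝ) with hK
  set N : ℝ := (Fintype.card (PatternVertex m → Vec p n) : ℝ) with hN
  set T : ℝ := (#{a | a ∈ antisymmData p ℓ q (PatternVertex m)} : ℝ) with hT
  have hT1 : 1 ≤ T := by
    rw [hT]
    have : 0 < #{a | a ∈ antisymmData p ℓ q (PatternVertex m)} :=
      card_pos.2 ⟨0, by simp [antisymmData]⟩
    exact_mod_cast this
  have hN0 : 0 < N := by rw [hN]; exact_mod_cast Fintype.card_pos
  have hK0 : 0 < K := by rw [hK]; exact_mod_cast Fintype.card_pos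
  set R : ℝ := (patternSize m : ℝ) with hR
  have hR0 : 0 < R := by
    rw [hR]
    have : 0 < patternSize m := by unfold patternSize; positivity
    exact_mod_cast this
  have ht' : 2 * (1 + R) * K ≤ p ^ t := by
    rw [hR, hK]; rw [patternRank_eq] at ht; exact_mod_cast ht
  have hlow := (abs_le.1 ((le_div_iff₀ (by positivity)).2
    (abs_card_gram_sub_le h2 B hB g (patternGram_comm a u b)))).1
  rw [neg_le, neg_sub, le_div_iff₀ (by positivity), ← hK, ← hT, ← hN] at hlow
  have hup : ∀ e : Fin m × Fin m × Set (Fin m × Fin m),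
      4 * R * (K * #{v | gram B v = g ∧ v (.inl e.1) + v (.inr (.inl e.2.1)) +
        v (.inr (.inr e.2.2)) ∈ D} * p ^ t) ≤ T * N * p ^ t + 4 * R * (K * N) := by
    rintro ⟨i, j, P⟩
    obtain ⟨E, hE⟩ : ∃ E : Set (Vec p n), ∀ x, x ∈ E ↔
        x ∈ D ∧ B.betaB x = (a i, u i + b {i | (i, j) ∈ P}) :=
      ⟨{x | x ∈ D ∧ B.betaB x = (a i, u i + b {i | (i, j) ∈ P})}, fun _ => Iff.rfl⟩
    have h := card_gram_sum_mem_le h2 B hB g (i := .inl i) (j := .inr (.inl j))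
      (s := .inr (.inr P)) (by simp) (by simp) E (R := 4 * R) (by positivity) (by
        rw [hR, filter_congr fun x _ => hE x]
        exact_mod_cast hgood i {i | (i, j) ∈ P})
    rw [filter_congr (q := fun v => gram B v = g ∧ v (.inl i) + v (.inr (.inl j)) +
      v (.inr (.inr P)) ∈ D) fun v _ => and_congr_right fun hv =>
        (hE _).trans ⟨fun h => h.1, fun h => ⟨h, betaB_add_add h2 B hv i j P⟩⟩] at h
    exact h
  have hcover : #{v | gram B v = g} ≤ ∑ e : Fin m × Fin m × Set (Fin m × Fin m),
      #{v | gram B v = g ∧ v (.inl e.1) + v (.inr (.inl e.2.1)) + v (.inr (.inr e.2.2)) ∈ D} := by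
    refine le_trans (card_le_card fun v hv => ?_) card_biUnion_le
    obtain ⟨i, j, P, h⟩ := hgoodv v (mem_filter.1 hv).2
    exact mem_biUnion.2 ⟨(i, j, P), mem_univ _, mem_filter.2
      ⟨mem_univ _, (mem_filter.1 hv).2, h⟩⟩
  have hcover' : (#{v | gram B v = g} : ℝ) ≤ ∑ e : Fin m × Fin m × Set (Fin m × Fin m),
      (#{v | gram B v = g ∧ v (.inl e.1) + v (.inr (.inl e.2.1)) +
        v (.inr (.inr e.2.2)) ∈ D} : ℝ) := by exact_mod_cast hcover
  have hcard : (Fintype.card (Fin m × Fin m × Set (Fin m × Fin m)) : ℝ) = R := by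
    rw [hR, patternSize]
    simp only [Fintype.card_prod, Fintype.card_set, Fintype.card_fin]
    push_cast; ring
  have hsum := sum_le_sum fun e (_ : e ∈ univ) => hup e
  rw [sum_const, card_univ, nsmul_eq_mul, hcard] at hsum
  have h5 : 4 * R * (K * #{v | gram B v = g} * p ^ t) ≤
      R * (T * N * p ^ t + 4 * R * (K * N)) := by
    refine le_trans ?_ hsum
    rw [← mul_sum, ← sum_mul, ← mul_sum]
    exact mul_le_mul_of_nonneg_left (mul_le_mul_of_nonneg_right
      (mul_le_mul_of_nonneg_left hcover' hK0.le) (by positivity)) (by positivity)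
  have h6 : 4 * (K * #{v | gram B v = g} * p ^ t) ≤ T * N * p ^ t + 4 * R * (K * N) := by
    refine le_of_mul_le_mul_left (le_trans (le_of_eq ?_) h5) hR0
    ring
  exact not_pattern_inequalities hT1 hN0 hK0 hR0 ht' hlow h6

end ShatteredLabels

section SauerShelah

lemma sum_choose_le_pow (M k : ℕ) : ∑ i ∈ Iic k, M.choose i ≤ (M + 1) ^ k := by
  rw [add_pow, Nat.range_succ_eq_Iic]
  refine sum_le_sum fun i hi => ?_
  rw [one_pow, mul_one]
  refine (Nat.choose_le_pow M i).trans (Nat.le_mul_of_pos_right _ ?_)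
  exact Nat.choose_pos (mem_Iic.1 hi)

/-- A family of more than `(M + 1) ^ k` subsets of a set of size `M` shatters a set of size
`k + 1`. -/
lemma exists_shatters_of_pow_lt_card {M k : ℕ} (𝒜 : Finset (Finset (Fin M)))
    (h : (M + 1) ^ k < #𝒜) : ∃ s : Finset (Fin M), #s = k + 1 ∧ 𝒜.Shatters s := by
  by_cases hk : 𝒜.vcDim ≤ k
  · exfalso
    have h1 := (card_le_card_shatterer 𝒜).trans card_shatterer_le_sum_vcDim
    rw [Fintype.card_fin] at h1
    have h3 := h1.trans (sum_le_sum_of_subset (Iic_subset_Iic.2 hk))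
    exact absurd (h3.trans (sum_choose_le_pow M k)) (not_le.2 h)
  · push Not at hk
    obtain ⟨s, hs, hsk⟩ : ∃ s ∈ 𝒜.shatterer, k + 1 ≤ #s := by
      have := (Finset.lt_sup_iff (s := 𝒜.shatterer) (f := card) (a := k)).1 hk
      simpa [Nat.succ_le_iff] using this
    obtain ⟨t, hts, ht⟩ := exists_subset_card_eq hsk
    exact ⟨t, ht, (mem_shatterer.1 hs).mono_right hts⟩

end SauerShelah

section RandomSamples

variable {I Ω : Type*} [Fintype I] [DecidableEq I] [Fintype Ω]

lemma card_pi_forall_mem (E : Set Ω) :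
    #{ω : I → Ω | ∀ u, ω u ∈ E} = #{x | x ∈ E} ^ Fintype.card I := by
  rw [← card_univ, ← prod_const, ← Fintype.card_piFinset]
  congr 1
  ext ω
  simp

lemma card_pi_mem (E : Set Ω) (u : I) :
    #{ω : I → Ω | ω u ∈ E} * Fintype.card Ω = #{x | x ∈ E} * Fintype.card Ω ^ Fintype.card I := by
  have h : ({ω : I → Ω | ω u ∈ E} : Finset (I → Ω)) =
      Fintype.piFinset (Function.update (fun _ => (univ : Finset Ω)) u
        ({x | x ∈ E} : Finset Ω)) := by
    ext ω
    simp only [mem_filter, mem_univ, true_and, Fintype.mem_piFinset]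
    refine ⟨fun h v => ?_, fun h => ?_⟩
    · by_cases hv : v = u
      · subst hv; simpa using h
      · simp [hv]
    · simpa using h u
  rw [h, Fintype.card_piFinset, ← mul_prod_erase univ _ (mem_univ u)]
  simp only [Function.update_self]
  rw [prod_congr rfl (g := fun _ => Fintype.card Ω) fun v hv => by
    rw [Function.update_of_ne (ne_of_mem_erase hv), card_univ], prod_const, card_erase_of_mem
    (mem_univ u), card_univ, mul_assoc, ← pow_succ, Nat.sub_add_cancel]
  exact Fintype.card_pos_iff.2 ⟨u⟩

/-- A random sample separates any well separated family of sets and avoids small bad sets. -/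
lemma exists_separating_sample {T : Type*} [Nonempty Ω] (P : Finset T) (E Bad : T → Set Ω)
    {δ β : ℝ} {M : ℕ} (hδ : δ ≤ 1)
    (hsep : ∀ b ∈ P, ∀ b' ∈ P, b ≠ b' →
      δ * Fintype.card Ω ≤ (#{ω | ¬(ω ∈ E b ↔ ω ∈ E b')} : ℝ))
    (hBad : ∀ b ∈ P, (#{ω | ω ∈ Bad b} : ℝ) ≤ β * Fintype.card Ω)
    (h : (#P : ℝ) ^ 2 * (1 - δ) ^ M + M * #P * β < 1) :
    ∃ ω : Fin M → Ω, (∀ b ∈ P, ∀ u, ω u ∉ Bad b) ∧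
      ∀ b ∈ P, ∀ b' ∈ P, b ≠ b' → ∃ u, ¬(ω u ∈ E b ↔ ω u ∈ E b') := by
  by_contra! hcon
  set N : ℝ := (Fintype.card Ω : ℝ) with hN
  have hN0 : 0 < N := by rw [hN]; exact_mod_cast Fintype.card_pos
  have hcover : (univ : Finset (Fin M → Ω)) ⊆
      (P.biUnion fun b => univ.biUnion fun u => ({ω | ω u ∈ Bad b} : Finset (Fin M → Ω))) ∪
      (P.offDiag.biUnion fun x => ({ω | ∀ u, ω u ∈ E x.1 ↔ ω u ∈ E x.2} :
        Finset (Fin M → Ω))) := by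
    intro ω _
    rw [mem_union]
    by_cases hω : ∀ b ∈ P, ∀ u, ω u ∉ Bad b
    · obtain ⟨b, hb, b', hb', hne, hu⟩ := hcon ω hω
      refine Or.inr (mem_biUnion.2 ⟨(b, b'), mem_offDiag.2 ⟨hb, hb', hne⟩, ?_⟩)
      exact mem_filter.2 ⟨mem_univ _, hu⟩
    · push Not at hω
      obtain ⟨b, hb, u, hu⟩ := hω
      exact Or.inl (mem_biUnion.2 ⟨b, hb, mem_biUnion.2 ⟨u, mem_univ _,
        mem_filter.2 ⟨mem_univ _, hu⟩⟩⟩)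
  have h1 := (card_le_card hcover).trans (card_union_le _ _)
  have h3 := h1.trans (add_le_add (card_biUnion_le.trans
    (sum_le_sum fun b _ => card_biUnion_le)) card_biUnion_le)
  rw [card_univ, Fintype.card_pi_const] at h3
  have h4 : N ^ M ≤ ∑ b ∈ P, ∑ u : Fin M, (#{ω : Fin M → Ω | ω u ∈ Bad b} : ℝ) +
      ∑ x ∈ P.offDiag,
        (#{ω : Fin M → Ω | ∀ u, ω u ∈ E x.1 ↔ ω u ∈ E x.2} : ℝ) := by
    rw [hN]; exact_mod_cast h3
  have h5 : ∀ b ∈ P, ∀ u : Fin M, (#{ω : Fin M → Ω | ω u ∈ Bad b} : ℝ) ≤ β * N ^ M := by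
    intro b hb u
    have := card_pi_mem (I := Fin M) (Bad b) u
    rw [Fintype.card_fin] at this
    have h' : (#{ω : Fin M → Ω | ω u ∈ Bad b} : ℝ) * N = #{x | x ∈ Bad b} * N ^ M := by
      rw [hN]; exact_mod_cast this
    refine le_of_mul_le_mul_right ?_ hN0
    rw [h', mul_right_comm]
    exact mul_le_mul_of_nonneg_right (hBad b hb) (by positivity)
  have h6 : ∀ x ∈ P.offDiag,
      (#{ω : Fin M → Ω | ∀ u, ω u ∈ E x.1 ↔ ω u ∈ E x.2} : ℝ) ≤
        (1 - δ) ^ M * N ^ M := by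
    intro x hx
    obtain ⟨hx1, hx2, hne⟩ := mem_offDiag.1 hx
    have hs := hsep _ hx1 _ hx2 hne
    have hc : (#{y | y ∈ E x.1 ↔ y ∈ E x.2} : ℝ) + #{y | ¬(y ∈ E x.1 ↔ y ∈ E x.2)} = N := by
      rw [hN, ← card_univ]
      exact_mod_cast card_filter_add_card_filter_not (s := univ)
        (fun y => y ∈ E x.1 ↔ y ∈ E x.2)
    have hle : #{ω : Fin M → Ω | ∀ u, ω u ∈ E x.1 ↔ ω u ∈ E x.2} ≤
        #{y | y ∈ E x.1 ↔ y ∈ E x.2} ^ M := by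
      obtain ⟨F, hF⟩ : ∃ F : Set Ω, ∀ y, y ∈ F ↔ (y ∈ E x.1 ↔ y ∈ E x.2) :=
        ⟨{y | y ∈ E x.1 ↔ y ∈ E x.2}, fun _ => Iff.rfl⟩
      have h' := card_pi_forall_mem (I := Fin M) F
      rw [Fintype.card_fin, filter_congr fun y _ => hF y] at h'
      refine (card_le_card fun ω hω => ?_).trans h'.le
      simp only [mem_filter, mem_univ, true_and] at hω ⊢
      exact fun u => (hF _).2 (hω u)
    have hle' : (#{ω : Fin M → Ω | ∀ u, ω u ∈ E x.1 ↔ ω u ∈ E x.2} : ℝ) ≤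
        (#{y | y ∈ E x.1 ↔ y ∈ E x.2} : ℝ) ^ M := by exact_mod_cast hle
    rw [← mul_pow]
    refine le_trans hle' (pow_le_pow_left₀ (by positivity) ?_ M)
    linarith
  have h7 := h4.trans (add_le_add (sum_le_sum fun b hb => sum_le_sum fun u _ => h5 b hb u)
    (sum_le_sum h6))
  simp only [sum_const, card_univ, Fintype.card_fin, nsmul_eq_mul] at h7
  have h8 : (#P.offDiag : ℝ) ≤ (#P : ℝ) ^ 2 := by
    have : #P.offDiag ≤ #P ^ 2 := by
      rw [offDiag_card, sq]; exact Nat.sub_le _ _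
    exact_mod_cast this
  have h9 : (#P.offDiag : ℝ) * ((1 - δ) ^ M * N ^ M) ≤ (#P : ℝ) ^ 2 * ((1 - δ) ^ M * N ^ M) :=
    mul_le_mul_of_nonneg_right h8 (mul_nonneg (pow_nonneg (by linarith) _) (by positivity))
  have hNM : 0 < N ^ M := by positivity
  have h10 := mul_lt_mul_of_pos_right h hNM
  nlinarith

/-- Many well separated sets shatter `k + 1` points which avoid small bad sets. -/
lemma exists_shattered_of_separated {T : Type*} [Nonempty Ω] (P : Finset T)
    (E Bad : T → Set Ω) {δ β : ℝ} {M k : ℕ} (hδ : δ ≤ 1)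
    (hsep : ∀ b ∈ P, ∀ b' ∈ P, b ≠ b' →
      δ * Fintype.card Ω ≤ (#{ω | ¬(ω ∈ E b ↔ ω ∈ E b')} : ℝ))
    (hBad : ∀ b ∈ P, (#{ω | ω ∈ Bad b} : ℝ) ≤ β * Fintype.card Ω)
    (h : (#P : ℝ) ^ 2 * (1 - δ) ^ M + M * #P * β < 1) (hP : (M + 1) ^ k < #P) :
    ∃ (ω : Fin (k + 1) → Ω) (b : Set (Fin (k + 1)) → T), ∀ i Q,
      b Q ∈ P ∧ ω i ∉ Bad (b Q) ∧ (ω i ∈ E (b Q) ↔ i ∈ Q) := by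
  obtain ⟨ω, hωB, hωP⟩ := exists_separating_sample P E Bad hδ hsep hBad h
  set f : T → Finset (Fin M) := fun b => {u | ω u ∈ E b} with hf
  have hinj : Set.InjOn f P := by
    intro b hb b' hb' hbb
    by_contra hne
    obtain ⟨u, hu⟩ := hωP b hb b' hb' hne
    apply hu
    have := Finset.ext_iff.1 hbb u
    simpa [hf] using this
  obtain ⟨s, hs, hsh⟩ := exists_shatters_of_pow_lt_card (P.image f)
    (by rwa [card_image_of_injOn hinj])
  have e : Fin (k + 1) ≃ s := (Fintype.equivFinOfCardEq (by rw [Fintype.card_coe, hs])).symm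
  have hex : ∀ Q : Set (Fin (k + 1)), ∃ b ∈ P, ∀ i, ω (e i) ∈ E b ↔ i ∈ Q := by
    intro Q
    obtain ⟨t, ht, hst⟩ := hsh (t := s.filter fun u => ∃ i ∈ Q, (e i : Fin M) = u)
      (filter_subset _ _)
    obtain ⟨b, hb, rfl⟩ := mem_image.1 ht
    refine ⟨b, hb, fun i => ?_⟩
    have h1 := Finset.ext_iff.1 hst (e i)
    simp only [mem_inter, Finset.coe_mem, true_and, hf, mem_filter, mem_univ] at h1
    rw [h1]
    constructor
    · rintro ⟨j, hj, hji⟩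
      rwa [e.injective (Subtype.ext hji)] at hj
    · exact fun hi => ⟨i, hi, rfl⟩
  choose b hb hbQ using hex
  exact ⟨fun i => ω (e i), b, fun i Q => ⟨hb Q, hωB _ (hb Q) _, hbQ Q i⟩⟩

end RandomSamples

section AlmostPeriods

/-- Some scale among `s, 4 s, …, 4 ^ I s` at which the sublevel sets grow slowly. -/
lemma exists_slow_scale {T : Type*} [Fintype T] {N : T → ℕ} {K R : ℝ} {I : ℕ}
    (hI : 0 < I) (hK : 1 ≤ K) (hR : R ≤ K ^ I) {s : ℝ}
    (hs : 0 < s) (hcov : (Fintype.card T : ℝ) ≤ R * #{b : T | (N b : ℝ) ≤ s}) :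
    ∃ s', s ≤ s' ∧ s' ≤ 4 ^ I * s ∧
      (#{b : T | (N b : ℝ) ≤ 4 * s'} : ℝ) ≤ K * #{b : T | (N b : ℝ) ≤ s'} := by
  by_contra! hcon
  have hpow : ∀ i ≤ I, 0 < i → K ^ i * #{b : T | (N b : ℝ) ≤ s} <
      #{b : T | (N b : ℝ) ≤ 4 ^ i * s} := by
    intro i
    induction i with
    | zero => intro _ h; omega
    | succ i ih =>
      intro hi _
      have h1 := hcon (4 ^ i * s) (le_mul_of_one_le_left hs.le (one_le_pow₀ (by norm_num)))
        (mul_le_mul_of_nonneg_right (pow_le_pow_right₀ (by norm_num) (by omega)) hs.le)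
      rw [← mul_assoc, ← pow_succ'] at h1
      refine lt_of_le_of_lt ?_ h1
      rw [pow_succ', mul_assoc]
      refine mul_le_mul_of_nonneg_left ?_ (by linarith)
      rcases Nat.eq_zero_or_pos i with rfl | hi0
      · simp
      · exact (ih (by omega) hi0).le
  have h1 := hpow I le_rfl hI
  have h3 : (#{b : T | (N b : ℝ) ≤ 4 ^ I * s} : ℝ) ≤ Fintype.card T := by
    exact_mod_cast card_le_univ _
  have h4 := mul_le_mul_of_nonneg_right hR
    (Nat.cast_nonneg (α := ℝ) #{b : T | (N b : ℝ) ≤ s})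
  linarith

variable {p : ℕ} [Fact p.Prime] {T : Type*} [AddCommGroup T] [Module (ZMod p) T] {N : T → ℕ}

/-- A maximal separated subset. -/
lemma exists_maximal_separated (hneg : ∀ b, N (-b) = N b) (h0 : N 0 = 0) (U : Finset T) {s : ℝ}
    (hs : 0 ≤ s) :
    ∃ P ⊆ U, (∀ b ∈ P, ∀ b' ∈ P, b ≠ b' → s < N (b - b')) ∧
      ∀ u ∈ U, ∃ b ∈ P, (N (u - b) : ℝ) ≤ s := by
  obtain ⟨P, hP, hmax⟩ := exists_max_image
    (U.powerset.filter fun P => ∀ b ∈ P, ∀ b' ∈ P, b ≠ b' → s < N (b - b')) card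
    ⟨∅, by simp⟩
  simp only [mem_filter, mem_powerset] at hP hmax
  refine ⟨P, hP.1, hP.2, fun u hu => ?_⟩
  by_contra! hcon
  have huP : u ∉ P := fun h => by
    have := hcon u h
    rw [sub_self, h0] at this
    simp only [Nat.cast_zero] at this
    linarith
  have := hmax (insert u P) ⟨insert_subset hu hP.1, ?_⟩
  · rw [card_insert_of_notMem huP] at this
    omega
  · intro b hb b' hb' hne
    rcases mem_insert.1 hb with hbu | hbP <;> rcases mem_insert.1 hb' with hbu' | hbP'
    · exact absurd (hbu.trans hbu'.symm) hne
    · rw [hbu]; exact hcon _ hbP'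
    · rw [hbu', ← hneg, neg_sub]; exact hcon _ hbP
    · exact hP.2 _ hbP _ hbP' hne

lemma apply_nsmul_le (hadd : ∀ b b', N (b + b') ≤ N b + N b') (h0 : N 0 = 0) (j : ℕ) (b : T) :
    N (j • b) ≤ j * N b := by
  induction j with
  | zero => simp [h0]
  | succ j ih => rw [succ_nsmul, add_mul, one_mul]; exact (hadd _ _).trans (by omega)

lemma apply_smul_le (hadd : ∀ b b', N (b + b') ≤ N b + N b') (h0 : N 0 = 0) (c : ZMod p) (b : T) :
    N (c • b) ≤ p * N b := by
  have : NeZero p := ⟨(Fact.out : p.Prime).ne_zero⟩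
  have h : c • b = c.val • b := by
    rw [← Nat.cast_smul_eq_nsmul (ZMod p), ZMod.natCast_zmod_val]
  rw [h]
  exact (apply_nsmul_le hadd h0 _ b).trans (Nat.mul_le_mul_right _ (ZMod.val_lt c).le)

lemma apply_mem_span_le (hadd : ∀ b b', N (b + b') ≤ N b + N b') (h0 : N 0 = 0) (F : Finset T)
    {s : ℝ} (hF : ∀ f ∈ F, (N f : ℝ) ≤ s) {v : T} (hv : v ∈ Submodule.span (ZMod p) (F : Set T)) :
    (N v : ℝ) ≤ p * #F * s := by
  obtain ⟨c, -, rfl⟩ := Submodule.mem_span_finset.1 hv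
  have h : ∀ G : Finset T, N (∑ f ∈ G, c f • f) ≤ ∑ f ∈ G, p * N f := by
    intro G
    induction G using Finset.induction_on with
    | empty => simp [h0]
    | insert a G ha ih =>
      rw [sum_insert ha, sum_insert ha]
      exact (hadd _ _).trans (add_le_add (apply_smul_le hadd h0 _ _) ih)
  have h1 : (N (∑ f ∈ F, c f • f) : ℝ) ≤ ∑ f ∈ F, (p : ℝ) * N f := by exact_mod_cast h F
  refine h1.trans ((sum_le_sum fun f hf => mul_le_mul_of_nonneg_left (hF f hf)
    (Nat.cast_nonneg p)).trans (le_of_eq ?_))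
  rw [sum_const, nsmul_eq_mul]
  ring

variable [Fintype T]

/-- If separated sets are small, then there is a large subspace on which `N` is small. -/
theorem exists_submodule_apply_le (hadd : ∀ b b', N (b + b') ≤ N b + N b')
    (hneg : ∀ b, N (-b) = N b) (h0 : N 0 = 0) {s K : ℝ} {R I : ℕ} (hs : 0 < s)
    (hsep : ∀ P : Finset T, (∀ b ∈ P, ∀ b' ∈ P, b ≠ b' → s < N (b - b')) → #P ≤ R)
    (hI : 0 < I) (hK : 1 ≤ K) (hR : R ≤ K ^ I) :
    ∃ H : Submodule (ZMod p) T, Nat.card T ≤ R * Nat.card H ∧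
      ∀ h ∈ H, (N h : ℝ) ≤ 5 * p * K * (4 ^ I * s) := by
  have hp : (1 : ℝ) ≤ p := by exact_mod_cast (Fact.out : p.Prime).pos
  have hcov : Fintype.card T ≤ R * #{b : T | (N b : ℝ) ≤ s} := by
    obtain ⟨P, -, hP, hmax⟩ := exists_maximal_separated hneg h0 (univ : Finset T) hs.le
    have hsub : (univ : Finset T) ⊆ P.biUnion fun b =>
        ({b : T | (N b : ℝ) ≤ s} : Finset T).image fun x => x + b := by
      intro u _
      obtain ⟨b, hb, hu⟩ := hmax u (mem_univ u)
      exact mem_biUnion.2 ⟨b, hb, mem_image.2 ⟨u - b, by simpa using hu, sub_add_cancel u b⟩⟩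
    rw [← card_univ]
    refine (card_le_card hsub).trans (card_biUnion_le.trans ?_)
    refine (sum_le_sum fun b _ => card_image_le).trans ?_
    rw [sum_const, smul_eq_mul]
    exact Nat.mul_le_mul_right _ (hsep P hP)
  obtain ⟨s', hs', hs'I, hslow⟩ := exists_slow_scale hI hK hR hs (by exact_mod_cast hcov)
  have hs'0 : 0 < s' := hs.trans_le hs'
  obtain ⟨F, hFU, hFsep, hFcov⟩ := exists_maximal_separated hneg h0
    ({b : T | (N b : ℝ) ≤ 3 * s'} : Finset T) (s := 2 * s') (by positivity)
  have hadd' : ∀ b b', (N (b + b') : ℝ) ≤ N b + N b' := fun b b' => by exact_mod_cast hadd b b'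
  have hW0 : (0 : T) ∈ ({b : T | (N b : ℝ) ≤ s'} : Finset T) := by
    simp [h0, hs'0.le]
  have hFK : (#F : ℝ) ≤ K := by
    have hdisj : (F : Set T).PairwiseDisjoint fun f =>
        ({b : T | (N b : ℝ) ≤ s'} : Finset T).image fun x => f + x := by
      intro f hf g hg hne
      refine disjoint_left.2 fun x hx hy => ?_
      obtain ⟨w, hw, rfl⟩ := mem_image.1 hx
      obtain ⟨w', hw', hww⟩ := mem_image.1 hy
      have h1 := hFsep f hf g hg hne
      rw [show f - g = w' + -w by
        rw [← sub_eq_add_neg, sub_eq_sub_iff_add_eq_add, ← hww, add_comm]] at h1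
      have h3 := hadd' w' (-w)
      rw [hneg] at h3
      have h4 := (mem_filter.1 hw).2
      have h5 := (mem_filter.1 hw').2
      linarith
    have hsub : (F.biUnion fun f =>
        ({b : T | (N b : ℝ) ≤ s'} : Finset T).image fun x => f + x) ⊆
        ({b : T | (N b : ℝ) ≤ 4 * s'} : Finset T) := by
      intro x hx
      obtain ⟨f, hf, hx⟩ := mem_biUnion.1 hx
      obtain ⟨w, hw, rfl⟩ := mem_image.1 hx
      have h4 := (mem_filter.1 hw).2
      have h5 := (mem_filter.1 (hFU hf)).2
      have h6 := hadd' f w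
      exact mem_filter.2 ⟨mem_univ _, by linarith⟩
    have h1 := card_le_card hsub
    rw [card_biUnion hdisj, sum_congr rfl fun f _ =>
      card_image_of_injective _ (add_right_injective f), sum_const, smul_eq_mul] at h1
    have h3 : (#F : ℝ) * #{b : T | (N b : ℝ) ≤ s'} ≤ K * #{b : T | (N b : ℝ) ≤ s'} :=
      le_trans (by exact_mod_cast h1) hslow
    exact le_of_mul_le_mul_right h3 (by exact_mod_cast card_pos.2 ⟨0, hW0⟩)
  refine ⟨Submodule.span (ZMod p) {b : T | (N b : ℝ) ≤ s'}, ?_, fun v hv => ?_⟩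
  · rw [Nat.card_eq_fintype_card]
    refine hcov.trans (Nat.mul_le_mul_left _ ?_)
    rw [Nat.card_eq_fintype_card, ← Fintype.card_coe]
    refine Fintype.card_le_of_injective (fun x => ⟨x.1, Submodule.subset_span ?_⟩) ?_
    · exact (mem_filter.1 x.2).2.trans hs'
    · intro x y hxy
      exact Subtype.ext (by simpa using hxy)
  · obtain ⟨f, hf, x, hx, rfl⟩ := exists_add_of_mem_span (W := {b : T | (N b : ℝ) ≤ s'})
      (X := {b : T | (N b : ℝ) ≤ 2 * s'}) (F := (F : Set T))
      (by simp [h0, hs'0.le]) (fun w hw x hx => by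
        have h1 : (N w : ℝ) ≤ s' := hw
        have h3 : (N x : ℝ) ≤ 2 * s' := hx
        have h4 := hadd' w x
        obtain ⟨f, hf, hfw⟩ := hFcov (w + x) (mem_filter.2 ⟨mem_univ _, by linarith⟩)
        exact ⟨f, hf, w + x - f, hfw, (add_sub_cancel f (w + x)).symm⟩) hv
    have h1 := apply_mem_span_le hadd h0 F (s := 3 * s')
      (fun f hf => (mem_filter.1 (hFU hf)).2) hf
    have h3 : (N x : ℝ) ≤ 2 * s' := hx
    have h4 := hadd' f x
    have h5 : (p : ℝ) * #F * (3 * s') ≤ p * K * (3 * s') :=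
      mul_le_mul_of_nonneg_right (mul_le_mul_of_nonneg_left hFK (by positivity)) (by positivity)
    have h6 : 1 ≤ (p : ℝ) * K := one_le_mul_of_one_le_of_one_le hp hK
    have h7 : s' ≤ p * K * s' := le_mul_of_one_le_left hs'0.le h6
    have h8 : 5 * (p : ℝ) * K * s' ≤ 5 * p * K * (4 ^ I * s) :=
      mul_le_mul_of_nonneg_left hs'I (by positivity)
    linarith

end AlmostPeriods

section Shifts

variable {X T : Type*} [Fintype X] [Fintype T] [AddCommGroup T]

/-- How many points distinguish `S` from its translate by `b` in the second coordinate. -/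
noncomputable def shiftDist (S : Set (X × T)) (b : T) : ℕ :=
  #{ω : X × T | ¬((ω.1, ω.2 + b) ∈ S ↔ ω ∈ S)}

lemma card_shift_ne (S : Set (X × T)) (b b' : T) :
    #{ω : X × T | ¬((ω.1, ω.2 + b) ∈ S ↔ (ω.1, ω.2 + b') ∈ S)} = shiftDist S (b - b') := by
  refine card_equiv (Equiv.prodCongr (Equiv.refl X) (Equiv.addRight b')) fun ω => ?_
  simp only [mem_filter, mem_univ, true_and, Equiv.prodCongr_apply, Prod.map_fst, Prod.map_snd,
    Equiv.coe_refl, id, Equiv.coe_addRight, add_assoc, add_sub_cancel]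
  rfl

lemma shiftDist_zero (S : Set (X × T)) : shiftDist S 0 = 0 := by
  simp [shiftDist]

lemma shiftDist_neg (S : Set (X × T)) (b : T) : shiftDist S (-b) = shiftDist S b := by
  rw [← zero_sub, ← card_shift_ne, shiftDist]
  congr 1
  ext ω
  simp only [mem_filter, mem_univ, true_and, add_zero]
  tauto

lemma shiftDist_add_le (S : Set (X × T)) (b b' : T) :
    shiftDist S (b + b') ≤ shiftDist S b + shiftDist S b' := by
  have h : shiftDist S b =
      #{ω : X × T | ¬((ω.1, ω.2 + (b + b')) ∈ S ↔ (ω.1, ω.2 + b') ∈ S)} := by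
    rw [card_shift_ne, add_sub_cancel_right]
  rw [h]
  refine le_trans (card_le_card fun ω hω => ?_) (card_union_le _ _)
  simp only [mem_union, mem_filter, mem_univ, true_and] at hω ⊢
  tauto

/-- A set which is almost invariant under a kernel is close to a preimage. -/
lemma exists_card_ne_le {Y : Type*} (S : Set (X × T)) (H : AddSubgroup T) (π : T → Y)
    (r : Y → T) (hr : ∀ x, x - r (π x) ∈ H) {s : ℝ} (hs : ∀ h ∈ H, (shiftDist S h : ℝ) ≤ s) :
    ∃ h : T, (#{ω : X × T | ¬(ω ∈ S ↔ (ω.1, r (π ω.2) + h) ∈ S)} : ℝ) ≤ s := by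
  have hsum : ∑ h : H, #{ω : X × T | ¬(ω ∈ S ↔ (ω.1, r (π ω.2) + h) ∈ S)} =
      ∑ h : H, shiftDist S h := by
    simp only [shiftDist, card_filter]
    rw [sum_comm, sum_comm (s := (univ : Finset H))]
    refine sum_congr rfl fun ω _ => ?_
    refine Fintype.sum_equiv (Equiv.subRight ⟨_, hr ω.2⟩) _ _ fun h => ?_
    have h1 : (((Equiv.subRight (⟨ω.2 - r (π ω.2), hr ω.2⟩ : H)) h : H) : T) =
        h - (ω.2 - r (π ω.2)) := rfl
    rw [h1, show ω.2 + ((h : T) - (ω.2 - r (π ω.2))) = r (π ω.2) + h by abel]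
    refine if_congr ?_ rfl rfl
    rw [iff_comm (a := ω ∈ S)]
  obtain ⟨h, -, hh⟩ := exists_le_of_sum_le (s := (univ : Finset H)) ⟨0, mem_univ _⟩ hsum.le
  exact ⟨h, (Nat.cast_le.2 hh).trans (hs h h.2)⟩

end Shifts

section Reduction

variable {p n ℓ q : ℕ} [Fact p.Prime]

/-- Replace the quadratic part of a factor by its image under a surjective linear map. -/
lemma exists_map_factor (B : QuadFactor p n ℓ q) {q' τ : ℕ} (hτ : 0 < τ)
    (hB : ∀ c : Fin q → ZMod p, c ≠ 0 → τ ≤ (∑ j, c j • B.Q j).rank)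
    (π : (Fin q → ZMod p) →ₗ[ZMod p] (Fin q' → ZMod p)) (hπ : Function.Surjective π) :
    ∃ B' : QuadFactor p n ℓ q',
      (∀ c : Fin q' → ZMod p, c ≠ 0 → τ ≤ (∑ j, c j • B'.Q j).rank) ∧
      ∀ x, B'.betaB x = ((B.betaB x).1, π (B.betaB x).2) := by
  set Q' : Fin q' → Matrix (Fin n) (Fin n) (ZMod p) :=
    fun i => ∑ j, π (Pi.single j 1) i • B.Q j with hQ'
  have hπ_apply : ∀ y i, π y i = ∑ j, π (Pi.single j 1) i * y j := by
    intro y i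
    conv_lhs => rw [pi_eq_sum_univ' y]
    rw [map_sum, Finset.sum_apply]
    refine sum_congr rfl fun j _ => ?_
    rw [map_smul, Pi.smul_apply, smul_eq_mul, mul_comm]
  have hcomb : ∀ c : Fin q' → ZMod p, ∑ i, c i • Q' i =
      ∑ j, (c ⬝ᵥ π (Pi.single j 1)) • B.Q j := by
    intro c
    simp only [hQ', smul_sum, smul_smul, dotProduct, sum_smul]
    exact sum_comm
  have hrank : ∀ c : Fin q' → ZMod p, c ≠ 0 → τ ≤ (∑ j, c j • Q' j).rank := by
    intro c hc
    rw [hcomb]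
    refine hB _ fun h => hc ?_
    ext i
    obtain ⟨y, hy⟩ := hπ (Pi.single i 1)
    have h1 : c ⬝ᵥ π y = 0 := by
      have : c ⬝ᵥ π y = ∑ j, (c ⬝ᵥ π (Pi.single j 1)) * y j := by
        simp only [dotProduct, hπ_apply y, mul_sum, sum_mul]
        rw [sum_comm]
        exact sum_congr rfl fun _ _ => sum_congr rfl fun _ _ => by ring
      rw [this]
      exact sum_eq_zero fun j _ => by rw [congrFun h j, Pi.zero_apply, zero_mul]
    rw [hy] at h1
    simpa using h1
  refine ⟨⟨B.L, Q', B.linIndep, fun i => ?_, fun i j hij => ?_⟩, hrank, fun x => ?_⟩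
  · simp only [hQ', Matrix.IsSymm, Matrix.transpose_sum, Matrix.transpose_smul]
    exact sum_congr rfl fun j _ => by rw [B.symm j]
  · by_contra hne
    have h1 := hrank (Pi.single i 1 - Pi.single j 1) fun h => by
      have := congrFun h i
      simp [hne] at this
    have h3 : ∑ k, (Pi.single i 1 - Pi.single j 1 : Fin q' → ZMod p) k • Q' k = 0 := by
      simp only [Pi.sub_apply, sub_smul, sum_sub_distrib, Pi.single_apply, ite_smul, one_smul,
        zero_smul, sum_ite_eq', mem_univ, if_true]
      rw [hij, sub_self]
    rw [h3, Matrix.rank_zero] at h1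
    omega
  · refine Prod.ext rfl ?_
    ext i
    change x ⬝ᵥ (Q' i) *ᵥ x = π (B.betaQ x x) i
    rw [hπ_apply]
    simp only [hQ', Matrix.sum_mulVec, dotProduct_sum, Matrix.smul_mulVec, dotProduct_smul,
      smul_eq_mul]
    rfl

lemma card_union_fibres_le (B : QuadFactor p n ℓ q) {E : Set (Label p ℓ q)} {a : ℕ}
    (h : ∀ ab, #{x | B.betaB x = ab} * p ^ (ℓ + q) ≤ a) :
    #{x | B.betaB x ∈ E} * p ^ (ℓ + q) ≤ #{ab | ab ∈ E} * a := by
  have h1 : #{x | B.betaB x ∈ E} = ∑ ab with ab ∈ E, #{x | B.betaB x = ab} := by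
    rw [card_eq_sum_card_fiberwise (f := B.betaB) (t := ({ab | ab ∈ E} : Finset (Label p ℓ q)))
      fun x hx => by simpa using hx]
    refine sum_congr rfl fun ab hab => ?_
    congr 1
    ext x
    simp only [mem_filter, mem_univ, true_and] at hab ⊢
    refine ⟨fun h => h.2, fun h => ⟨?_, h⟩⟩
    rw [h]; exact hab
  rw [h1, sum_mul, ← smul_eq_mul (#_) a]
  exact sum_le_card_nsmul _ _ _ fun ab _ => h ab

/-- Few atoms meet the error set in a large proportion. -/
lemma card_bad_labels_le (B : QuadFactor p n ℓ q) (D : Set (Vec p n)) {s : ℕ} {δ : ℝ}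
    (hD : (#{x | x ∈ D} : ℝ) ≤ δ * Fintype.card (Vec p n)) :
    (#{ab : Label p ℓ q | Fintype.card (Vec p n) <
      s * (#{x | x ∈ D ∧ B.betaB x = ab} * p ^ (ℓ + q))} : ℝ) ≤
      s * δ * Fintype.card (Label p ℓ q) := by
  set Bad : Finset (Label p ℓ q) := {ab : Label p ℓ q | Fintype.card (Vec p n) <
      s * (#{x | x ∈ D ∧ B.betaB x = ab} * p ^ (ℓ + q))} with hBad
  have hcard : Fintype.card (Label p ℓ q) = p ^ (ℓ + q) := by
    simp [Label, pow_add, ZMod.card]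
  have h1 : #Bad * Fintype.card (Vec p n) ≤ s * (#{x | x ∈ D} * p ^ (ℓ + q)) := by
    have h3 : #{x | x ∈ D} = ∑ ab, #{x | x ∈ D ∧ B.betaB x = ab} := by
      rw [card_eq_sum_card_fiberwise (f := B.betaB) (t := (univ : Finset (Label p ℓ q)))
        fun x _ => by simp]
      exact sum_congr rfl fun ab _ => by rw [filter_filter]
    rw [h3, sum_mul, mul_sum]
    refine le_trans ?_ (sum_le_sum_of_subset (subset_univ Bad))
    rw [← smul_eq_mul]
    refine card_nsmul_le_sum _ _ _ fun ab hab => ?_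
    exact (mem_filter.1 hab).2.le
  have hN : (0 : ℝ) < Fintype.card (Vec p n) := by exact_mod_cast Fintype.card_pos
  refine le_of_mul_le_mul_right ?_ hN
  have h4 : (#Bad : ℝ) * Fintype.card (Vec p n) ≤ s * (#{x | x ∈ D} * (p : ℝ) ^ (ℓ + q)) := by
    exact_mod_cast h1
  refine h4.trans ?_
  rw [hcard, Nat.cast_pow, mul_assoc, mul_assoc]
  refine mul_le_mul_of_nonneg_left ?_ (Nat.cast_nonneg _)
  have := mul_le_mul_of_nonneg_right hD (pow_nonneg (Nat.cast_nonneg (α := ℝ) p) (ℓ + q))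
  linarith

lemma exists_linear_quotient (H : Submodule (ZMod p) (Fin q → ZMod p)) :
    ∃ (q' : ℕ) (π : (Fin q → ZMod p) →ₗ[ZMod p] (Fin q' → ZMod p)), q' ≤ q ∧
      p ^ q' * Nat.card H = p ^ q ∧ Function.Surjective π ∧ ∀ x, π x = 0 → x ∈ H := by
  have e : ((Fin q → ZMod p) ⧸ H) ≃ₗ[ZMod p]
      (Fin (Module.finrank (ZMod p) ((Fin q → ZMod p) ⧸ H)) → ZMod p) :=
    LinearEquiv.ofFinrankEq _ _ (by simp)
  refine ⟨_, e.toLinearMap ∘ₗ H.mkQ, ?_, ?_, ?_, fun x hx => ?_⟩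
  · have := Submodule.finrank_quotient_le H
    simpa using this
  · have h := Submodule.finrank_quotient_add_finrank H
    rw [Module.finrank_fin_fun] at h
    rw [Nat.card_eq_fintype_card, Module.card_eq_pow_finrank (K := ZMod p) (V := H), ZMod.card,
      ← pow_add, h]
  · exact e.surjective.comp H.mkQ_surjective
  · simpa using hx

/-- A set of bounded `VC₂`-dimension which is close to a union of atoms of a high rank factor is
close to a union of atoms of a factor with few quadratic parts. -/
theorem exists_reduced_factor (h2 : (2 : ZMod p) ≠ 0) (B : QuadFactor p n ℓ q) {k t τ M I : ℕ}
    (hτ : 0 < τ) (htτ : 2 * t ≤ τ) (htq : ℓ + q ≤ t) (ht : patternRank p (k + 1) ℓ q ≤ p ^ t)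
    (hB : ∀ c : Fin q → ZMod p, c ≠ 0 → τ ≤ (∑ j, c j • B.Q j).rank)
    {A : Set (Vec p n)} (hA : ¬HasVC2Dim A (k + 1)) {S : Set (Label p ℓ q)} {δ δ₁ K : ℝ}
    (hD : (#{x | x ∈ A ∆ {x | B.betaB x ∈ S}} : ℝ) ≤ δ * Fintype.card (Vec p n))
    (hδ₁ : 0 < δ₁) (hδ₁' : δ₁ ≤ 1)
    (hM : (((M + 1) ^ k + 1 : ℕ) : ℝ) ^ 2 * (1 - δ₁) ^ M +
      M * ((M + 1) ^ k + 1 : ℕ) * ((4 * patternSize (k + 1) : ℕ) * δ) < 1)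
    (hI : 0 < I) (hK : 1 ≤ K) (hKI : (((M + 1) ^ k : ℕ) : ℝ) ≤ K ^ I) :
    ∃ (q' : ℕ) (B' : QuadFactor p n ℓ q') (S' : Set (Label p ℓ q')), q' ≤ q ∧
      p ^ q' ≤ (M + 1) ^ k ∧ (∀ c : Fin q' → ZMod p, c ≠ 0 → τ ≤ (∑ j, c j • B'.Q j).rank) ∧
      (#{x | ¬(B.betaB x ∈ S ↔ B'.betaB x ∈ S')} : ℝ) ≤
        10 * p * K * 4 ^ I * δ₁ * Fintype.card (Vec p n) := by
  set R := (M + 1) ^ k with hR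
  have hp : 0 < p := (Fact.out : p.Prime).pos
  set Ω : ℝ := (Fintype.card (Label p ℓ q) : ℝ) with hΩ
  have hcard : Fintype.card (Label p ℓ q) = p ^ (ℓ + q) := by
    simp [Label, pow_add, ZMod.card]
  have hΩ0 : 0 < Ω := by rw [hΩ]; exact_mod_cast Fintype.card_pos
  set D := A ∆ {x | B.betaB x ∈ S} with hDdef
  have hbad := card_bad_labels_le B D (s := 4 * patternSize (k + 1)) hD
  set Bad : Finset (Label p ℓ q) := {ab : Label p ℓ q | Fintype.card (Vec p n) <
      4 * patternSize (k + 1) * (#{x | x ∈ D ∧ B.betaB x = ab} * p ^ (ℓ + q))} with hBad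
  have hsep : ∀ P : Finset (Fin q → ZMod p),
      (∀ b ∈ P, ∀ b' ∈ P, b ≠ b' → δ₁ * Ω < shiftDist S (b - b')) → #P ≤ R := by
    intro P hP
    by_contra! hPR
    obtain ⟨P', hP', hP'R⟩ := exists_subset_card_eq (Nat.succ_le_of_lt hPR)
    obtain ⟨ω, b, hω⟩ := exists_shattered_of_separated (Ω := Label p ℓ q) (k := k) (M := M) P'
      (fun b => {ω | (ω.1, ω.2 + b) ∈ S}) (fun b => {ω | (ω.1, ω.2 + b) ∈ Bad})
      (δ := δ₁) (β := (4 * patternSize (k + 1) : ℕ) * δ) hδ₁'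
      (fun b hb b' hb' hne => by
        have h1 := (hP b (hP' hb) b' (hP' hb') hne).le
        rw [← card_shift_ne] at h1
        refine h1.trans (le_of_eq ?_)
        congr 1)
      (fun b _ => by
        refine le_trans (le_of_eq ?_) hbad
        norm_cast
        refine card_equiv (Equiv.prodCongr (Equiv.refl _) (Equiv.addRight b)) fun ω => ?_
        simp only [mem_filter, mem_univ, true_and]
        rfl)
      (by rw [hP'R]; exact hM) (by rw [hP'R]; exact Nat.lt_succ_self _)
    refine hA (hasVC2Dim_of_labels h2 B (Nat.succ_pos k) (fun c hc => htτ.trans (hB c hc)) ht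
      (S := S) (fun i => (ω i).1) (fun i => (ω i).2) b (fun i Q => (hω i Q).2.2) fun i Q => ?_)
    have h1 := (hω i Q).2.1
    by_contra hlt
    refine h1 (mem_filter.2 ⟨mem_univ _, ?_⟩)
    push Not at hlt
    exact hlt
  obtain ⟨H, hH, hHs⟩ := exists_submodule_apply_le (p := p) (shiftDist_add_le S)
    (shiftDist_neg S) (shiftDist_zero S) (mul_pos hδ₁ hΩ0) hsep hI hK hKI
  obtain ⟨q', π, hq', hcardH, hπ, hker⟩ := exists_linear_quotient H
  obtain ⟨B', hB', hB'β⟩ := exists_map_factor B hτ hB π hπ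
  obtain ⟨r, hr⟩ := hπ.hasRightInverse
  obtain ⟨h, hh⟩ := exists_card_ne_le S H.toAddSubgroup π r
    (fun x => hker _ (by rw [map_sub, hr, sub_self])) hHs
  refine ⟨q', B', {ab | (ab.1, r ab.2 + h) ∈ S}, hq', ?_, hB', ?_⟩
  · rw [Nat.card_eq_fintype_card, Fintype.card_fun, ZMod.card, Fintype.card_fin, ← hcardH] at hH
    exact Nat.le_of_mul_le_mul_right hH Nat.card_pos
  · obtain ⟨E, hE⟩ : ∃ E : Set (Label p ℓ q), ∀ ω, ω ∈ E ↔
        ¬(ω ∈ S ↔ (ω.1, r (π ω.2) + h) ∈ S) :=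
      ⟨{ω | ¬(ω ∈ S ↔ (ω.1, r (π ω.2) + h) ∈ S)}, fun _ => Iff.rfl⟩
    have h1 := card_union_fibres_le B (E := E)
      (card_atom_le h2 B (fun c hc => htτ.trans (hB c hc)) htq)
    rw [filter_congr fun x _ => hE x, filter_congr fun x _ => hE (B.betaB x), ← hcard] at h1
    have h3 : (#{x | ¬(B.betaB x ∈ S ↔ ((B.betaB x).1, r (π (B.betaB x).2) + h) ∈ S)} : ℝ) * Ω ≤
        #{ω : Label p ℓ q | ¬(ω ∈ S ↔ (ω.1, r (π ω.2) + h) ∈ S)} *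
          (2 * Fintype.card (Vec p n)) := by
      rw [hΩ]; exact_mod_cast h1
    have h4 := h3.trans (mul_le_mul_of_nonneg_right hh (by positivity))
    refine le_of_mul_le_mul_right ?_ hΩ0
    refine le_trans (le_of_eq ?_) (h4.trans (le_of_eq (by ring)))
    congr 3
    ext x
    simp only [mem_filter, mem_univ, true_and, Set.mem_ofPred_eq, hB'β]

end Reduction

section Parameters

open Filter Topology

lemma one_sub_pow_le_exp {δ : ℝ} (hδ : δ ≤ 1) (M : ℕ) : (1 - δ) ^ M ≤ Real.exp (-(M * δ)) := by
  rw [← mul_neg, Real.exp_nat_mul]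
  exact pow_le_pow_left₀ (by linarith) (Real.one_sub_le_exp_neg δ) M

lemma eventually_le_rpow {θ : ℝ} (hθ : 0 < θ) (C : ℝ) : ∀ᶠ x : ℝ in atTop, C ≤ x ^ θ :=
  (tendsto_rpow_atTop hθ).eventually_ge_atTop C

lemma eventually_rpow_mul_exp_lt {θ : ℝ} (hθ : 0 < θ) (s : ℝ) {ε : ℝ} (hε : 0 < ε) :
    ∀ᶠ x : ℝ in atTop, x ^ s * Real.exp (-x ^ θ) < ε := by
  have h := (tendsto_rpow_mul_exp_neg_mul_atTop_nhds_zero (s / θ) 1 one_pos).comp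
    (tendsto_rpow_atTop hθ)
  filter_upwards [h.eventually (gt_mem_nhds hε), eventually_ge_atTop 0] with x hx hx0
  simp only [Function.comp_apply] at hx
  rwa [← Real.rpow_mul hx0, mul_div_cancel₀ _ hθ.ne', neg_mul, one_mul] at hx

/-- The parameters of the reduction of the number of quadratic parts, in terms of `x = 1 / δ`. -/
lemma exists_reduction_parameters (p s : ℕ) {k : ℕ} (hk : 1 ≤ k) {η : ℝ} (hη : 0 < η) :
    ∃ (e : ℕ) (K : ℝ), 1 ≤ K ∧ ∀ᶠ x : ℝ in atTop, ∃ (M I : ℕ) (δ₁ : ℝ), 0 < δ₁ ∧ δ₁ ≤ 1 ∧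
      0 < I ∧ (((M + 1) ^ k : ℕ) : ℝ) ≤ K ^ I ∧ (((M + 1) ^ k : ℕ) : ℝ) ≤ x ^ (k + η) ∧
      (((M + 1) ^ k + 1 : ℕ) : ℝ) ^ 2 * (1 - δ₁) ^ M +
        M * ((M + 1) ^ k + 1 : ℕ) * ((s : ℝ) * x⁻¹ ^ e) < 1 ∧
      10 * p * K * 4 ^ I * δ₁ ≤ x⁻¹ / 2 ∧ x⁻¹ ^ e ≤ x⁻¹ / 2 := by
  have hk0 : (0 : ℝ) < k := by exact_mod_cast hk
  obtain ⟨θ, hθ0, hθ1, hθη⟩ : ∃ θ : ℝ, 0 < θ ∧ θ ≤ 1 ∧ 4 * θ * k ≤ η := by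
    refine ⟨min 1 (η / (4 * k)), lt_min one_pos (by positivity), min_le_left _ _, ?_⟩
    have h := mul_le_mul_of_nonneg_right (min_le_right 1 (η / (4 * k)))
      (by positivity : (0 : ℝ) ≤ 4 * k)
    rw [div_mul_cancel₀ _ (by positivity)] at h
    linarith
  obtain ⟨a, ha⟩ := exists_nat_ge (4 * (k + η) / θ)
  obtain ⟨e, he⟩ := exists_nat_ge (k + η + 7)
  rw [div_le_iff₀ hθ0] at ha
  refine ⟨e, 4 ^ a, one_le_pow₀ (by norm_num), ?_⟩
  filter_upwards [eventually_ge_atTop 2, eventually_le_rpow hθ0 3,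
    eventually_rpow_mul_exp_lt (θ := 2 * θ) (by positivity) (2 * (k + η))
      (ε := 1 / 8) (by norm_num),
    eventually_gt_atTop (4 * s : ℝ),
    eventually_le_rpow (θ := 3 * θ / 4) (by positivity) (80 * p * 4 ^ a)] with x hx2 hx3 hxe hxs hxp
  have hx1 : 1 ≤ x := by linarith
  have hx0 : 0 < x := by linarith
  set y := x ^ (k + η) with hy
  have hy1 : 1 ≤ y := Real.one_le_rpow hx1 (by positivity)
  have hMlow : x ^ (1 + 3 * θ) ≤ (⌈x ^ (1 + 3 * θ)⌉₊ : ℝ) := Nat.le_ceil _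
  have hMup : (⌈x ^ (1 + 3 * θ)⌉₊ : ℝ) < x ^ (1 + 3 * θ) + 1 :=
    Nat.ceil_lt_add_one (by positivity)
  set M := ⌈x ^ (1 + 3 * θ)⌉₊ with hM
  have hM4 : (M : ℝ) + 1 ≤ x ^ (1 + 4 * θ) := by
    have h1 : x ^ (1 + 4 * θ) = x ^ (1 + 3 * θ) * x ^ θ := by
      rw [← Real.rpow_add hx0]; congr 1; ring
    have h3 : 1 ≤ x ^ (1 + 3 * θ) := Real.one_le_rpow hx1 (by positivity)
    rw [h1]
    nlinarith
  have hMk : (((M + 1) ^ k : ℕ) : ℝ) ≤ y := by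
    push_cast
    refine (pow_le_pow_left₀ (by positivity) hM4 k).trans ?_
    rw [← Real.rpow_natCast, ← Real.rpow_mul hx0.le]
    refine Real.rpow_le_rpow_of_exponent_le hx1 ?_
    linarith
  have hδ1 : x ^ (-(1 + θ)) ≤ 1 := Real.rpow_le_one_of_one_le_of_nonpos hx1 (by linarith)
  have hxe' : x⁻¹ ^ e ≤ x ^ (-(k + η + 7)) := by
    rw [inv_pow, ← Real.rpow_natCast, ← Real.rpow_neg hx0.le]
    exact Real.rpow_le_rpow_of_exponent_le hx1 (by linarith)
  have hlog : 0 ≤ Real.logb 4 x := Real.logb_nonneg (by norm_num) hx1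
  set I := ⌊θ / 4 * Real.logb 4 x⌋₊ + 1 with hI
  have hIlow : θ / 4 * Real.logb 4 x ≤ I := by
    rw [hI]; push_cast; exact (Nat.lt_floor_add_one _).le
  have hIup : (I : ℝ) ≤ θ / 4 * Real.logb 4 x + 1 := by
    rw [hI]; push_cast
    have := Nat.floor_le (by positivity : 0 ≤ θ / 4 * Real.logb 4 x)
    linarith
  have hx4 : ∀ c : ℝ, (4 : ℝ) ^ (c * Real.logb 4 x) = x ^ c := by
    intro c
    rw [mul_comm, Real.rpow_mul (by norm_num), Real.rpow_logb (by norm_num) (by norm_num) hx0]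
  refine ⟨M, I, x ^ (-(1 + θ)), by positivity, hδ1, Nat.succ_pos _, ?_, hMk, ?_, ?_, ?_⟩
  · refine hMk.trans ?_
    rw [← pow_mul, ← Real.rpow_natCast, hy, ← hx4]
    refine Real.rpow_le_rpow_of_exponent_le (by norm_num) ?_
    push_cast
    have h1 := mul_le_mul_of_nonneg_left hIlow (Nat.cast_nonneg (α := ℝ) a)
    have h3 := mul_le_mul_of_nonneg_right ha hlog
    linarith
  · have hR : (((M + 1) ^ k + 1 : ℕ) : ℝ) ≤ 2 * y := by
      push_cast at hMk ⊢
      linarith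
    have h1 : (1 - x ^ (-(1 + θ))) ^ M ≤ Real.exp (-x ^ (2 * θ)) := by
      refine (one_sub_pow_le_exp hδ1 M).trans (Real.exp_le_exp.2 (neg_le_neg ?_))
      have h3 := mul_le_mul_of_nonneg_right hMlow (by positivity : 0 ≤ x ^ (-(1 + θ)))
      rw [← Real.rpow_add hx0] at h3
      refine le_trans (le_of_eq ?_) h3
      congr 1; ring
    have h4 : (((M + 1) ^ k + 1 : ℕ) : ℝ) ^ 2 * (1 - x ^ (-(1 + θ))) ^ M ≤
        4 * (x ^ (2 * (k + η)) * Real.exp (-x ^ (2 * θ))) := by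
      have h5 : 4 * (x ^ (2 * (k + η)) * Real.exp (-x ^ (2 * θ))) =
          (2 * y) ^ 2 * Real.exp (-x ^ (2 * θ)) := by
        rw [hy, mul_comm (2 : ℝ) (k + η), Real.rpow_mul hx0.le, Real.rpow_two]; ring
      rw [h5]
      exact mul_le_mul (pow_le_pow_left₀ (by positivity) hR 2) h1
        (pow_nonneg (by linarith) _) (by positivity)
    have h6 : (M : ℝ) * ((M + 1) ^ k + 1 : ℕ) * (s * x⁻¹ ^ e) ≤
        x ^ (5 : ℝ) * (2 * y) * (s * x ^ (-(k + η + 7))) := by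
      refine mul_le_mul (mul_le_mul ?_ hR (Nat.cast_nonneg _) (by positivity))
        (mul_le_mul_of_nonneg_left hxe' (Nat.cast_nonneg _)) (by positivity) (by positivity)
      refine le_trans ?_ (Real.rpow_le_rpow_of_exponent_le hx1 (by linarith : 1 + 4 * θ ≤ 5))
      linarith
    have h7 : x ^ (5 : ℝ) * (2 * y) * (s * x ^ (-(k + η + 7))) = 2 * s * x ^ (-2 : ℝ) := by
      have : x ^ (5 : ℝ) * y * x ^ (-(k + η + 7)) = x ^ (-2 : ℝ) := by
        rw [hy, ← Real.rpow_add hx0, ← Real.rpow_add hx0]; congr 1; ring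
      rw [← this]; ring
    have h8 : 2 * s * x ^ (-2 : ℝ) < 1 / 2 := by
      rw [Real.rpow_neg hx0.le, Real.rpow_two, ← div_eq_mul_inv, div_lt_iff₀ (by positivity)]
      nlinarith
    linarith
  · have h1 : (4 : ℝ) ^ I ≤ 4 * x ^ (θ / 4) := by
      rw [← Real.rpow_natCast, ← hx4, mul_comm (4 : ℝ)]
      rw [← Real.rpow_add_one (by norm_num)]
      exact Real.rpow_le_rpow_of_exponent_le (by norm_num) hIup
    have h3 : 10 * (p : ℝ) * 4 ^ a * 4 ^ I * x ^ (-(1 + θ)) ≤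
        10 * p * 4 ^ a * (4 * x ^ (θ / 4)) * x ^ (-(1 + θ)) :=
      mul_le_mul_of_nonneg_right (mul_le_mul_of_nonneg_left h1 (by positivity)) (by positivity)
    refine h3.trans ?_
    have h4 : x ^ (θ / 4) * x ^ (-(1 + θ)) * x ^ (3 * θ / 4) = x⁻¹ := by
      rw [← Real.rpow_add hx0, ← Real.rpow_add hx0, ← Real.rpow_neg_one]; congr 1; ring
    have h5 := mul_le_mul_of_nonneg_left hxp
      (by positivity : 0 ≤ x ^ (θ / 4) * x ^ (-(1 + θ)))
    rw [h4] at h5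
    linarith
  · refine hxe'.trans ?_
    have h1 : x ^ (-(k + η + 7)) ≤ x ^ (-2 : ℝ) :=
      Real.rpow_le_rpow_of_exponent_le hx1 (by linarith)
    refine h1.trans ?_
    rw [Real.rpow_neg hx0.le, Real.rpow_two, div_eq_mul_inv, sq, mul_inv]
    exact mul_le_mul_of_nonneg_left (inv_anti₀ (by norm_num) hx2) (by positivity)

end Parameters

section Bounds

open Filter Topology

/-- The number of quadratic functions is at most exponential in the uniformity parameter. -/
lemma one_div_corrConst_sq_le {p : ℕ} (hp : 2 ≤ p) {ε : ℝ} (hε : 0 < ε) (hε1 : ε ≤ 1) :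
    1 / corrConst p ε ^ 2 ≤
      (p : ℝ) ^ (66 * (4096 * 32 ^ 10 + 1) ^ 5 * ε⁻¹ ^ 200 : ℝ) := by
  have hp1 : (1 : ℝ) ≤ p := by exact_mod_cast (by omega : 1 ≤ p)
  have hp0 : (0 : ℝ) < p := by linarith
  set v := ε⁻¹ with hv
  have hv1 : 1 ≤ v := (one_le_inv₀ hε).2 hε1
  have hεv : ε = v⁻¹ := by rw [hv, inv_inv]
  set D := doublingConst ε with hD
  have hD0 : 0 < D := doublingConst_pos hε
  have hDup : (D : ℝ) ≤ (4096 * 32 ^ 10 + 1) * v ^ 40 := by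
    have h1 : (D : ℝ) < 4096 / (ε ^ 4 / 32) ^ 10 + 1 := Nat.ceil_lt_add_one (by positivity)
    have h3 : 4096 / (ε ^ 4 / 32) ^ 10 = 4096 * 32 ^ 10 * v ^ 40 := by
      rw [hεv]; field_simp
    have h4 : 1 ≤ v ^ 40 := one_le_pow₀ hv1
    rw [h3] at h1
    linarith
  have hDlow : v ^ 5 ≤ D := by
    have h1 : 4096 / (ε ^ 4 / 32) ^ 10 ≤ (D : ℝ) := Nat.le_ceil _
    have h3 : 4096 / (ε ^ 4 / 32) ^ 10 = 4096 * 32 ^ 10 * v ^ 40 := by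
      rw [hεv]; field_simp
    have h4 : v ^ 5 ≤ v ^ 40 := pow_le_pow_right₀ hv1 (by norm_num)
    have h5 : 1 ≤ v ^ 40 := one_le_pow₀ hv1
    rw [h3] at h1
    linarith
  have h1 : 1 / corrConst p ε ^ 2 = (256 * v ^ 5 * (p ^ D ^ 5 * D)) ^ 6 := by
    rw [corrConst, affineConst, ← hD, hεv]
    push_cast
    field_simp
    ring
  have hDp : (D : ℝ) ≤ (p : ℝ) ^ D := by
    have : D < p ^ D := Nat.lt_pow_self hp
    exact_mod_cast this.le
  have h256 : (256 : ℝ) ≤ (p : ℝ) ^ 8 := by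
    have h : (2 : ℝ) ^ 8 ≤ (p : ℝ) ^ 8 :=
      pow_le_pow_left₀ (by norm_num) (by exact_mod_cast hp) 8
    linarith
  have h3 : 256 * v ^ 5 * ((p : ℝ) ^ D ^ 5 * D) ≤ (p : ℝ) ^ (11 * D ^ 5) := by
    calc 256 * v ^ 5 * ((p : ℝ) ^ D ^ 5 * D)
        ≤ (p : ℝ) ^ 8 * (p : ℝ) ^ D * ((p : ℝ) ^ D ^ 5 * (p : ℝ) ^ D) :=
          mul_le_mul (mul_le_mul h256 (hDlow.trans hDp) (by positivity) (by positivity))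
            (mul_le_mul_of_nonneg_left hDp (by positivity)) (by positivity) (by positivity)
      _ = (p : ℝ) ^ (8 + D + (D ^ 5 + D)) := by rw [← pow_add, ← pow_add, ← pow_add]
      _ ≤ (p : ℝ) ^ (11 * D ^ 5) := by
          refine pow_le_pow_right₀ hp1 ?_
          have h4 : D ≤ D ^ 5 := Nat.le_self_pow (by norm_num) D
          omega
  rw [h1]
  refine (pow_le_pow_left₀ (by positivity) h3 6).trans ?_
  rw [← pow_mul, ← Real.rpow_natCast]
  refine Real.rpow_le_rpow_of_exponent_le hp1 ?_
  push_cast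
  have h6 : (D : ℝ) ^ 5 ≤ (4096 * 32 ^ 10 + 1) ^ 5 * v ^ 200 := by
    refine (pow_le_pow_left₀ (Nat.cast_nonneg _) hDup 5).trans (le_of_eq ?_)
    rw [mul_pow, ← pow_mul]
  linarith

lemma inv_uniformityParam_le (m e : ℕ) : ∃ E : ℕ, ∀ᶠ x : ℝ in atTop,
    uniformityParam m (x⁻¹ ^ e / 2) ≤ 1 ∧ (uniformityParam m (x⁻¹ ^ e / 2))⁻¹ ≤ x ^ E := by
  set s := patternSize m with hs
  refine ⟨16 * e * s + 1, ?_⟩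
  filter_upwards [eventually_ge_atTop ((2 : ℝ) ^ (16 * s) * (s + 1) ^ 8)] with x hx
  have hx1 : 1 ≤ x := by
    refine le_trans ?_ hx
    exact one_le_mul_of_one_le_of_one_le (one_le_pow₀ (by norm_num))
      (one_le_pow₀ (by linarith [Nat.cast_nonneg (α := ℝ) s]))
  have hx0 : 0 < x := by linarith
  have hinv : x⁻¹ ^ e ≤ 1 := pow_le_one₀ (by positivity) (inv_le_one_of_one_le₀ hx1)
  have h : (uniformityParam m (x⁻¹ ^ e / 2))⁻¹ =
      (2 : ℝ) ^ (16 * s) * (s + 1) ^ 8 * x ^ (16 * e * s) := by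
    rw [uniformityParam, ← hs]
    have h1 : (x⁻¹ ^ e / 2) ^ (2 * s) = (2 ^ (2 * s) * x ^ (2 * e * s))⁻¹ := by
      rw [inv_pow, div_pow, inv_pow, ← pow_mul, mul_inv, div_eq_mul_inv, mul_comm,
        show 2 * e * s = e * (2 * s) by ring]
    rw [h1, ← inv_pow, inv_div, div_inv_eq_mul, mul_pow, mul_pow, ← pow_mul, ← pow_mul,
      show 2 * s * 8 = 16 * s by ring, show 2 * e * s * 8 = 16 * e * s by ring]
    ring
  refine ⟨?_, ?_⟩
  · unfold uniformityParam
    refine pow_le_one₀ (by positivity) (div_le_one_of_le₀ ?_ (by positivity))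
    exact (pow_le_one₀ (by positivity) (by linarith)).trans (by
      linarith [Nat.cast_nonneg (α := ℝ) (patternSize m)])
  · rw [h, pow_succ' x]
    exact mul_le_mul_of_nonneg_right hx (by positivity)

lemma one_div_corrConst_le_rpow {p : ℕ} (hp : 2 ≤ p) (m e : ℕ) : ∃ E : ℕ, ∀ᶠ x : ℝ in atTop,
    1 / corrConst p (uniformityParam m (x⁻¹ ^ e / 2)) ^ 2 ≤ (p : ℝ) ^ (x ^ E) := by
  obtain ⟨E, hE⟩ := inv_uniformityParam_le m e
  refine ⟨E * 200 + 1, ?_⟩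
  filter_upwards [hE, eventually_ge_atTop (66 * (4096 * 32 ^ 10 + 1) ^ 5 : ℝ)] with x hx hxC
  have hx0 : 0 < x := lt_of_lt_of_le (by positivity) hxC
  have hp1 : (1 : ℝ) ≤ p := by exact_mod_cast (by omega : 1 ≤ p)
  have hu := uniformityParam_pos m (δ := x⁻¹ ^ e / 2) (by positivity)
  refine (one_div_corrConst_sq_le hp hu hx.1).trans (Real.rpow_le_rpow_of_exponent_le hp1 ?_)
  rw [pow_succ' x, pow_mul x]
  exact mul_le_mul hxC (pow_le_pow_left₀ (by positivity) hx.2 200) (by positivity) hx0.le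

lemma mul_iterate_le {F : ℕ → ℕ} {C d : ℕ} (hC : 1 ≤ C) (hF : ∀ t, 1 ≤ t → F t ≤ C * t ^ d)
    (hF' : ∀ t, t ≤ F t) (hd : 1 ≤ d) {t : ℕ} (ht : 1 ≤ t) (i : ℕ) :
    t ≤ F^[i] t ∧ C * F^[i] t ≤ (C * t) ^ (d + 1) ^ i := by
  induction i with
  | zero => simp
  | succ i ih =>
    rw [Function.iterate_succ_apply']
    refine ⟨ih.1.trans (hF' _), ?_⟩
    have h1 := hF _ (ht.trans ih.1)
    set u := F^[i] t with hu
    calc C * F u ≤ C * (C * u ^ d) := Nat.mul_le_mul_left _ h1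
      _ ≤ (C * u) ^ (d + 1) := by
          rw [mul_pow, ← mul_assoc]
          refine Nat.mul_le_mul ?_ (Nat.pow_le_pow_right (ht.trans ih.1) (by omega))
          rw [← sq]
          exact Nat.pow_le_pow_right hC (by omega)
      _ ≤ ((C * t) ^ (d + 1) ^ i) ^ (d + 1) := Nat.pow_le_pow_left ih.2 _
      _ = (C * t) ^ (d + 1) ^ (i + 1) := by rw [← pow_mul, pow_succ]

lemma iterate_le_pow {p : ℕ} (hp : 2 ≤ p) {F : ℕ → ℕ} {C d : ℕ} (hC : 1 ≤ C)
    (hF : ∀ t, 1 ≤ t → F t ≤ C * t ^ d) (hF' : ∀ t, t ≤ F t) (hd : 1 ≤ d) (r : ℕ) :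
    F^[r] (2 * r) ≤ p ^ p ^ ((2 * C + d + 1) * r) := by
  rcases Nat.eq_zero_or_pos r with rfl | hr
  · simp
  have h1 := (mul_iterate_le hC hF hF' hd (t := 2 * r) (by omega) r).2
  have h3 : C * (2 * r) ≤ p ^ (C * (2 * r)) := (Nat.lt_pow_self hp).le
  have h4 : d + 1 ≤ p ^ (d + 1) := (Nat.lt_pow_self hp).le
  calc F^[r] (2 * r) ≤ C * F^[r] (2 * r) := Nat.le_mul_of_pos_left _ hC
    _ ≤ (C * (2 * r)) ^ (d + 1) ^ r := h1
    _ ≤ (p ^ (C * (2 * r))) ^ (d + 1) ^ r := Nat.pow_le_pow_left h3 _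
    _ = p ^ (C * (2 * r) * (d + 1) ^ r) := by rw [← pow_mul]
    _ ≤ p ^ p ^ ((2 * C + d + 1) * r) := by
        refine Nat.pow_le_pow_right (by omega) ?_
        calc C * (2 * r) * (d + 1) ^ r ≤ p ^ (C * (2 * r)) * (p ^ (d + 1)) ^ r :=
              Nat.mul_le_mul h3 (Nat.pow_le_pow_left h4 r)
          _ = p ^ ((2 * C + d + 1) * r) := by rw [← pow_mul, ← pow_add]; congr 1; ring

lemma patternRank_le {p : ℕ} (hp : 2 ≤ p) (m : ℕ) : ∃ c : ℕ, 1 ≤ c ∧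
    ∀ ℓ q, patternRank p m ℓ q ≤ p ^ (c * (ℓ + q) + c) := by
  set s := 2 * m + 2 ^ (m * m) with hs
  have hs1 : 1 ≤ s := le_add_left Nat.one_le_two_pow
  refine ⟨s ^ 2 + 2 * (1 + patternSize m), by omega, fun ℓ q => ?_⟩
  rw [patternRank, ← hs]
  calc 2 * (1 + patternSize m) * p ^ (s * ℓ + s ^ 2 * q)
      ≤ p ^ (2 * (1 + patternSize m)) * p ^ (s * ℓ + s ^ 2 * q) :=
        Nat.mul_le_mul_right _ (Nat.lt_pow_self hp).le
    _ = p ^ (2 * (1 + patternSize m) + (s * ℓ + s ^ 2 * q)) :=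
        (pow_add _ _ _).symm
    _ ≤ _ := by
        refine Nat.pow_le_pow_right (by omega) ?_
        have h1 : s * ℓ ≤ s ^ 2 * ℓ := Nat.mul_le_mul_right _ (Nat.le_self_pow (by norm_num) s)
        nlinarith [Nat.zero_le (2 * (1 + patternSize m) * (ℓ + q)), Nat.zero_le (s ^ 2)]

/-- A monotone integer valued rank requirement dominating a growth function and a linear
function. -/
lemma exists_rank_function {ρ : ℝ → ℝ} (hρ : GrowthFunction ρ) {d : ℕ} (hd : 1 ≤ d)
    (hρd : PolyBound ρ d) (c : ℕ) :
    ∃ (σ : ℕ → ℕ) (C : ℕ), Monotone σ ∧ 1 ≤ C ∧ (∀ t : ℕ, ρ t ≤ σ t) ∧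
      (∀ t, 2 * (c * t + c) < σ t) ∧ ∀ t, 1 ≤ t → t + σ t ≤ C * t ^ d := by
  obtain ⟨C, hC, hρC⟩ := hρd
  obtain ⟨C', hC'⟩ := exists_nat_ge C
  refine ⟨fun t => ⌈ρ t⌉₊ + 2 * (c * t + c) + 1, C' + 4 * c + 3, fun a b hab => ?_, by omega,
    fun t => ?_, fun t => Nat.lt_succ_of_le (Nat.le_add_left _ _),
    fun t ht => ?_⟩
  · have h1 : ⌈ρ a⌉₊ ≤ ⌈ρ b⌉₊ := Nat.ceil_mono (hρ.1 (Nat.cast_le.2 hab))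
    have h3 : c * a ≤ c * b := Nat.mul_le_mul_left c hab
    change ⌈ρ a⌉₊ + 2 * (c * a + c) + 1 ≤ ⌈ρ b⌉₊ + 2 * (c * b + c) + 1
    omega
  · push_cast
    have := Nat.le_ceil (ρ t)
    have h3 : (0 : ℝ) ≤ 2 * ((c : ℝ) * t + c) := by positivity
    linarith
  · have h1 : ⌈ρ t⌉₊ ≤ C' * t ^ d := by
      refine Nat.ceil_le.2 ((hρC t (by exact_mod_cast ht)).trans ?_)
      push_cast
      exact mul_le_mul_of_nonneg_right hC' (by positivity)
    have h3 : t ≤ t ^ d := Nat.le_self_pow (by omega) t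
    have h4 : c * t ≤ c * t ^ d := Nat.mul_le_mul_left c h3
    have h5 : c * 1 ≤ c * t ^ d := Nat.mul_le_mul_left c (ht.trans h3)
    have h6 : (C' + 4 * c + 3) * t ^ d = C' * t ^ d + 4 * (c * t ^ d) + 3 * t ^ d := by ring
    have h7 : 1 ≤ t ^ d := ht.trans h3
    change t + (⌈ρ t⌉₊ + 2 * (c * t + c) + 1) ≤ _
    rw [h6]
    omega

end Bounds

section Assembly

variable {p n ℓ q : ℕ}

lemma le_rank [Fact p.Prime] (B : QuadFactor p n ℓ q) {y : ℝ} (h0 : q = 0 → y ≤ n)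
    (h : ∀ c : Fin q → ZMod p, c ≠ 0 → y ≤ ((∑ j, c j • B.Q j).rank : ℝ)) : y ≤ (B.rank : ℝ) := by
  unfold QuadFactor.rank
  split_ifs with hq
  · exact h0 hq
  · by_cases hne : ((fun c : Fin q → ZMod p => (∑ j, c j • B.Q j).rank) '' {c | c ≠ 0}).Nonempty
    · obtain ⟨c, hc, hcr⟩ := Nat.sInf_mem hne
      exact (h c hc).trans_eq (congrArg Nat.cast hcr)
    · refine absurd (Set.Nonempty.image _ ⟨fun _ => 1, fun h1 => ?_⟩) hne
      exact one_ne_zero (congrFun h1 ⟨0, Nat.pos_of_ne_zero hq⟩)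

lemma le_tower (hp : 2 ≤ p) {G r E : ℕ} {x : ℝ} (hr : (r : ℝ) ≤ (p : ℝ) ^ (x ^ E))
    (hx : (G : ℝ) + 1 ≤ x) (hℓ : ℓ ≤ p ^ p ^ (G * r)) :
    (ℓ : ℝ) ≤ (p : ℝ) ^ ((p : ℝ) ^ ((p : ℝ) ^ (x ^ (E + 1)))) := by
  have hp1 : (1 : ℝ) ≤ p := by exact_mod_cast (by omega : 1 ≤ p)
  have hp0 : (0 : ℝ) < p := by linarith
  have hG : (0 : ℝ) ≤ G := Nat.cast_nonneg G
  have h1 : (ℓ : ℝ) ≤ (p : ℝ) ^ ((p : ℝ) ^ ((G * r : ℕ) : ℝ)) := by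
    have h3 : ((p ^ p ^ (G * r) : ℕ) : ℝ) = (p : ℝ) ^ ((p : ℝ) ^ ((G * r : ℕ) : ℝ)) := by
      rw [Real.rpow_natCast, ← Nat.cast_pow p, Real.rpow_natCast, ← Nat.cast_pow]
    rw [← h3]; exact Nat.cast_le.2 hℓ
  refine h1.trans (Real.rpow_le_rpow_of_exponent_le hp1 (Real.rpow_le_rpow_of_exponent_le hp1 ?_))
  have hGp : (G : ℝ) ≤ (p : ℝ) ^ (G : ℝ) := by
    rw [Real.rpow_natCast]; exact_mod_cast (Nat.lt_pow_self hp).le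
  have hxE : 1 ≤ x ^ E := one_le_pow₀ (by linarith)
  calc ((G * r : ℕ) : ℝ) = G * r := by push_cast; rfl
    _ ≤ (p : ℝ) ^ (G : ℝ) * (p : ℝ) ^ (x ^ E) :=
      mul_le_mul hGp hr (Nat.cast_nonneg _) (by positivity)
    _ = (p : ℝ) ^ (G + x ^ E) := (Real.rpow_add hp0 _ _).symm
    _ ≤ (p : ℝ) ^ (x ^ (E + 1)) := by
      refine Real.rpow_le_rpow_of_exponent_le hp1 ?_
      rw [pow_succ']
      nlinarith

lemma le_rpow_self (hp : 2 ≤ p) (z : ℝ) : z ≤ (p : ℝ) ^ z := by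
  have hp1 : (1 : ℝ) ≤ p := by exact_mod_cast (by omega : 1 ≤ p)
  obtain hz | hz := le_total z 0
  · exact hz.trans (Real.rpow_nonneg (by linarith) _)
  · have h1 : ((⌊z⌋₊ + 1 : ℕ) : ℝ) ≤ ((p ^ ⌊z⌋₊ : ℕ) : ℝ) := Nat.cast_le.2 (Nat.lt_pow_self hp)
    calc z ≤ ((⌊z⌋₊ + 1 : ℕ) : ℝ) := by push_cast; exact (Nat.lt_floor_add_one z).le
      _ ≤ (p : ℝ) ^ (⌊z⌋₊ : ℝ) := by rw [Real.rpow_natCast]; exact_mod_cast h1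
      _ ≤ (p : ℝ) ^ z := Real.rpow_le_rpow_of_exponent_le hp1 (Nat.floor_le hz)

lemma le_mul_logb (hp : 2 ≤ p) {x s : ℝ} (hx : 0 < x) (h : ((p ^ q : ℕ) : ℝ) ≤ x ^ s) :
    (q : ℝ) ≤ s * Real.logb p x := by
  have hp1 : (1 : ℝ) < p := by exact_mod_cast (by omega : 1 < p)
  rw [← Real.logb_rpow_eq_mul_logb_of_pos hx, Real.le_logb_iff_rpow_le hp1 (by positivity),
    Real.rpow_natCast]
  exact_mod_cast h

lemma card_filter_mem_eq_ncard {α : Type*} [Fintype α] (D : Set α) : #{x | x ∈ D} = D.ncard := by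
  rw [← Set.ncard_coe_finset]
  congr 1
  ext x
  simp

lemma ncard_symmDiff_le {α : Type*} [Fintype α] (A Y Z : Set α) :
    (A ∆ Z).ncard ≤ (A ∆ Y).ncard + #{x | ¬(x ∈ Y ↔ x ∈ Z)} := by
  rw [← card_filter_mem_eq_ncard, ← card_filter_mem_eq_ncard]
  refine (card_le_card fun x hx => ?_).trans (card_union_le _ _)
  simp only [mem_union, mem_filter, mem_univ, true_and, Set.mem_symmDiff] at hx ⊢
  tauto

end Assembly

theorem statement0 (p : ℕ) (hp : p.Prime) (hodd : Odd p)
    (k : ℕ) (hk : 1 ≤ k) (η : ℝ) (hη : 0 < η)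
    (ρ : ℝ → ℝ) (hρ : GrowthFunction ρ) (d : ℕ) (hd : PolyGrowthDegree ρ d) :
    ∃ c > (0 : ℝ), ∃ C > (0 : ℝ), ∃ δ₀ > (0 : ℝ), ∀ δ : ℝ, 0 < δ → δ < δ₀ →
      ∃ N : ℕ, ∀ n : ℕ, N ≤ n → ∀ A : Set (Vec p n), VC2dimLE A k →
        ∃ (ℓ q : ℕ) (B : QuadFactor p n ℓ q),
          ρ ((ℓ : ℝ) + (q : ℝ)) ≤ (B.rank : ℝ) ∧
          (ℓ : ℝ) ≤ (p : ℝ) ^ ((p : ℝ) ^ ((p : ℝ) ^ ((p : ℝ) ^ (C * δ ^ (-c))))) ∧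
          (q : ℝ) ≤ ((k : ℝ) + η) * Real.logb p δ⁻¹ ∧
          (∃ S : Set (Label p ℓ q),
            (((A ∆ (⋃ ab ∈ S, B.atom ab))).ncard : ℝ) ≤ δ * (p : ℝ) ^ n) ∧
          (d = 1 → (ℓ : ℝ) ≤ (p : ℝ) ^ ((p : ℝ) ^ ((p : ℝ) ^ (C * δ ^ (-c))))) := by
  have : Fact p.Prime := ⟨hp⟩
  have hp2 : 2 ≤ p := hp.two_le
  have h2 : (2 : ZMod p) ≠ 0 := by
    intro h
    have h' : ((2 : ℕ) : ZMod p) = 0 := by exact_mod_cast h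
    rw [ZMod.natCast_eq_zero_iff] at h'
    have := Nat.le_of_dvd (by norm_num) h'
    have hp2' : p = 2 := by omega
    rw [hp2'] at hodd
    exact absurd hodd (by decide)
  have hp1 : (1 : ℝ) ≤ p := by exact_mod_cast (by omega : 1 ≤ p)
  obtain ⟨e, K, hK, hpar⟩ := exists_reduction_parameters p (4 * patternSize (k + 1)) hk hη
  obtain ⟨c, hc, hpat⟩ := patternRank_le hp2 (k + 1)
  obtain ⟨σ, C, hσ, hC, hρσ, hσc, hσC⟩ := exists_rank_function hρ hd.1 hd.2.1 c
  obtain ⟨E, hE⟩ := one_div_corrConst_le_rpow hp2 (k + 1) e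
  obtain ⟨x₀, hx₀⟩ := Filter.eventually_atTop.1
    (hpar.and (hE.and (Filter.eventually_ge_atTop (((2 * C + d + 1 : ℕ) : ℝ) + 1))))
  refine ⟨(E + 1 : ℕ), by positivity, 1, one_pos, (max x₀ 1)⁻¹, by positivity,
    fun δ hδ hδx => ?_⟩
  obtain ⟨x, rfl⟩ : ∃ x : ℝ, δ = x⁻¹ := ⟨δ⁻¹, (inv_inv δ).symm⟩
  rw [inv_inv]
  have hx : 0 < x := inv_pos.1 hδ
  have hxx₀ : x₀ ≤ x :=
    (le_max_left _ _).trans ((inv_lt_inv₀ hx (by positivity)).1 hδx).le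
  obtain ⟨⟨M, I, δ₁, hδ₁, hδ₁', hI, hMI, hMη, hM, hKδ, heδ⟩, hxE, hxC⟩ := hx₀ x hxx₀
  have hxpow : 1 * x⁻¹ ^ (-((E + 1 : ℕ) : ℝ)) = x ^ (E + 1) := by
    rw [one_mul, Real.inv_rpow hx.le, Real.rpow_neg hx.le, inv_inv, Real.rpow_natCast]
  rw [hxpow]
  set y : ℝ := (p : ℝ) ^ ((p : ℝ) ^ ((p : ℝ) ^ (x ^ (E + 1)))) with hy
  refine ⟨⌈ρ y⌉₊, fun n hn A hA => ?_⟩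
  have hA' : ¬HasVC2Dim A (k + 1) := fun h => absurd (hA _ h) (by omega)
  have hcardV : (Fintype.card (Vec p n) : ℝ) = (p : ℝ) ^ n := by
    simp [Vec, ZMod.card]
  obtain ⟨r, Ms, b, Y, hr, hMs, hY, hAY⟩ := exists_quadratic_approximation h2 (Nat.succ_pos k) hA'
    (δ := x⁻¹ ^ e / 2) (by positivity)
  rw [mul_div_cancel₀ _ (two_ne_zero)] at hAY
  obtain ⟨ℓ, q, B, S, -, hℓ, hB, rfl⟩ := exists_high_rank_factor hσ Ms b hMs Y hY
  have hσc' := hσc (ℓ + q)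
  obtain ⟨q', B', S', hq', hpq', hB', hS'⟩ := exists_reduced_factor h2 B (k := k)
    (t := c * (ℓ + q) + c) (by omega) hσc'.le
    (by have := Nat.mul_le_mul_right (ℓ + q) hc; omega) (hpat ℓ q) hB hA'
    (by rw [card_filter_mem_eq_ncard]; exact hAY) hδ₁ hδ₁' hM hI hK hMI
  have hℓy : (ℓ : ℝ) ≤ y := by
    refine le_tower hp2 (hr.trans hxE) hxC ?_
    exact (Nat.le_add_right ℓ q).trans (hℓ.trans
      (iterate_le_pow hp2 hC hσC (fun t => Nat.le_add_right t _) hd.1 r))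
  refine ⟨ℓ, q', B', ?_, ?_, ?_, ⟨S', ?_⟩, fun _ => hℓy⟩
  · refine le_rank B' (fun hq0 => ?_) fun c hc => ?_
    · subst hq0
      rw [Nat.cast_zero, add_zero]
      exact (hρ.1 hℓy).trans ((Nat.le_ceil _).trans (Nat.cast_le.2 hn))
    · refine (hρ.1 ?_).trans ((hρσ (ℓ + q)).trans (Nat.cast_le.2 (hB' c hc)))
      push_cast
      have : (q' : ℝ) ≤ q := Nat.cast_le.2 hq'
      linarith
  · refine hℓy.trans ?_
    exact Real.rpow_le_rpow_of_exponent_le hp1 (Real.rpow_le_rpow_of_exponent_le hp1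
      (Real.rpow_le_rpow_of_exponent_le hp1 (le_rpow_self hp2 _)))
  · exact le_mul_logb hp2 hx ((Nat.cast_le.2 hpq').trans hMη)
  · have h1 : (⋃ ab ∈ S', B'.atom ab) = {x | B'.betaB x ∈ S'} := by
      ext z
      simp [QuadFactor.atom]
    rw [h1]
    have h3 := ncard_symmDiff_le A {z | B.betaB z ∈ S} {z | B'.betaB z ∈ S'}
    have h4 : ((A ∆ {z | B'.betaB z ∈ S'}).ncard : ℝ) ≤ (A ∆ {z | B.betaB z ∈ S}).ncard +
        #{z | ¬(B.betaB z ∈ S ↔ B'.betaB z ∈ S')} := by exact_mod_cast h3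
    rw [← hcardV]
    have h5 := mul_le_mul_of_nonneg_right hKδ (Nat.cast_nonneg (α := ℝ) (Fintype.card (Vec p n)))
    have h6 := mul_le_mul_of_nonneg_right heδ (Nat.cast_nonneg (α := ℝ) (Fintype.card (Vec p n)))
    linarith

end PaperTS
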